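/- The bounded-time verification problem for HCMTL* in the point-based semantics is decidable: there is an algorithm that, given a point-based timed automaton B, an HCMTL* sentence φ, and a time bound N ∈ ℕ with N > 0, decides whether {}, 0, ε ⊨^N_B φ under the point-based semantics. -/

import Mathlib

namespace HyTime

/-! ### Comparisons and clock constraints -/

/-- Comparison operators `<, ≤, =, ≥, >` used in clock constraints. -/
inductive Cmp where
  | lt | le | eq | ge | gt
  deriving DecidableEq

def Cmp.denote : Cmp → ℝ → ℝ → Prop
  | .lt => fun a b => a < b
  | .le => fun a b => a ≤ b
  | .eq => fun a b => a = b
  | .ge => fun a b => b ≤ a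
  | .gt => fun a b => b < a

def Cmp.code : Cmp → ℕ
  | .lt => 0
  | .le => 1
  | .eq => 2
  | .ge => 3
  | .gt => 4

/-- Clock constraints over one clock: positive boolean combinations of atoms `x ∼ c`,
where the constants `c` come from `α` (naturals, or rationals). -/
inductive ClkC (α : Type) where
  | atom : Cmp → α → ClkC α
  | disj : ClkC α → ClkC α → ClkC α
  | conj : ClkC α → ClkC α → ClkC α
  deriving DecidableEq

namespace ClkC
variable {α β : Type}

/-- Satisfaction of a clock constraint by a clock value `v : ℝ`;
`toR` interprets the constants as reals. -/
def holds (toR : α → ℝ) (v : ℝ) : ClkC α → Prop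
  | .atom c k => c.denote v (toR k)
  | .disj a b => a.holds toR v ∨ b.holds toR v
  | .conj a b => a.holds toR v ∧ b.holds toR v

/-- A missing constraint (`none`) is the trivial constraint. -/
def holdsOpt (toR : α → ℝ) (v : ℝ) : Option (ClkC α) → Prop
  | none => True
  | some c => c.holds toR v

def map (f : α → β) : ClkC α → ClkC β
  | .atom c k => .atom c (f k)
  | .disj a b => .disj (a.map f) (b.map f)
  | .conj a b => .conj (a.map f) (b.map f)

/-- The list of constants appearing in a clock constraint. -/
def consts : ClkC α → List α
  | .atom _ k => [k]
  | .disj a b => a.consts ++ b.consts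
  | .conj a b => a.consts ++ b.consts

end ClkC

/-- The canonical interpretation of natural-number constants as reals. -/
def natR : ℕ → ℝ := fun n => (n : ℝ)

/-- The canonical interpretation of rational constants as reals. -/
def ratR : ℚ → ℝ := fun q => (q : ℝ)

/-! ### Intervals of reals -/

/-- A bounded real interval, with open/closed information at both endpoints. -/
structure TIvl where
  lo : ℝ
  hi : ℝ
  loC : Bool
  hiC : Bool
  deriving Inhabited

namespace TIvl

/-- Membership of a time point in an interval. -/
def Mem (t : ℝ) (I : TIvl) : Prop :=
  (if I.loC then I.lo ≤ t else I.lo < t) ∧ (if I.hiC then t ≤ I.hi else t < I.hi)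

/-- A well-formed (nonempty) interval: either nondegenerate, or a closed singular interval. -/
def WF (I : TIvl) : Prop :=
  I.lo < I.hi ∨ (I.lo = I.hi ∧ I.loC = true ∧ I.hiC = true)

/-- Two intervals are consecutive: they share the endpoint `R(I) = L(J)`,
which belongs to exactly one of them (hence they are disjoint). -/
def Consecutive (I J : TIvl) : Prop := I.hi = J.lo ∧ I.hiC = !J.loC

end TIvl

/-! ### Timed automata (interval-based) -/

/-- An edge of an interval-based timed automaton:
source, destination, guard (a set of constraints, each over a designated clock), reset set. -/
abbrev IEdge (α : Type) := ℕ × ℕ × List (ℕ × ClkC α) × List ℕ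

/-- A timed automaton `A = (V, V₀, α, X, β, E, V_F)` over atomic propositions `props`.
States, propositions and clocks are natural numbers; all components are finite (lists).
`label` is the state labeling, `beta` assigns to (state, clock) pairs a clock constraint. -/
structure TA (α : Type) where
  states : List ℕ
  init : List ℕ
  props : List ℕ
  clocks : List ℕ
  label : List (ℕ × List ℕ)
  beta : List ((ℕ × ℕ) × ClkC α)
  edges : List (IEdge α)
  final : List ℕ

namespace TA
variable {α β : Type}

def labelOf (A : TA α) (v : ℕ) : List ℕ := (A.label.lookup v).getD []

def betaOf (A : TA α) (v x : ℕ) : Option (ClkC α) :=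
  (A.beta.find? (fun q => q.1.1 == v && q.1.2 == x)).map (·.2)

/-- All constants appearing in the constraints of a timed automaton. -/
def consts (A : TA α) : List α :=
  (A.beta.map (·.2)).flatMap ClkC.consts ++
    A.edges.flatMap (fun e => (e.2.2.1.map (·.2)).flatMap ClkC.consts)

/-- Apply a function to every constant of the automaton. -/
def map (f : α → β) (A : TA α) : TA β where
  states := A.states
  init := A.init
  props := A.props
  clocks := A.clocks
  label := A.label
  beta := A.beta.map (fun q => (q.1, q.2.map f))
  edges := A.edges.map (fun e => (e.1, e.2.1, e.2.2.1.map (fun p => (p.1, p.2.map f)), e.2.2.2))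
  final := A.final

end TA

/-! ### Executions of timed automata -/

/-- The raw data of an execution `(v₁,I₁) →^{γ₁}_{Ψ₁} ⋯ →^{γ_{n-1}}_{Ψ_{n-1}} (vₙ,Iₙ)`. -/
structure RawExec (α : Type) where
  states : List ℕ
  ivls : List TIvl
  guards : List (List (ℕ × ClkC α))
  resets : List (List ℕ)
  deriving Inhabited

namespace RawExec
variable {α : Type}

def n (ρ : RawExec α) : ℕ := ρ.states.length
def ivl (ρ : RawExec α) (i : ℕ) : TIvl := ρ.ivls.getD i default
def state (ρ : RawExec α) (i : ℕ) : ℕ := ρ.states.getD i 0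
def reset (ρ : RawExec α) (i : ℕ) : List ℕ := ρ.resets.getD i []
def guard (ρ : RawExec α) (i : ℕ) : List (ℕ × ClkC α) := ρ.guards.getD i []

/-- The `i`-th edge taken by the execution. -/
def edge (ρ : RawExec α) (i : ℕ) : IEdge α := (ρ.state i, ρ.state (i+1), ρ.guard i, ρ.reset i)

/-- The clock valuation `μ_{i+1}` when entering the `(i+1)`-st state: clocks start at `0`,
advance with elapsed time, and the clocks reset at a transition are set to `0`. -/
def mu (ρ : RawExec α) : ℕ → ℕ → ℝ
  | 0, _ => 0
  | i+1, x => if x ∈ ρ.reset i then 0 else ρ.mu i x + ((ρ.ivl i).hi - (ρ.ivl i).lo)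

/-- `t ∈ len(ρ)`. -/
def MemLen (t : ℝ) (ρ : RawExec α) : Prop := ∃ i, i < ρ.n ∧ TIvl.Mem t (ρ.ivl i)

/-- `ρ(t) = v`: at time `t` the execution is at state `v`. -/
def StateAt (ρ : RawExec α) (t : ℝ) (v : ℕ) : Prop :=
  ∃ i, i < ρ.n ∧ TIvl.Mem t (ρ.ivl i) ∧ ρ.state i = v

/-- `ρ` is an execution of `A`: consistent lengths, an interval sequence starting at `0`,
an initial state, edges of `A`, state constraints throughout each interval, and
guard constraints at the transition times. -/
def IsExec (toR : α → ℝ) (A : TA α) (ρ : RawExec α) : Prop :=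
  0 < ρ.n ∧ ρ.ivls.length = ρ.n ∧ ρ.guards.length = ρ.n - 1 ∧ ρ.resets.length = ρ.n - 1 ∧
  (ρ.ivl 0).lo = 0 ∧ (ρ.ivl 0).loC = true ∧
  (∀ i, i < ρ.n → (ρ.ivl i).WF) ∧
  (∀ i, i + 1 < ρ.n → (ρ.ivl i).Consecutive (ρ.ivl (i+1))) ∧
  ρ.state 0 ∈ A.init ∧
  (∀ i, i + 1 < ρ.n → ρ.edge i ∈ A.edges) ∧
  (∀ i, i < ρ.n → ∀ x ∈ A.clocks, ∀ t : ℝ, TIvl.Mem t (ρ.ivl i) →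
    ClkC.holdsOpt toR (ρ.mu i x + t - (ρ.ivl i).lo) (A.betaOf (ρ.state i) x)) ∧
  (∀ i, i + 1 < ρ.n → ∀ q ∈ ρ.guard i,
    ClkC.holds toR (ρ.mu i q.1 + (ρ.ivl i).hi - (ρ.ivl i).lo) q.2)

/-- An accepting execution: ends in a final state. -/
def IsAccExec (toR : α → ℝ) (A : TA α) (ρ : RawExec α) : Prop :=
  ρ.IsExec toR A ∧ ρ.state (ρ.n - 1) ∈ A.final

/-- The execution is bounded by `N`: no time point `≥ N` belongs to it. -/
def BoundedBy (ρ : RawExec α) (N : ℝ) : Prop := ∀ t : ℝ, N ≤ t → ¬ MemLen t ρ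

/-- Membership in `Exec(A)` (if `bd = none`) resp. `Exec_N(A)` (if `bd = some N`). -/
def InSem (toR : α → ℝ) (A : TA α) (bd : Option ℝ) (ρ : RawExec α) : Prop :=
  ρ.IsAccExec toR A ∧ ∀ N, bd = some N → ρ.BoundedBy N

/-- Index of the interval containing `t`. -/
noncomputable def idxAt (ρ : RawExec α) (t : ℝ) : ℕ :=
  ρ.ivls.findIdx (fun I => @decide (TIvl.Mem t I) (Classical.propDecidable _))

/-- The prefix `ρ|_t` of an execution up to time `t`:
the last interval is intersected with `[0, t]`. -/
noncomputable def prefixUpTo (ρ : RawExec α) (t : ℝ) : RawExec α :=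
  let i := ρ.idxAt t
  ⟨ρ.states.take (i + 1),
   ρ.ivls.take i ++ [⟨(ρ.ivl i).lo, t, (ρ.ivl i).loC, true⟩],
   ρ.guards.take i, ρ.resets.take i⟩

/-- Two executions are equal up to time `t` if their prefixes up to `t` are identical. -/
def EqUpTo (ρ₁ ρ₂ : RawExec α) (t : ℝ) : Prop := ρ₁.prefixUpTo t = ρ₂.prefixUpTo t

end RawExec

/-! ### HCMTL* syntax -/

/-- An interval annotating a temporal operator: endpoints from `α`, with `hi = none`
denoting `∞`. -/
structure FIvl (α : Type) where
  lo : α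
  hi : Option α
  loC : Bool
  hiC : Bool

namespace FIvl
variable {α β : Type}

/-- `t ∈ base + I`. -/
def Mem (toR : α → ℝ) (base t : ℝ) (I : FIvl α) : Prop :=
  (if I.loC then base + toR I.lo ≤ t else base + toR I.lo < t) ∧
  (∀ h, I.hi = some h → (if I.hiC then t ≤ base + toR h else t < base + toR h))

/-- A singular interval `[c, c]`. -/
def Singular (I : FIvl α) : Prop := I.loC = true ∧ I.hiC = true ∧ I.hi = some I.lo

def map (f : α → β) (I : FIvl α) : FIvl β := ⟨f I.lo, I.hi.map f, I.loC, I.hiC⟩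

def consts (I : FIvl α) : List α := I.lo :: I.hi.toList

end FIvl

/-- HCMTL* formulas in negation normal form:
`φ ::= p_π | ¬p_π | φ ∨ φ | φ ∧ φ | F_I φ | G_I φ | φ U_I φ | ∃π φ | ∀π φ`.
Propositions and path variables are natural numbers; interval endpoints come from `α`. -/
inductive HF (α : Type) where
  | pos : ℕ → ℕ → HF α
  | neg : ℕ → ℕ → HF α
  | disj : HF α → HF α → HF α
  | conj : HF α → HF α → HF α
  | fut : FIvl α → HF α → HF α
  | glob : FIvl α → HF α → HF α
  | untl : FIvl α → HF α → HF α → HF α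
  | ex : ℕ → HF α → HF α
  | all : ℕ → HF α → HF α

namespace HF
variable {α β : Type}

/-- Free path variables. -/
def free : HF α → Finset ℕ
  | .pos _ π => {π}
  | .neg _ π => {π}
  | .disj a b => a.free ∪ b.free
  | .conj a b => a.free ∪ b.free
  | .fut _ a => a.free
  | .glob _ a => a.free
  | .untl _ a b => a.free ∪ b.free
  | .ex π a => a.free.erase π
  | .all π a => a.free.erase π

/-- A sentence has no free path variables. -/
def Sentence (φ : HF α) : Prop := φ.free = ∅

/-- Quantifier-free formulas. -/
def QFree : HF α → Prop
  | .pos _ _ => True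
  | .neg _ _ => True
  | .disj a b => a.QFree ∧ b.QFree
  | .conj a b => a.QFree ∧ b.QFree
  | .fut _ a => a.QFree
  | .glob _ a => a.QFree
  | .untl _ a b => a.QFree ∧ b.QFree
  | .ex _ _ => False
  | .all _ _ => False

/-- All intervals occurring in the formula are non-singular. -/
def NonSing : HF α → Prop
  | .pos _ _ => True
  | .neg _ _ => True
  | .disj a b => a.NonSing ∧ b.NonSing
  | .conj a b => a.NonSing ∧ b.NonSing
  | .fut I a => ¬ I.Singular ∧ a.NonSing
  | .glob I a => ¬ I.Singular ∧ a.NonSing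
  | .untl I a b => ¬ I.Singular ∧ a.NonSing ∧ b.NonSing
  | .ex _ a => a.NonSing
  | .all _ a => a.NonSing

/-- The HyperMITL fragment: all quantifiers at the top level, all intervals non-singular. -/
def HyperMITL : HF α → Prop
  | .ex _ a => a.HyperMITL
  | .all _ a => a.HyperMITL
  | φ => φ.QFree ∧ φ.NonSing

/-- Apply a function to every interval endpoint of the formula. -/
def map (f : α → β) : HF α → HF β
  | .pos p π => .pos p π
  | .neg p π => .neg p π
  | .disj a b => .disj (a.map f) (b.map f)
  | .conj a b => .conj (a.map f) (b.map f)
  | .fut I a => .fut (I.map f) (a.map f)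
  | .glob I a => .glob (I.map f) (a.map f)
  | .untl I a b => .untl (I.map f) (a.map f) (b.map f)
  | .ex π a => .ex π (a.map f)
  | .all π a => .all π (a.map f)

/-- The list of interval endpoints appearing in the formula. -/
def consts : HF α → List α
  | .pos _ _ => []
  | .neg _ _ => []
  | .disj a b => a.consts ++ b.consts
  | .conj a b => a.consts ++ b.consts
  | .fut I a => I.consts ++ a.consts
  | .glob I a => I.consts ++ a.consts
  | .untl I a b => I.consts ++ a.consts ++ b.consts
  | .ex _ a => a.consts
  | .all _ a => a.consts

end HF

/-! ### HCMTL* interval-based semantics -/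

/-- Time bound restriction: with `bd = some N`, only times `< N` are considered. -/
def inBd : Option ℝ → ℝ → Prop
  | none, _ => True
  | some N, t => t < N

/-- The interval-based satisfaction relation `Π, t, † ⊨_A φ` (with `bd = none`),
resp. its time-bounded variant `Π, t, † ⊨^N_A φ` (with `bd = some N`).
`d = none` represents `† = ε`, and `d = some π` represents `† = π`. -/
def HSat {α : Type} (toR : α → ℝ) (A : TA α) (bd : Option ℝ) :
    HF α → (ℕ → RawExec α) → ℝ → Option ℕ → Prop
  | .pos p π, Env, t, _ =>
      RawExec.MemLen t (Env π) ∧ ∃ v, RawExec.StateAt (Env π) t v ∧ p ∈ A.labelOf v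
  | .neg p π, Env, t, _ =>
      RawExec.MemLen t (Env π) ∧ ∃ v, RawExec.StateAt (Env π) t v ∧ p ∉ A.labelOf v
  | .disj a b, Env, t, d => HSat toR A bd a Env t d ∨ HSat toR A bd b Env t d
  | .conj a b, Env, t, d => HSat toR A bd a Env t d ∧ HSat toR A bd b Env t d
  | .fut I a, Env, t, d => ∃ t', t < t' ∧ inBd bd t' ∧ FIvl.Mem toR t t' I ∧
      HSat toR A bd a Env t' d
  | .glob I a, Env, t, d => ∀ t', t < t' → inBd bd t' → FIvl.Mem toR t t' I →
      HSat toR A bd a Env t' d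
  | .untl I a b, Env, t, d => ∃ t', t < t' ∧ inBd bd t' ∧ FIvl.Mem toR t t' I ∧
      HSat toR A bd b Env t' d ∧ ∀ t'', t < t'' → t'' < t' → HSat toR A bd a Env t'' d
  | .ex π a, Env, t, d => ∃ ρ, RawExec.InSem toR A bd ρ ∧
      ((d = none ∧ t = 0) ∨
        ∃ d₀, d = some d₀ ∧ RawExec.MemLen t (Env d₀) ∧ RawExec.EqUpTo ρ (Env d₀) t) ∧
      HSat toR A bd a (Function.update Env π ρ) t (some π)
  | .all π a, Env, t, d => ∀ ρ, RawExec.InSem toR A bd ρ →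
      ((d = none ∧ t = 0) ∨
        ∃ d₀, d = some d₀ ∧ RawExec.MemLen t (Env d₀) ∧ RawExec.EqUpTo ρ (Env d₀) t) →
      HSat toR A bd a (Function.update Env π ρ) t (some π)

/-! ### MSO(<, +1) -/

/-- MSO(<,+1) formulas over monadic predicate names `σ` and first-order variables `ℕ`:
`φ ::= x < y | +1(x,y) | P(x) | φ ∨ φ | ¬φ | ∃x φ | ∃P φ`. -/
inductive MSO (σ : Type) where
  | lt : ℕ → ℕ → MSO σ
  | succ : ℕ → ℕ → MSO σ
  | app : σ → ℕ → MSO σ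
  | disj : MSO σ → MSO σ → MSO σ
  | neg : MSO σ → MSO σ
  | exFO : ℕ → MSO σ → MSO σ
  | exSO : σ → MSO σ → MSO σ

/-- Continuity of a flow at `t` (within the time domain `D`). -/
def ContAt {σ : Type} (D : Set ℝ) (f : ℝ → Set σ) (t : ℝ) : Prop :=
  ∃ ε : ℝ, 0 < ε ∧ ∀ s ∈ D, |s - t| < ε → f s = f t

/-- A flow is finitely variable: on every bounded interval it has only finitely many
discontinuities. -/
def FinVar {σ : Type} (D : Set ℝ) (f : ℝ → Set σ) : Prop :=
  ∀ a b : ℝ, Set.Finite {t | t ∈ D ∩ Set.Icc a b ∧ ¬ ContAt D f t}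

namespace MSO
variable {σ : Type}

/-- Satisfaction `f, I ⊨ φ` of an MSO(<,+1) formula over the time domain `D`,
by a flow `f` and a first-order interpretation `ivar`. Second-order quantification
ranges over finitely variable flows agreeing with `f` except at the quantified predicate. -/
def Sat (D : Set ℝ) : MSO σ → (ℝ → Set σ) → (ℕ → ℝ) → Prop
  | .lt x y, _, ivar => ivar x < ivar y
  | .succ x y, _, ivar => ivar y = ivar x + 1
  | .app P x, f, ivar => P ∈ f (ivar x)
  | .disj a b, f, ivar => Sat D a f ivar ∨ Sat D b f ivar
  | .neg a, f, ivar => ¬ Sat D a f ivar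
  | .exFO x a, f, ivar => ∃ r ∈ D, Sat D a f (Function.update ivar x r)
  | .exSO P a, f, ivar => ∃ g : ℝ → Set σ, FinVar D g ∧
      (∀ t ∈ D, ∀ Q, Q ≠ P → (Q ∈ g t ↔ Q ∈ f t)) ∧ Sat D a g ivar

/-- Free first-order variables. -/
def freeFO : MSO σ → Finset ℕ
  | .lt x y => {x, y}
  | .succ x y => {x, y}
  | .app _ x => {x}
  | .disj a b => a.freeFO ∪ b.freeFO
  | .neg a => a.freeFO
  | .exFO x a => a.freeFO.erase x
  | .exSO _ a => a.freeFO

/-- Free monadic (second-order) predicates. -/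
def freeSO [DecidableEq σ] : MSO σ → Finset σ
  | .lt _ _ => ∅
  | .succ _ _ => ∅
  | .app P _ => {P}
  | .disj a b => a.freeSO ∪ b.freeSO
  | .neg a => a.freeSO
  | .exFO _ a => a.freeSO
  | .exSO P a => a.freeSO.erase P

/-- Purely first-order formulas: no monadic predicates occur at all. -/
def FOonly : MSO σ → Prop
  | .lt _ _ => True
  | .succ _ _ => True
  | .app _ _ => False
  | .disj a b => a.FOonly ∧ b.FOonly
  | .neg a => a.FOonly
  | .exFO _ a => a.FOonly
  | .exSO _ _ => False

end MSO

/-! ### The monadic predicates `MP = V ∪ T ∪ R` and the encoding ι of executions as flows -/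

/-- The monadic predicates associated to a timed automaton: states `v`, transition markers
`T⁻_e`, `T⁺_e` for edges `e`, and reset markers `R⁰_x`, `R¹_x` for clocks `x`. -/
inductive MPred (α : Type) where
  | st : ℕ → MPred α
  | tminus : IEdge α → MPred α
  | tplus : IEdge α → MPred α
  | r0 : ℕ → MPred α
  | r1 : ℕ → MPred α
  deriving DecidableEq

/-- The encoding `ι_A` of an execution as a flow over `MP = V ∪ T ∪ R`:
at each time, the current state; at a `T⁻` transition time `t = L(I_{i+1}) ∈ I_{i+1}`,
the marker `T⁻_e` and resets `R⁰_x` (for the clocks `x` reset by `e`);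
at a `T⁺` transition time `t = R(I_i) ∈ I_i`, the marker `T⁺_e` and resets `R¹_x`;
and `∅` after the execution has ended. -/
def iota {α : Type} (ρ : RawExec α) (t : ℝ) : Set (MPred α) :=
  {mp | match mp with
    | .st v => RawExec.StateAt ρ t v
    | .tminus e => ∃ i, i + 1 < ρ.n ∧ ρ.edge i = e ∧
        t = (ρ.ivl (i+1)).lo ∧ TIvl.Mem t (ρ.ivl (i+1))
    | .tplus e => ∃ i, i + 1 < ρ.n ∧ ρ.edge i = e ∧
        t = (ρ.ivl i).hi ∧ TIvl.Mem t (ρ.ivl i)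
    | .r0 x => ∃ i, i + 1 < ρ.n ∧ x ∈ ρ.reset i ∧
        t = (ρ.ivl (i+1)).lo ∧ TIvl.Mem t (ρ.ivl (i+1))
    | .r1 x => ∃ i, i + 1 < ρ.n ∧ x ∈ ρ.reset i ∧
        t = (ρ.ivl i).hi ∧ TIvl.Mem t (ρ.ivl i)}

/-- The combined flow `f_Π` of a path environment `Π` on path variables `1, …, m`,
over the pairwise disjoint indexed copies `MP_1 ∪ ⋯ ∪ MP_m` (tagged by the index). -/
def fPi (m : ℕ) (Env : ℕ → RawExec ℕ) : ℝ → Set (ℕ × MPred ℕ) :=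
  fun t => {q | 1 ≤ q.1 ∧ q.1 ≤ m ∧ q.2 ∈ iota (Env q.1) t}

end HyTime

namespace HyTime

/-! ### Timed automata in the point-based semantics -/

/-- A transition of a point-based timed automaton: source state, event (a set of
propositions), guard, reset set, destination state. -/
abbrev PEdge (α : Type) := ℕ × List ℕ × List (ℕ × ClkC α) × List ℕ × ℕ

def PEdge.src {α : Type} (e : PEdge α) : ℕ := e.1
def PEdge.event {α : Type} (e : PEdge α) : List ℕ := e.2.1
def PEdge.guard {α : Type} (e : PEdge α) : List (ℕ × ClkC α) := e.2.2.1
def PEdge.rst {α : Type} (e : PEdge α) : List ℕ := e.2.2.2.1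
def PEdge.dst {α : Type} (e : PEdge α) : ℕ := e.2.2.2.2

/-- A timed automaton in the point-based semantics `B = (𝒫(P), S, s₀, X, Δ, F)`. -/
structure PTA (α : Type) where
  states : List ℕ
  start : ℕ
  props : List ℕ
  clocks : List ℕ
  trans : List (PEdge α)
  final : List ℕ

/-- The raw data of a run `(s₀,μ₀) →^{e₁,t₁} ⋯ →^{eₙ,tₙ} (sₙ,μₙ)`:
the transitions taken and their times. -/
structure PRun (α : Type) where
  edges : List (PEdge α)
  times : List ℝ
  deriving Inhabited

namespace PRun
variable {α : Type}

def n (η : PRun α) : ℕ := η.edges.length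
def edge (η : PRun α) (i : ℕ) : PEdge α := η.edges.getD i default
def time (η : PRun α) (i : ℕ) : ℝ := η.times.getD i 0
def tprev (η : PRun α) (i : ℕ) : ℝ := if i = 0 then 0 else η.time (i - 1)

/-- The clock valuation `μ_i` after `i` transitions. -/
def mu (η : PRun α) : ℕ → ℕ → ℝ
  | 0, _ => 0
  | i+1, x => if x ∈ PEdge.rst (η.edge i) then 0 else η.mu i x + (η.time i - η.tprev i)

/-- `η` is a run of `B`: nonempty, increasing nonnegative transition times,
starting at the start state, consecutive transitions of `Δ`, guards holding at
transition times. -/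
def IsRun (toR : α → ℝ) (B : PTA α) (η : PRun α) : Prop :=
  0 < η.n ∧ η.times.length = η.n ∧
  0 ≤ η.time 0 ∧ (∀ i, i + 1 < η.n → η.time i < η.time (i+1)) ∧
  PEdge.src (η.edge 0) = B.start ∧
  (∀ i, i < η.n → η.edge i ∈ B.trans) ∧
  (∀ i, i + 1 < η.n → PEdge.src (η.edge (i+1)) = PEdge.dst (η.edge i)) ∧
  (∀ i, i < η.n → ∀ q ∈ PEdge.guard (η.edge i),
    ClkC.holds toR (η.mu i q.1 + (η.time i - η.tprev i)) q.2)

/-- An accepting run: ends in a final state. -/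
def IsAccRun (toR : α → ℝ) (B : PTA α) (η : PRun α) : Prop :=
  η.IsRun toR B ∧ PEdge.dst (η.edge (η.n - 1)) ∈ B.final

/-- The duration `len(η) = tₙ` of a run. -/
def len (η : PRun α) : ℝ := η.time (η.n - 1)

/-- All transition times are `< N`. -/
def BoundedBy (η : PRun α) (N : ℝ) : Prop := ∀ i, i < η.n → η.time i < N

/-- Membership in `Runs(B)` (if `bd = none`) resp. its bounded variant. -/
def InSem (toR : α → ℝ) (B : PTA α) (bd : Option ℝ) (η : PRun α) : Prop :=
  η.IsAccRun toR B ∧ ∀ N, bd = some N → η.BoundedBy N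

/-- `t ∈ η`: `t` is one of the transition (event) times of `η`. -/
def EvtTime (η : PRun α) (t : ℝ) : Prop := ∃ i, i < η.n ∧ η.time i = t

/-- `η'` is an extension of `η` from time `t`: they agree on all transitions at
times `≤ t`, and all later transitions (of either run) occur after `t`. -/
def ExtendsFrom (η' η : PRun α) (t : ℝ) : Prop :=
  ∃ i, i ≤ η.n ∧ i ≤ η'.n ∧
    η'.edges.take i = η.edges.take i ∧ η'.times.take i = η.times.take i ∧
    (∀ j, j < i → η.time j ≤ t) ∧
    (∀ j, i ≤ j → j < η.n → t < η.time j) ∧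
    (∀ j, i ≤ j → j < η'.n → t < η'.time j)

end PRun

/-! ### HCMTL* point-based semantics -/

/-- The point-based satisfaction relation `Γ, t, † ⊨_B φ` (with `bd = none`),
resp. its time-bounded variant (with `bd = some N`). `V` is the current set of
path variables (the domain of the environment `Γ`); temporal operators range only
over event points of the runs in `Γ`. -/
def PSat {α : Type} (toR : α → ℝ) (B : PTA α) (bd : Option ℝ) :
    HF α → Finset ℕ → (ℕ → PRun α) → ℝ → Option ℕ → Prop
  | .pos p π, _, Γ, t, _ =>
      ∃ i, i < (Γ π).n ∧ (Γ π).time i = t ∧ p ∈ PEdge.event ((Γ π).edge i)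
  | .neg p π, _, Γ, t, _ =>
      ∃ i, i < (Γ π).n ∧ (Γ π).time i = t ∧ p ∉ PEdge.event ((Γ π).edge i)
  | .disj a b, V, Γ, t, d => PSat toR B bd a V Γ t d ∨ PSat toR B bd b V Γ t d
  | .conj a b, V, Γ, t, d => PSat toR B bd a V Γ t d ∧ PSat toR B bd b V Γ t d
  | .fut I a, V, Γ, t, d => ∃ t', t < t' ∧ inBd bd t' ∧ FIvl.Mem toR t t' I ∧
      (∃ π ∈ V, PRun.EvtTime (Γ π) t') ∧ PSat toR B bd a V Γ t' d
  | .glob I a, V, Γ, t, d => ∀ t', t < t' → inBd bd t' → FIvl.Mem toR t t' I →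
      (∃ π ∈ V, PRun.EvtTime (Γ π) t') → PSat toR B bd a V Γ t' d
  | .untl I a b, V, Γ, t, d => ∃ t', t < t' ∧ inBd bd t' ∧ FIvl.Mem toR t t' I ∧
      (∃ π ∈ V, PRun.EvtTime (Γ π) t') ∧ PSat toR B bd b V Γ t' d ∧
      (∀ t'', t < t'' → t'' < t' → (∃ π ∈ V, PRun.EvtTime (Γ π) t'') →
        PSat toR B bd a V Γ t'' d)
  | .ex π a, V, Γ, t, d => ∃ η, PRun.InSem toR B bd η ∧
      ((d = none ∧ t = 0) ∨
        ∃ d₀, d = some d₀ ∧ t ≤ PRun.len (Γ d₀) ∧ PRun.ExtendsFrom η (Γ d₀) t) ∧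
      PSat toR B bd a (insert π V) (Function.update Γ π η) t (some π)
  | .all π a, V, Γ, t, d => ∀ η, PRun.InSem toR B bd η →
      ((d = none ∧ t = 0) ∨
        ∃ d₀, d = some d₀ ∧ t ≤ PRun.len (Γ d₀) ∧ PRun.ExtendsFrom η (Γ d₀) t) →
      PSat toR B bd a (insert π V) (Function.update Γ π η) t (some π)

/-! ### Concrete injective encodings of syntax into ℕ -/

def encList {α : Type} (f : α → ℕ) : List α → ℕ
  | [] => 0
  | a :: l => Nat.pair (f a) (encList f l) + 1

def encClkC : ClkC ℕ → ℕ
  | .atom c k => Nat.pair 0 (Nat.pair c.code k)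
  | .disj a b => Nat.pair 1 (Nat.pair (encClkC a) (encClkC b))
  | .conj a b => Nat.pair 2 (Nat.pair (encClkC a) (encClkC b))

def encGuard (g : List (ℕ × ClkC ℕ)) : ℕ := encList (fun q => Nat.pair q.1 (encClkC q.2)) g

def encIEdge (e : IEdge ℕ) : ℕ :=
  Nat.pair e.1 (Nat.pair e.2.1 (Nat.pair (encGuard e.2.2.1) (encList id e.2.2.2)))

/-- Injective encoding of timed automata as natural numbers. -/
def encTA (A : TA ℕ) : ℕ :=
  Nat.pair (encList id A.states) <| Nat.pair (encList id A.init) <|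
  Nat.pair (encList id A.props) <| Nat.pair (encList id A.clocks) <|
  Nat.pair (encList (fun q => Nat.pair q.1 (encList id q.2)) A.label) <|
  Nat.pair (encList (fun q => Nat.pair (Nat.pair q.1.1 q.1.2) (encClkC q.2)) A.beta) <|
  Nat.pair (encList encIEdge A.edges) (encList id A.final)

def encFIvl (I : FIvl ℕ) : ℕ :=
  Nat.pair I.lo <| Nat.pair (match I.hi with | none => 0 | some h => h + 1) <|
  Nat.pair I.loC.toNat I.hiC.toNat

/-- Injective encoding of HCMTL* formulas as natural numbers. -/
def encHF : HF ℕ → ℕ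
  | .pos p π => Nat.pair 0 (Nat.pair p π)
  | .neg p π => Nat.pair 1 (Nat.pair p π)
  | .disj a b => Nat.pair 2 (Nat.pair (encHF a) (encHF b))
  | .conj a b => Nat.pair 3 (Nat.pair (encHF a) (encHF b))
  | .fut I a => Nat.pair 4 (Nat.pair (encFIvl I) (encHF a))
  | .glob I a => Nat.pair 5 (Nat.pair (encFIvl I) (encHF a))
  | .untl I a b => Nat.pair 6 (Nat.pair (encFIvl I) (Nat.pair (encHF a) (encHF b)))
  | .ex π a => Nat.pair 7 (Nat.pair π (encHF a))
  | .all π a => Nat.pair 8 (Nat.pair π (encHF a))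

def encPEdge (e : PEdge ℕ) : ℕ :=
  Nat.pair (PEdge.src e) <| Nat.pair (encList id (PEdge.event e)) <|
  Nat.pair (encGuard (PEdge.guard e)) <| Nat.pair (encList id (PEdge.rst e)) (PEdge.dst e)

/-- Injective encoding of point-based timed automata as natural numbers. -/
def encPTA (B : PTA ℕ) : ℕ :=
  Nat.pair (encList id B.states) <| Nat.pair B.start <| Nat.pair (encList id B.props) <|
  Nat.pair (encList id B.clocks) <| Nat.pair (encList encPEdge B.trans) (encList id B.final)

/-- Injective encoding of MSO(<,+1) formulas as natural numbers. -/
def encMSO : MSO ℕ → ℕ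
  | .lt x y => Nat.pair 0 (Nat.pair x y)
  | .succ x y => Nat.pair 1 (Nat.pair x y)
  | .app P x => Nat.pair 2 (Nat.pair P x)
  | .disj a b => Nat.pair 3 (Nat.pair (encMSO a) (encMSO b))
  | .neg a => Nat.pair 4 (encMSO a)
  | .exFO x a => Nat.pair 5 (Nat.pair x (encMSO a))
  | .exSO P a => Nat.pair 6 (Nat.pair P (encMSO a))

/-! ### The interval-based automaton ⟦B⟧ associated to a point-based automaton B -/

/-- Code of an original state of `B` as a state of `⟦B⟧`. -/
def stCode (s : ℕ) : ℕ := 2 * s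
/-- Code of a transition of `B` as a (transition-)state of `⟦B⟧`. -/
def edCode (e : PEdge ℕ) : ℕ := 2 * encPEdge e + 1
/-- The fresh proposition `#` marking transition-states. -/
def hashProp : ℕ := 0
/-- Code of an original proposition of `B` as a proposition of `⟦B⟧`. -/
def propCode (p : ℕ) : ℕ := 2 * p + 1
/-- Code of a state of `B` as a proposition of `⟦B⟧` (over `P ∪ S ∪ {#}`). -/
def stPropCode (s : ℕ) : ℕ := 2 * s + 2
/-- Code of an original clock of `B` as a clock of `⟦B⟧`. -/
def clkCode (x : ℕ) : ℕ := x + 1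
/-- The fresh clock `x_sing` forcing transition-states to be singular. -/
def xsing : ℕ := 0

/-- The interval-based timed automaton `⟦B⟧` over `P ∪ S ∪ {#}`: its states are the
states of `B` together with the transitions of `B`; transition-states are labeled by
their event together with `#`, carry the guard constraints and the constraint
`x_sing = 0`; edges alternate between states and transition-states, resetting `x_sing`
on entry to a transition-state and the transition's resets on exit. -/
def ibOf (B : PTA ℕ) : TA ℕ where
  states := B.states.map stCode ++ B.trans.map edCode
  init := stCode B.start :: (B.trans.filter (fun e => PEdge.src e == B.start)).map edCode
  props := hashProp :: (B.props.map propCode ++ B.states.map stPropCode)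
  clocks := xsing :: B.clocks.map clkCode
  label := B.states.map (fun s => (stCode s, [stPropCode s])) ++
    B.trans.map (fun e => (edCode e, hashProp :: (PEdge.event e).map propCode))
  beta := B.trans.map (fun e => ((edCode e, xsing), ClkC.atom Cmp.eq 0)) ++
    B.trans.flatMap (fun e => B.clocks.filterMap (fun x =>
      match (PEdge.guard e).filter (fun q => q.1 == x) with
      | [] => none
      | q :: rest =>
          some ((edCode e, clkCode x), rest.foldl (fun acc r => ClkC.conj acc r.2) q.2)))
  edges := B.trans.flatMap (fun e =>
    [(stCode (PEdge.src e), edCode e, [], [xsing]),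
     (edCode e, stCode (PEdge.dst e), [], (PEdge.rst e).map clkCode)])
  final := (B.trans.filter (fun e => B.final.contains (PEdge.dst e))).map edCode

/-- The map `χ` sending a run `(s₀,μ₀) →^{e₁,t₁} ⋯ →^{eₙ,tₙ} (sₙ,μₙ)` of `B` to the
execution `(s₀,[0,t₁)), (e₁,[t₁,t₁]), (s₁,(t₁,t₂)), …, (eₙ,[tₙ,tₙ])` of `⟦B⟧`
(starting at `(e₁,[0,0])` if `t₁ = 0`). -/
noncomputable def chi (η : PRun ℕ) : RawExec ℕ :=
  let n := η.n
  let sts := η.edges.flatMap (fun e => [stCode (PEdge.src e), edCode e])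
  let ivls := (List.range n).flatMap (fun i =>
    [⟨η.tprev i, η.time i, decide (i = 0), false⟩, ⟨η.time i, η.time i, true, true⟩])
  let gds : List (List (ℕ × ClkC ℕ)) := List.replicate (2 * n - 1) []
  let rsts := ((List.range n).flatMap
    (fun i => [[xsing], (PEdge.rst (η.edge i)).map clkCode])).take (2 * n - 1)
  if η.time 0 = 0 then ⟨sts.tail, ivls.tail, gds.tail, rsts.tail⟩
  else ⟨sts, ivls, gds, rsts⟩

end HyTime

namespace HyTime

/-! ### Finite automata reading folded timed configurations -/

namespace Track

variable {K K' σ : Type}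

/-- The letter read at the fractional part `f`: the values of all tracks at `f, 1 + f, 2 + f, …`. -/
def col (c : K → ℝ → ℕ) (f : ℝ) : K → ℕ → ℕ := fun k i => c k (i + f)

/-- The configuration lives in `[0, N)` and has finite support. -/
def Good (N : ℕ) (c : K → ℝ → ℕ) : Prop :=
  (∀ k x, c k x ≠ 0 → 0 ≤ x ∧ x < N) ∧ {x | ∃ k, c k x ≠ 0}.Finite

/-- `l` lists increasingly fractional parts in `(0,1)`, including all relevant ones. -/
structure Covers (c : K → ℝ → ℕ) (l : List ℝ) : Prop where
  sorted : l.Pairwise (· < ·)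
  mem : ∀ f ∈ l, 0 < f ∧ f < 1
  zero : ∀ f, 0 < f → f < 1 → f ∉ l → col c f = 0

theorem exists_sorted_list {T : Set ℝ} (hT : T.Finite) :
    ∃ l : List ℝ, l.Pairwise (· < ·) ∧ ∀ f, f ∈ l ↔ f ∈ T :=
  ⟨hT.toFinset.sort (· ≤ ·), (Finset.sortedLT_sort _).pairwise, by simp⟩

theorem Good.finite_cols {N : ℕ} {c : K → ℝ → ℕ} (h : Good N c) :
    {f : ℝ | 0 < f ∧ f < 1 ∧ col c f ≠ 0}.Finite := by
  refine (h.2.image Int.fract).subset ?_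
  rintro f ⟨h0, h1, hne⟩
  simp only [ne_eq, funext_iff, not_forall] at hne
  obtain ⟨k, i, hki⟩ := hne
  exact ⟨i + f, ⟨k, hki⟩, by rw [Int.fract_natCast_add, Int.fract_eq_self.2 ⟨h0.le, h1⟩]⟩

theorem exists_common_cover {N N' : ℕ} {c : K → ℝ → ℕ} {c' : K' → ℝ → ℕ} (h : Good N c)
    (h' : Good N' c') : ∃ l, Covers c l ∧ Covers c' l := by
  obtain ⟨l, hl, hm⟩ := exists_sorted_list (h.finite_cols.union h'.finite_cols)
  refine ⟨l, ⟨hl, fun f hf => ?_, fun f h0 h1 hf => ?_⟩, ⟨hl, fun f hf => ?_, fun f h0 h1 hf => ?_⟩⟩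
  · rcases (hm f).1 hf with h | h <;> exact ⟨h.1, h.2.1⟩
  · by_contra hne
    exact hf ((hm f).2 (Or.inl ⟨h0, h1, hne⟩))
  · rcases (hm f).1 hf with h | h <;> exact ⟨h.1, h.2.1⟩
  · by_contra hne
    exact hf ((hm f).2 (Or.inr ⟨h0, h1, hne⟩))

theorem Good.exists_cover {N : ℕ} {c : K → ℝ → ℕ} (h : Good N c) : ∃ l, Covers c l :=
  let ⟨l, hl, _⟩ := exists_common_cover h h
  ⟨l, hl⟩

theorem Good.comp {N : ℕ} {c : K → ℝ → ℕ} (h : Good N c) (f : K' → K) :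
    Good N (fun k => c (f k)) :=
  ⟨fun k x => h.1 (f k) x, h.2.subset fun _ ⟨k, hk⟩ => ⟨f k, hk⟩⟩

theorem Covers.comp {c : K → ℝ → ℕ} {l : List ℝ} (h : Covers c l) (f : K' → K) :
    Covers (fun k => c (f k)) l :=
  ⟨h.sorted, h.mem, fun g h0 h1 hg => by
    funext k
    exact congrFun (h.zero g h0 h1 hg) (f k)⟩

/-- Finite automata over columns; the column at the fractional part `0` determines the initial
state, and blank columns are ignored. -/
structure Aut (K σ : Type) where
  start : (K → ℕ → ℕ) → σ
  step : σ → (K → ℕ → ℕ) → σ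
  acc : σ → Prop
  step_zero : ∀ q, step q 0 = q

namespace Aut

variable (A : Aut K σ)

def run (c : K → ℝ → ℕ) (l : List ℝ) : σ :=
  l.foldl (fun q f => A.step q (col c f)) (A.start (col c 0))

/-- Acceptance of a configuration. -/
def Acc (c : K → ℝ → ℕ) : Prop := ∃ l, Covers c l ∧ A.acc (A.run c l)

open Classical in
theorem run_filter (c : K → ℝ → ℕ) (l : List ℝ) :
    A.run c l = A.run c (l.filter fun f => col c f ≠ 0) := by
  unfold run
  rw [List.foldl_filter]
  congr 1
  funext q f
  by_cases h : col c f = 0 <;> simp [h, A.step_zero]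

theorem run_eq {c : K → ℝ → ℕ} {l l' : List ℝ} (h : Covers c l) (h' : Covers c l') :
    A.run c l = A.run c l' := by
  classical
  rw [run_filter, A.run_filter c l']
  congr 1
  refine List.Perm.eq_of_pairwise (le := (· < ·)) (fun a b _ _ hab hba => absurd hab hba.not_gt)
    (h.sorted.filter _) (h'.sorted.filter _) ?_
  rw [List.perm_ext_iff_of_nodup]
  · intro f
    simp only [List.mem_filter]
    refine and_congr_left fun hf => ?_
    have hf' : col c f ≠ 0 := by simpa using hf
    constructor
    · intro hm
      by_contra hn
      exact hf' (h'.zero f (h.mem f hm).1 (h.mem f hm).2 hn)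
    · intro hm
      by_contra hn
      exact hf' (h.zero f (h'.mem f hm).1 (h'.mem f hm).2 hn)
  · exact (h.sorted.imp fun h => h.ne).filter _
  · exact (h'.sorted.imp fun h => h.ne).filter _

theorem acc_iff {c : K → ℝ → ℕ} {l : List ℝ} (h : Covers c l) :
    A.Acc c ↔ A.acc (A.run c l) :=
  ⟨fun ⟨_, hl', ha⟩ => A.run_eq hl' h ▸ ha, fun ha => ⟨l, h, ha⟩⟩

/-- The complement automaton. -/
def compl : Aut K σ := { A with acc := fun q => ¬ A.acc q }

theorem compl_acc {N : ℕ} {c : K → ℝ → ℕ} (h : Good N c) : A.compl.Acc c ↔ ¬ A.Acc c := by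
  obtain ⟨l, hl⟩ := h.exists_cover
  rw [acc_iff _ hl, acc_iff _ hl]
  rfl

/-- The product automaton for the conjunction. -/
def inter {τ : Type} (B : Aut K τ) : Aut K (σ × τ) where
  start a := (A.start a, B.start a)
  step q a := (A.step q.1 a, B.step q.2 a)
  acc q := A.acc q.1 ∧ B.acc q.2
  step_zero q := by simp [A.step_zero, B.step_zero]

theorem inter_run {τ : Type} (B : Aut K τ) (c : K → ℝ → ℕ) (l : List ℝ) :
    (A.inter B).run c l = (A.run c l, B.run c l) := by
  induction l using List.reverseRecOn with
  | nil => rfl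
  | append_singleton l f ih =>
    simp only [run, List.foldl_append, List.foldl_cons, List.foldl_nil] at ih ⊢
    rw [ih]
    rfl

theorem inter_acc {τ : Type} (B : Aut K τ) {N : ℕ} {c : K → ℝ → ℕ} (h : Good N c) :
    (A.inter B).Acc c ↔ A.Acc c ∧ B.Acc c := by
  obtain ⟨l, hl⟩ := h.exists_cover
  rw [acc_iff _ hl, acc_iff _ hl, acc_iff _ hl, inter_run]
  rfl

/-- Reading only the tracks selected by `f`. -/
def comap (A : Aut K' σ) (f : K' → K) : Aut K σ where
  start a := A.start fun k => a (f k)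
  step q a := A.step q fun k => a (f k)
  acc := A.acc
  step_zero q := A.step_zero q

theorem comap_acc (A : Aut K' σ) (f : K' → K) {N : ℕ} {c : K → ℝ → ℕ} (h : Good N c) :
    (A.comap f).Acc c ↔ A.Acc fun k => c (f k) := by
  obtain ⟨l, hl⟩ := h.exists_cover
  rw [acc_iff _ hl, acc_iff _ (hl.comp f)]
  rfl

section Projection

variable [DecidableEq K]

/-- A track letter vanishing beyond the time bound. -/
def Ok (N : ℕ) (a : ℕ → ℕ) : Prop := ∀ i, N ≤ i → a i = 0

/-- Reachability along columns that are nonblank on the track `k` only. -/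
def Reach (N : ℕ) (k : K) (q q' : σ) : Prop :=
  ∃ u : List (ℕ → ℕ), (∀ a ∈ u, Ok N a) ∧
    u.foldl (fun q a => A.step q (Function.update 0 k a)) q = q'

theorem Reach.refl (N : ℕ) (k : K) (q : σ) : A.Reach N k q q := ⟨[], by simp, rfl⟩

theorem Reach.snoc {A : Aut K σ} {N : ℕ} {k : K} {q q' : σ} (h : A.Reach N k q q') {a : ℕ → ℕ}
    (ha : Ok N a) : A.Reach N k q (A.step q' (Function.update 0 k a)) := by
  obtain ⟨u, hu, rfl⟩ := h
  refine ⟨u ++ [a], fun b hb => ?_, by simp⟩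
  rcases List.mem_append.1 hb with hb | hb
  · exact hu b hb
  · simp only [List.mem_singleton] at hb
    exact hb ▸ ha

/-- A shortest witness of reachability is shorter than the number of states. -/
theorem Reach.exists_short [Fintype σ] {A : Aut K σ} {N : ℕ} {k : K} {q q' : σ}
    (h : A.Reach N k q q') : ∃ u : List (ℕ → ℕ), u.length < Fintype.card σ ∧ (∀ a ∈ u, Ok N a) ∧
      u.foldl (fun q a => A.step q (Function.update 0 k a)) q = q' := by
  obtain ⟨u, hu, hq⟩ := h
  induction hn : u.length using Nat.strong_induction_on generalizing u with
  | _ n ih =>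
    by_cases hlt : u.length < Fintype.card σ
    · exact ⟨u, hlt, hu, hq⟩
    · let M : DFA (ℕ → ℕ) σ := ⟨fun q a => A.step q (Function.update 0 k a), q, ∅⟩
      obtain ⟨s, a, b, c, hx, -, hb, ha, hbq, hc⟩ :=
        M.evalFrom_split (x := u) (s := q) (t := q') (not_lt.1 hlt) hq
      refine ih (a ++ c).length ?_ (a ++ c) ?_ ?_ rfl
      · have := List.length_pos_of_ne_nil hb
        rw [← hn, hx]
        simp only [List.length_append]
        omega
      · intro d hd
        apply hu
        rw [hx]
        simp only [List.mem_append] at hd ⊢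
        tauto
      · rw [List.foldl_append]
        change M.evalFrom (M.evalFrom q a) c = q'
        rw [ha, hc]

open Classical in
/-- The subset automaton guessing the content of the track `k`. -/
noncomputable def proj (N : ℕ) (k : K) : Aut K (Set σ) where
  start b := {q | ∃ a, Ok N a ∧ A.Reach N k (A.start (Function.update b k a)) q}
  step Q b := if b = 0 then Q else
    {q | ∃ q₀ ∈ Q, ∃ a, Ok N a ∧ A.Reach N k (A.step q₀ (Function.update b k a)) q}
  acc Q := ∃ q ∈ Q, A.acc q
  step_zero Q := by simp

theorem col_update (c : K → ℝ → ℕ) (k : K) (a : ℝ → ℕ) (f : ℝ) :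
    col (Function.update c k a) f = Function.update (col c f) k (fun i => a (i + f)) := by
  funext k' i
  by_cases h : k' = k
  · subst h; simp [col]
  · simp [col, h]

theorem run_mem_proj (N : ℕ) (k : K) (c : K → ℝ → ℕ) (a : ℝ → ℕ)
    (ha : ∀ x, a x ≠ 0 → x < N) (l : List ℝ) (hl : ∀ f ∈ l, 0 < f) :
    A.run (Function.update c k a) l ∈ (A.proj N k).run c l ∧
    ∀ q ∈ (A.proj N k).run c l, ∀ b, Ok N b →
      A.step q (Function.update 0 k b) ∈ (A.proj N k).run c l := by
  have hok : ∀ f, 0 ≤ f → Ok N (fun i => a (i + f)) := by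
    intro f hf i hi
    by_contra hne
    have h1 := ha _ hne
    have h2 : (N : ℝ) ≤ i := by exact_mod_cast hi
    linarith
  induction l using List.reverseRecOn with
  | nil =>
    constructor
    · refine ⟨_, hok 0 le_rfl, ?_⟩
      simp only [run, List.foldl_nil, col_update]
      exact Reach.refl ..
    · rintro q ⟨a', ha', hr⟩ b hb
      exact ⟨a', ha', hr.snoc hb⟩
  | append_singleton l f ih =>
    obtain ⟨ih1, ih2⟩ := ih fun g hg => hl g (by simp [hg])
    have hf : 0 < f := hl f (by simp)
    simp only [run, List.foldl_append, List.foldl_cons, List.foldl_nil] at ih1 ih2 ⊢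
    generalize List.foldl (fun q f => (A.proj N k).step q (col c f)) _ l = Q at *
    generalize List.foldl (fun q f => A.step q (col (Function.update c k a) f)) _ l = q₀ at *
    rw [col_update]
    by_cases h0 : col c f = 0
    · rw [h0, (A.proj N k).step_zero]
      exact ⟨ih2 _ ih1 _ (hok f hf.le), ih2⟩
    · simp only [proj, h0, if_false]
      constructor
      · exact ⟨_, ih1, _, hok f hf.le, Reach.refl ..⟩
      · rintro q ⟨q₁, hq₁, a', ha', hr⟩ b hb
        exact ⟨q₁, hq₁, a', ha', hr.snoc hb⟩

/-- Placing a word of track letters on equidistant points of a gap. -/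
theorem exists_gap_word (c : K → ℝ → ℕ) (k : K) (N D : ℕ) (G : Set ℝ) {p hi : ℝ}
    (hp : p < hi) (hc : ∀ g, p < g → g < hi → col c g = 0)
    (hG : ∀ r : ℕ, 0 < r → r < D → p + (hi - p) * r / D ∈ G) (u : List (ℕ → ℕ)) :
    ∀ (j : ℕ) (q : σ), u.length + j < D → (∀ a ∈ u, Ok N a) →
    ∃ L : List (ℝ × (ℕ → ℕ)), L.Pairwise (fun x y => x.1 < y.1) ∧
      (∀ x ∈ L, p + (hi - p) * (j + 1) / D ≤ x.1 ∧ x.1 < hi ∧ x.1 ∈ G ∧ Ok N x.2) ∧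
      L.foldl (fun q x => A.step q (Function.update (col c x.1) k x.2)) q =
        u.foldl (fun q a => A.step q (Function.update 0 k a)) q := by
  induction u with
  | nil => intro j q _ _; exact ⟨[], by simp⟩
  | cons a u ih =>
    intro j q hj hok
    have hD : (0 : ℝ) < D := by
      have : 0 < D := by omega
      exact_mod_cast this
    have hjD : (j : ℝ) + 1 < D := by
      have : j + 1 < D := by simp at hj; omega
      exact_mod_cast this
    have hd : 0 < hi - p := by linarith
    set x := p + (hi - p) * (j + 1) / D with hx
    have hx1 : p < x := by
      have : 0 < (hi - p) * (j + 1) / D := by positivity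
      linarith
    have hx2 : x < hi := by
      have : (hi - p) * (j + 1) / D < hi - p := by
        rw [div_lt_iff₀ hD]
        exact mul_lt_mul_of_pos_left hjD hd
      linarith
    obtain ⟨L, h1, h2, h3⟩ := ih (j + 1) (A.step q (Function.update 0 k a))
      (by simp at hj; omega) (fun b hb => hok b (by simp [hb]))
    have hlt : ∀ y ∈ L, x < y.1 := by
      intro y hy
      refine lt_of_lt_of_le ?_ (h2 y hy).1
      rw [hx]
      push_cast
      gcongr
      linarith
    refine ⟨(x, a) :: L, List.pairwise_cons.2 ⟨hlt, h1⟩, ?_, ?_⟩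
    · intro y hy
      rcases List.mem_cons.1 hy with rfl | hy
      · refine ⟨le_rfl, hx2, ?_, hok a (by simp)⟩
        have := hG (j + 1) (by omega) (by simp at hj; omega)
        push_cast at this
        exact this
      · exact ⟨(hlt y hy).le, (h2 y hy).2⟩
    · simp only [List.foldl_cons, hc x hx1 hx2]
      exact h3

/-- Every run of the subset automaton is realised by a concrete content of the guessed track,
whose new points subdivide the gaps into `D` equal parts. -/
theorem exists_word_of_mem_proj [Fintype σ] (c : K → ℝ → ℕ) (k : K) (N D : ℕ)
    (hD : Fintype.card σ ≤ D) (G : Set ℝ) (l : List ℝ) : ∀ hi : ℝ, l.Pairwise (· < ·) →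
    (∀ f ∈ l, 0 < f ∧ f < hi) → 0 < hi → (∀ g, 0 < g → g < hi → g ∉ l → col c g = 0) →
    (∀ f ∈ l, f ∈ G) →
    (∀ p q, (p = 0 ∨ p ∈ l) → (q = hi ∨ q ∈ l) → p < q →
      ∀ r : ℕ, 0 < r → r < D → p + (q - p) * r / D ∈ G) →
    ∀ q ∈ (A.proj N k).run c l, ∃ (w : ℕ → ℕ) (L : List (ℝ × (ℕ → ℕ))), Ok N w ∧
      L.Pairwise (fun x y => x.1 < y.1) ∧
      (∀ x ∈ L, 0 < x.1 ∧ x.1 < hi ∧ x.1 ∈ G ∧ Ok N x.2) ∧ (∀ f ∈ l, ∃ b, (f, b) ∈ L) ∧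
      L.foldl (fun q x => A.step q (Function.update (col c x.1) k x.2))
        (A.start (Function.update (col c 0) k w)) = q := by
  induction l using List.reverseRecOn with
  | nil =>
    rintro hi - - h0 hz - hG q ⟨w, hw, hr⟩
    obtain ⟨u, hu, hok, hq⟩ := hr.exists_short
    obtain ⟨L, h1, h2, h3⟩ := A.exists_gap_word c k N D G h0 (fun g h0 h1 => hz g h0 h1 (by simp))
      (hG 0 hi (Or.inl rfl) (Or.inl rfl) h0) u 0 (A.start (Function.update (col c 0) k w))
      (by omega) hok
    refine ⟨w, L, hw, h1, fun x hx => ?_, by simp, h3.trans hq⟩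
    obtain ⟨h4, h5⟩ := h2 x hx
    refine ⟨lt_of_lt_of_le ?_ h4, h5⟩
    have : (0 : ℝ) < D := by
      have : 0 < D := by omega
      exact_mod_cast this
    rw [Nat.cast_zero]
    positivity
  | append_singleton l f ih =>
    intro hi hs hm h0 hz hlG hG q hq
    have hf := hm f (by simp)
    obtain ⟨hs1, -, hs2⟩ := List.pairwise_append.1 hs
    have hlf : ∀ g ∈ l, g < f := fun g hg => hs2 g hg f (by simp)
    have key := ih f hs1 (fun g hg => ⟨(hm g (by simp [hg])).1, hlf g hg⟩) hf.1
      (fun g h1 h2 h3 => hz g h1 (h2.trans hf.2) (by simp [h3, h2.ne]))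
      (fun g hg => hlG g (by simp [hg]))
      (fun p q hp hq => hG p q (hp.imp_right fun h => by simp [h])
        (Or.inr (by rcases hq with h | h <;> simp [h])))
    have hDpos : (0 : ℝ) < D := by
      have : 0 < D := lt_of_lt_of_le (Fintype.card_pos_iff.2 ⟨A.start 0⟩) hD
      exact_mod_cast this
    simp only [run, List.foldl_append, List.foldl_cons, List.foldl_nil] at hq key
    generalize List.foldl (fun q f => (A.proj N k).step q (col c f)) _ l = Q at *
    have hfin : ∀ q₀ ∈ Q, ∀ (a : ℕ → ℕ) (u : List (ℕ → ℕ)), Ok N a → u.length < D →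
        (∀ b ∈ u, Ok N b) →
        u.foldl (fun q a => A.step q (Function.update 0 k a))
          (A.step q₀ (Function.update (col c f) k a)) = q →
        ∃ (w : ℕ → ℕ) (L : List (ℝ × (ℕ → ℕ))), Ok N w ∧
          L.Pairwise (fun x y => x.1 < y.1) ∧
          (∀ x ∈ L, 0 < x.1 ∧ x.1 < hi ∧ x.1 ∈ G ∧ Ok N x.2) ∧
          (∀ g ∈ l ++ [f], ∃ b, (g, b) ∈ L) ∧
          L.foldl (fun q x => A.step q (Function.update (col c x.1) k x.2))
            (A.start (Function.update (col c 0) k w)) = q := by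
      intro q₀ hq₀ a u ha hu hok hqq
      obtain ⟨w, L₀, hw, hL1, hL2, hL3, hL4⟩ := key q₀ hq₀
      obtain ⟨L, h1, h2, h3⟩ := A.exists_gap_word c k N D G hf.2
        (fun g h1 h2 => hz g (hf.1.trans h1) h2 (by
          simp only [List.mem_append, List.mem_singleton, not_or]
          exact ⟨fun hg => (hlf g hg).not_gt h1, h1.ne'⟩))
        (hG f hi (Or.inr (by simp)) (Or.inl rfl) hf.2) u 0
        (A.step q₀ (Function.update (col c f) k a)) (by omega) hok
      have hfL : ∀ x ∈ L, f < x.1 := fun x hx => by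
        refine lt_of_lt_of_le ?_ (h2 x hx).1
        have : 0 < (hi - f) * ((0 : ℕ) + 1) / D := by
          have : 0 < hi - f := by linarith [hf.2]
          rw [Nat.cast_zero]
          positivity
        linarith
      refine ⟨w, L₀ ++ (f, a) :: L, hw, ?_, ?_, ?_, ?_⟩
      · refine List.pairwise_append.2 ⟨hL1, List.pairwise_cons.2 ⟨hfL, h1⟩, ?_⟩
        intro x hx y hy
        have hxf := (hL2 x hx).2.1
        rcases List.mem_cons.1 hy with rfl | hy
        · exact hxf
        · exact hxf.trans (hfL y hy)
      · intro x hx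
        rcases List.mem_append.1 hx with hx | hx
        · exact ⟨(hL2 x hx).1, (hL2 x hx).2.1.trans hf.2, (hL2 x hx).2.2⟩
        · rcases List.mem_cons.1 hx with rfl | hx
          · exact ⟨hf.1, hf.2, hlG f (by simp), ha⟩
          · exact ⟨hf.1.trans (hfL x hx), (h2 x hx).2⟩
      · intro g hg
        rcases List.mem_append.1 hg with hg | hg
        · obtain ⟨b, hb⟩ := hL3 g hg
          exact ⟨b, by simp [hb]⟩
        · simp only [List.mem_singleton] at hg
          exact ⟨a, by simp [hg]⟩
      · rw [List.foldl_append, List.foldl_cons, hL4, h3, hqq]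
    by_cases hcz : col c f = 0
    · rw [hcz, (A.proj N k).step_zero] at hq
      refine hfin q hq 0 [] (fun _ _ => rfl) (by simpa using hDpos) (by simp) ?_
      have : Function.update (col c f) k 0 = 0 := by
        rw [hcz]
        exact Function.update_eq_self k 0
      rw [this, A.step_zero]
      rfl
    · simp only [proj, hcz, if_false] at hq
      obtain ⟨q₀, hq₀, a, ha, hr⟩ := hq
      obtain ⟨u, hu, hok, hqq⟩ := hr.exists_short
      exact hfin q₀ hq₀ a u ha (by omega) hok hqq

end Projection

end Aut
variable {K K' σ : Type}

/-- Assembling a track from its columns. -/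
theorem exists_track (w : ℕ → ℕ) (L : List (ℝ × (ℕ → ℕ))) (hL : L.Pairwise fun x y => x.1 < y.1)
    (h01 : ∀ x ∈ L, 0 < x.1 ∧ x.1 < 1) :
    ∃ a : ℝ → ℕ, (∀ i : ℕ, a (i + 0) = w i) ∧ (∀ x ∈ L, ∀ i : ℕ, a (i + x.1) = x.2 i) ∧
      ∀ y, a y ≠ 0 → 0 ≤ y ∧ ((Int.fract y = 0 ∧ w ⌊y⌋₊ ≠ 0) ∨
        ∃ x ∈ L, Int.fract y = x.1 ∧ x.2 ⌊y⌋₊ ≠ 0) := by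
  classical
  refine ⟨fun y => if y < 0 then 0 else if Int.fract y = 0 then w ⌊y⌋₊ else
    if h : ∃ x ∈ L, Int.fract y = x.1 then h.choose.2 ⌊y⌋₊ else 0, ?_, ?_, ?_⟩
  · intro i
    simp
  · intro x hx i
    obtain ⟨h0, h1⟩ := h01 x hx
    have hfr : Int.fract ((i : ℝ) + x.1) = x.1 := by
      rw [Int.fract_natCast_add, Int.fract_eq_self.2 ⟨h0.le, h1⟩]
    have hfl : ⌊(i : ℝ) + x.1⌋₊ = i := by
      rw [Nat.floor_eq_iff (by positivity)]
      constructor <;> linarith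
    have hex : ∃ x' ∈ L, Int.fract ((i : ℝ) + x.1) = x'.1 := ⟨x, hx, hfr⟩
    have hlt : ¬ (i : ℝ) + x.1 < 0 := by
      have : (0 : ℝ) ≤ i := Nat.cast_nonneg i
      linarith
    simp only [hlt, if_false, hfl]
    rw [if_neg (by rw [hfr]; exact h0.ne'), dif_pos hex]
    obtain ⟨hm, he⟩ := hex.choose_spec
    have he' := hfr.symm.trans he
    suffices hcx : hex.choose = x from congrArg (fun z => z.2 i) hcx
    exact List.inj_on_of_nodup_map (f := Prod.fst)
      (List.pairwise_map.2 (hL.imp fun h => h.ne)) hm hx he'.symm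
  · intro y hy
    by_cases hlt : y < 0
    · simp [hlt] at hy
    · refine ⟨not_lt.1 hlt, ?_⟩
      simp only [hlt, if_false] at hy
      by_cases hf : Int.fract y = 0
      · exact Or.inl ⟨hf, by simpa [hf] using hy⟩
      · rw [if_neg hf] at hy
        by_cases hex : ∃ x ∈ L, Int.fract y = x.1
        · rw [dif_pos hex] at hy
          exact Or.inr ⟨hex.choose, hex.choose_spec.1, hex.choose_spec.2, hy⟩
        · simp [hex] at hy

namespace Aut
variable (A : Aut K σ) [DecidableEq K]

theorem exists_of_proj_acc [Fintype σ] {N : ℕ} {c : K → ℝ → ℕ} {k : K} {D : ℕ}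
    (hD : Fintype.card σ ≤ D) (G : Set ℝ) {l : List ℝ} (hl : Covers c l) (hlG : ∀ f ∈ l, f ∈ G)
    (hG : ∀ p q, (p = 0 ∨ p ∈ l) → (q = 1 ∨ q ∈ l) → p < q →
      ∀ r : ℕ, 0 < r → r < D → p + (q - p) * r / D ∈ G) (h : (A.proj N k).Acc c) :
    ∃ a : ℝ → ℕ, (∀ x, a x ≠ 0 → (0 ≤ x ∧ x < N) ∧ (Int.fract x = 0 ∨ Int.fract x ∈ G)) ∧
      {x | a x ≠ 0}.Finite ∧ A.Acc (Function.update c k a) := by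
  rw [acc_iff _ hl] at h
  obtain ⟨q, hq, hacc⟩ := h
  obtain ⟨w, L, hw, hL, hLp, hlL, hrun⟩ := A.exists_word_of_mem_proj c k N D hD G l 1 hl.sorted
    hl.mem one_pos hl.zero hlG hG q hq
  obtain ⟨a, ha0, ha1, ha⟩ := exists_track w L hL fun x hx => ⟨(hLp x hx).1, (hLp x hx).2.1⟩
  have hfloor : ∀ y, a y ≠ 0 → ⌊y⌋₊ < N := by
    intro y hy
    by_contra hlt
    obtain ⟨-, ⟨-, h⟩ | ⟨x, hx, -, h⟩⟩ := ha y hy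
    · exact h (hw _ (not_lt.1 hlt))
    · exact h ((hLp x hx).2.2.2 _ (not_lt.1 hlt))
  refine ⟨a, ?_, ?_, L.map (·.1), ⟨?_, ?_, ?_⟩, ?_⟩
  · intro y hy
    obtain ⟨h0, h1⟩ := ha y hy
    refine ⟨⟨h0, (Nat.floor_lt h0).1 (hfloor y hy)⟩, ?_⟩
    rcases h1 with h1 | ⟨x, hx, hxy, -⟩
    · exact Or.inl h1.1
    · exact Or.inr (hxy ▸ (hLp x hx).2.2.1)
  · have hfin : (Set.image2 (fun (i : ℕ) (f : ℝ) => (i : ℝ) + f) {i | i < N}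
        (insert 0 {f | f ∈ L.map (·.1)})).Finite :=
      (Set.finite_lt_nat N).image2 _ ((List.finite_toSet _).insert 0)
    refine hfin.subset fun y hy => ⟨⌊y⌋₊, hfloor y hy, Int.fract y, ?_, ?_⟩
    · obtain ⟨-, h1 | ⟨x, hx, hxy, -⟩⟩ := ha y hy
      · exact Or.inl h1.1
      · exact Or.inr (by simpa using ⟨x.2, hxy ▸ hx⟩)
    · change (⌊y⌋₊ : ℝ) + Int.fract y = y
      rw [natCast_floor_eq_intCast_floor (ha y hy).1]
      exact Int.floor_add_fract y
  · exact List.pairwise_map.2 hL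
  · intro f hf
    obtain ⟨x, hx, rfl⟩ := List.mem_map.1 hf
    exact ⟨(hLp x hx).1, (hLp x hx).2.1⟩
  · intro f h0 h1 hf
    have hfl : f ∉ l := fun h => by
      obtain ⟨b, hb⟩ := hlL f h
      exact hf (List.mem_map.2 ⟨_, hb, rfl⟩)
    rw [col_update, hl.zero f h0 h1 hfl]
    have : (fun i : ℕ => a (i + f)) = 0 := by
      funext i
      by_contra hne
      have hfr : Int.fract ((i : ℝ) + f) = f := by
        rw [Int.fract_natCast_add, Int.fract_eq_self.2 ⟨h0.le, h1⟩]
      obtain ⟨-, h | ⟨x, hx, hxy, -⟩⟩ := ha _ hne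
      · exact h0.ne' (hfr ▸ h.1)
      · exact hf (List.mem_map.2 ⟨x, hx, by rw [← hxy, hfr]⟩)
    rw [this]
    exact Function.update_eq_self k 0
  · convert hacc
    rw [← hrun, run, List.foldl_map, col_update, show (fun i : ℕ => a (i + 0)) = w from funext ha0]
    refine List.foldl_ext _ _ _ fun q x hx => ?_
    rw [col_update, show (fun i : ℕ => a (i + x.1)) = x.2 from funext (ha1 x hx)]

theorem good_update {N : ℕ} {c : K → ℝ → ℕ} (hc : Good N c) (k : K) {a : ℝ → ℕ}
    (ha : ∀ x, a x ≠ 0 → 0 ≤ x ∧ x < N) (hf : {x | a x ≠ 0}.Finite) :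
    Good N (Function.update c k a) := by
  refine ⟨fun k' x => ?_, (hc.2.union hf).subset ?_⟩
  · by_cases h : k' = k
    · subst h; simpa using ha x
    · simpa [h] using hc.1 k' x
  · rintro x ⟨k', hx⟩
    by_cases h : k' = k
    · subst h; exact Or.inr (by simpa using hx)
    · exact Or.inl ⟨k', by simpa [h] using hx⟩

theorem proj_acc_of_acc {N : ℕ} {c : K → ℝ → ℕ} (hc : Good N c) {k : K} {a : ℝ → ℕ}
    (ha : ∀ x, a x ≠ 0 → 0 ≤ x ∧ x < N) (hf : {x | a x ≠ 0}.Finite)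
    (h : A.Acc (Function.update c k a)) : (A.proj N k).Acc c := by
  obtain ⟨l, hl, hl'⟩ := exists_common_cover hc (good_update hc k ha hf)
  rw [acc_iff _ hl'] at h
  exact ⟨l, hl, _, (A.run_mem_proj N k c a (fun x hx => (ha x hx).2) l
    fun f hf => (hl.mem f hf).1).1, h⟩

theorem proj_acc [Fintype σ] {N : ℕ} {c : K → ℝ → ℕ} (hc : Good N c) {k : K} :
    (A.proj N k).Acc c ↔ ∃ a : ℝ → ℕ, (∀ x, a x ≠ 0 → 0 ≤ x ∧ x < N) ∧ {x | a x ≠ 0}.Finite ∧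
      A.Acc (Function.update c k a) := by
  constructor
  · intro h
    obtain ⟨l, hl⟩ := hc.exists_cover
    obtain ⟨a, h1, h2, h3⟩ := A.exists_of_proj_acc le_rfl Set.univ hl (by simp) (by simp) h
    exact ⟨a, fun x hx => (h1 x hx).1, h2, h3⟩
  · rintro ⟨a, h1, h2, h3⟩
    exact A.proj_acc_of_acc hc h1 h2 h3

/-- A guessed track may be placed on a grid refining the one of the configuration. -/
theorem exists_grid [Fintype σ] {N M D : ℕ} (hM : 0 < M) (hD : Fintype.card σ ≤ D)
    {c : K → ℝ → ℕ} (hc : Good N c) (hcM : ∀ k x, c k x ≠ 0 → ∃ j : ℕ, x = j / M)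
    {k : K} {a : ℝ → ℕ} (ha : ∀ x, a x ≠ 0 → 0 ≤ x ∧ x < N) (hf : {x | a x ≠ 0}.Finite)
    (h : A.Acc (Function.update c k a)) :
    ∃ a : ℝ → ℕ, (∀ x, a x ≠ 0 → 0 ≤ x ∧ x < N) ∧ {x | a x ≠ 0}.Finite ∧
      (∀ x, a x ≠ 0 → ∃ j : ℕ, x = j / (M * D : ℕ)) ∧ A.Acc (Function.update c k a) := by
  have hD0 : 0 < D := lt_of_lt_of_le (Fintype.card_pos_iff.2 ⟨A.start 0⟩) hD
  have hMR : (0 : ℝ) < M := by exact_mod_cast hM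
  have hDR : (0 : ℝ) < D := by exact_mod_cast hD0
  obtain ⟨l, hs, hm⟩ := exists_sorted_list hc.finite_cols
  have hl : Covers c l := ⟨hs, fun f hf => ⟨((hm f).1 hf).1, ((hm f).1 hf).2.1⟩,
    fun f h0 h1 hf => by
      by_contra hne
      exact hf ((hm f).2 ⟨h0, h1, hne⟩)⟩
  have hgrid : ∀ f ∈ l, ∃ j : ℕ, f = j / M := by
    intro f hf
    obtain ⟨h0, h1, hne⟩ := (hm f).1 hf
    simp only [ne_eq, funext_iff, not_forall] at hne
    obtain ⟨k, i, hki⟩ := hne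
    obtain ⟨j, hj⟩ := hcM k _ hki
    have hj' : (j : ℝ) = i * M + f * M := by
      rw [eq_div_iff hMR.ne'] at hj
      linarith
    have hij : i * M ≤ j := by
      have : (i * M : ℝ) ≤ j := by rw [hj']; nlinarith
      exact_mod_cast this
    refine ⟨j - i * M, ?_⟩
    rw [Nat.cast_sub hij, eq_div_iff hMR.ne']
    push_cast
    linarith
  have hsub : ∀ i j r : ℕ, i < j →
      ∃ n : ℕ, (i / M + (j / M - i / M) * r / D : ℝ) = n / (M * D : ℕ) := by
    intro i j r hij
    refine ⟨i * D + (j - i) * r, ?_⟩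
    push_cast [Nat.cast_sub hij.le]
    field_simp
  obtain ⟨a', h1, h2, h3⟩ := A.exists_of_proj_acc (N := N) hD {f | ∃ j : ℕ, f = j / (M * D : ℕ)} hl
    (fun f hf => by
      obtain ⟨j, rfl⟩ := hgrid f hf
      refine ⟨j * D, ?_⟩
      push_cast
      field_simp)
    (by
      intro p q hp hq hpq r _ _
      obtain ⟨i, rfl⟩ : ∃ i : ℕ, p = i / M := by
        rcases hp with rfl | hp
        · exact ⟨0, by simp⟩
        · exact hgrid p hp
      obtain ⟨j, rfl⟩ : ∃ j : ℕ, q = j / M := by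
        rcases hq with rfl | hq
        · exact ⟨M, by field_simp⟩
        · exact hgrid q hq
      have hij : i < j := by
        rw [div_lt_div_iff_of_pos_right hMR] at hpq
        exact_mod_cast hpq
      exact hsub i j r hij) (A.proj_acc_of_acc hc ha hf h)
  refine ⟨a', fun x hx => (h1 x hx).1, h2, fun x hx => ?_, h3⟩
  obtain ⟨⟨h0, -⟩, h4⟩ := h1 x hx
  have hMD : (0 : ℝ) < (M * D : ℕ) := by push_cast; positivity
  have hfl : (⌊x⌋₊ : ℝ) + Int.fract x = x := by
    rw [natCast_floor_eq_intCast_floor h0]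
    exact Int.floor_add_fract x
  obtain ⟨j, hj⟩ : ∃ j : ℕ, Int.fract x = j / (M * D : ℕ) := by
    rcases h4 with h4 | h4
    · exact ⟨0, by rw [h4]; simp⟩
    · exact h4
  refine ⟨⌊x⌋₊ * (M * D) + j, ?_⟩
  have hsum : ∀ i : ℕ, (i + j / (M * D : ℕ) : ℝ) = (i * (M * D) + j : ℕ) / (M * D : ℕ) := by
    intro i
    push_cast at hMD ⊢
    field_simp
  rw [← hsum, ← hj, hfl]

end Aut
variable {K σ : Type}

namespace Aut

/-- Accepts when the column at the fractional part `0` satisfies `S`. -/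
def atZero (S : (K → ℕ → ℕ) → Prop) : Aut K Prop where
  start := S
  step q _ := q
  acc q := q
  step_zero _ := rfl

theorem atZero_acc (S : (K → ℕ → ℕ) → Prop) {N : ℕ} {c : K → ℝ → ℕ} (h : Good N c) :
    (atZero S).Acc c ↔ S (col c 0) := by
  obtain ⟨l, hl⟩ := h.exists_cover
  rw [acc_iff _ hl]
  have : ∀ (l : List ℝ) (q : Prop), l.foldl (fun q f => (atZero S).step q (col c f)) q = q := by
    intro l
    induction l with
    | nil => intro q; rfl
    | cons f l ih => intro q; exact ih q
  rw [run, this]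
  rfl

/-- Accepts when some column satisfies `S`. -/
def any (S : (K → ℕ → ℕ) → Prop) (hS : ¬ S 0) : Aut K Prop where
  start := S
  step q b := q ∨ S b
  acc q := q
  step_zero q := by simp [hS]

theorem any_acc (S : (K → ℕ → ℕ) → Prop) (hS : ¬ S 0) {N : ℕ} {c : K → ℝ → ℕ} (h : Good N c) :
    (any S hS).Acc c ↔ ∃ f, 0 ≤ f ∧ f < 1 ∧ S (col c f) := by
  obtain ⟨l, hl⟩ := h.exists_cover
  rw [acc_iff _ hl]
  have : ∀ (l : List ℝ) (q : Prop), l.foldl (fun q f => (any S hS).step q (col c f)) q ↔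
      q ∨ ∃ f ∈ l, S (col c f) := by
    intro l
    induction l with
    | nil => intro q; simp
    | cons f l ih =>
      intro q
      rw [List.foldl_cons, ih]
      simp [any, or_assoc]
  change (any S hS).run c l ↔ _
  rw [run, this]
  constructor
  · rintro (h0 | ⟨f, hf, h1⟩)
    · exact ⟨0, le_rfl, one_pos, h0⟩
    · exact ⟨f, (hl.mem f hf).1.le, (hl.mem f hf).2, h1⟩
  · rintro ⟨f, h0, h1, hf⟩
    rcases h0.eq_or_lt with rfl | h0
    · exact Or.inl hf
    · refine Or.inr ⟨f, ?_, hf⟩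
      by_contra hn
      exact hS (hl.zero f h0 h1 hn ▸ hf)

/-- Accepts when a column satisfying `S i` is followed by one satisfying `S' i`, for some `i`. -/
def pairs {ι : Type} (S S' : ι → (K → ℕ → ℕ) → Prop) (hS : ∀ i, ¬ S i 0) (hS' : ∀ i, ¬ S' i 0) :
    Aut K (Set ι × Prop) where
  start b := ({i | S i b}, False)
  step q b := ({i | i ∈ q.1 ∨ S i b}, q.2 ∨ ∃ i ∈ q.1, S' i b)
  acc q := q.2
  step_zero q := by simp [hS, hS']

theorem pairs_acc {ι : Type} (S S' : ι → (K → ℕ → ℕ) → Prop) (hS : ∀ i, ¬ S i 0)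
    (hS' : ∀ i, ¬ S' i 0) {N : ℕ} {c : K → ℝ → ℕ} (h : Good N c) :
    (pairs S S' hS hS').Acc c ↔
      ∃ i f f', 0 ≤ f ∧ f < f' ∧ f' < 1 ∧ S i (col c f) ∧ S' i (col c f') := by
  obtain ⟨l, hl⟩ := h.exists_cover
  rw [acc_iff _ hl]
  have key : ∀ l : List ℝ, l.Pairwise (· < ·) → (∀ f ∈ l, 0 < f) →
      (∀ i, i ∈ ((pairs S S' hS hS').run c l).1 ↔ ∃ f, (f = 0 ∨ f ∈ l) ∧ S i (col c f)) ∧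
      (((pairs S S' hS hS').run c l).2 ↔ ∃ i f f', (f = 0 ∨ f ∈ l) ∧ f' ∈ l ∧ f < f' ∧
        S i (col c f) ∧ S' i (col c f')) := by
    intro l
    induction l using List.reverseRecOn with
    | nil => intro _ _; simp [run, pairs]
    | append_singleton l g ih =>
      intro hs h0
      obtain ⟨hs1, -, hs2⟩ := List.pairwise_append.1 hs
      have hlg : ∀ f ∈ l, f < g := fun f hf => hs2 f hf g (by simp)
      have hg : 0 < g := h0 g (by simp)
      obtain ⟨ih1, ih2⟩ := ih hs1 fun f hf => h0 f (by simp [hf])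
      simp only [run, List.foldl_append, List.foldl_cons, List.foldl_nil] at ih1 ih2 ⊢
      generalize List.foldl (fun q f => (pairs S S' hS hS').step q (col c f)) _ l = Q at *
      constructor
      · intro i
        change i ∈ Q.1 ∨ S i (col c g) ↔ _
        rw [ih1]
        constructor
        · rintro (⟨f, hf, h⟩ | h)
          · exact ⟨f, hf.imp_right fun hf => by simp [hf], h⟩
          · exact ⟨g, by simp, h⟩
        · rintro ⟨f, hf, h⟩
          simp only [List.mem_append, List.mem_singleton] at hf
          rcases hf with hf | hf | rfl
          · exact Or.inl ⟨f, Or.inl hf, h⟩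
          · exact Or.inl ⟨f, Or.inr hf, h⟩
          · exact Or.inr h
      · change (Q.2 ∨ ∃ i ∈ Q.1, S' i (col c g)) ↔ _
        rw [ih2]
        constructor
        · rintro (⟨i, f, f', hf, hf', h⟩ | ⟨i, hi, h⟩)
          · exact ⟨i, f, f', hf.imp_right fun hf => by simp [hf], by simp [hf'], h⟩
          · obtain ⟨f, hf, hS⟩ := (ih1 i).1 hi
            refine ⟨i, f, g, hf.imp_right fun hf => by simp [hf], by simp, ?_, hS, h⟩
            rcases hf with rfl | hf
            · exact hg
            · exact hlg f hf
        · rintro ⟨i, f, f', hf, hf', hlt, h1, h2⟩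
          simp only [List.mem_append, List.mem_singleton] at hf hf'
          have hfl : f = 0 ∨ f ∈ l := by
            rcases hf with hf | hf | rfl
            · exact Or.inl hf
            · exact Or.inr hf
            · rcases hf' with hf' | rfl
              · exact absurd hlt (hlg _ hf').not_gt
              · exact absurd hlt (lt_irrefl _)
          rcases hf' with hf' | rfl
          · exact Or.inl ⟨i, f, f', hfl, hf', hlt, h1, h2⟩
          · exact Or.inr ⟨i, (ih1 i).2 ⟨f, hfl, h1⟩, h2⟩
  change ((pairs S S' hS hS').run c l).2 ↔ _
  rw [(key l hl.sorted fun f hf => (hl.mem f hf).1).2]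
  constructor
  · rintro ⟨i, f, f', hf, hf', hlt, h⟩
    refine ⟨i, f, f', ?_, hlt, (hl.mem f' hf').2, h⟩
    rcases hf with rfl | hf
    · exact le_rfl
    · exact (hl.mem f hf).1.le
  · rintro ⟨i, f, f', h0, hlt, h1, h2, h3⟩
    have hmem : ∀ f, 0 < f → f < 1 → col c f ≠ 0 → f ∈ l := by
      intro f h0 h1 hne
      by_contra hn
      exact hne (hl.zero f h0 h1 hn)
    refine ⟨i, f, f', ?_, hmem f' (h0.trans_lt hlt) h1 (fun h => hS' i (h ▸ h3)), hlt, h2, h3⟩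
    rcases h0.eq_or_lt with rfl | h0
    · exact Or.inl rfl
    · exact Or.inr (hmem f h0 (hlt.trans h1) fun h => hS i (h ▸ h2))

end Aut

/-- `P` is recognised, on configurations bounded by `N`, by an automaton with at most `D`
states. -/
def Rec (N D : ℕ) (P : (K → ℝ → ℕ) → Prop) : Prop :=
  ∃ (σ : Type) (_ : Fintype σ) (A : Aut K σ), Fintype.card σ ≤ D ∧
    ∀ c, Good N c → (P c ↔ A.Acc c)

namespace Rec

variable {N D D' : ℕ} {P Q : (K → ℝ → ℕ) → Prop}

theorem mono (h : Rec N D P) (hD : D ≤ D') : Rec N D' P :=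
  let ⟨σ, i, A, hA, hP⟩ := h
  ⟨σ, i, A, hA.trans hD, hP⟩

theorem congr (h : Rec N D P) (hPQ : ∀ c, Good N c → (Q c ↔ P c)) : Rec N D Q :=
  let ⟨σ, i, A, hA, hP⟩ := h
  ⟨σ, i, A, hA, fun c hc => (hPQ c hc).trans (hP c hc)⟩

theorem not (h : Rec N D P) : Rec N D fun c => ¬ P c :=
  let ⟨σ, i, A, hA, hP⟩ := h
  ⟨σ, i, A.compl, hA, fun c hc =>
    (not_congr (hP c hc)).trans (A.compl_acc hc).symm⟩

theorem and (h : Rec N D P) (h' : Rec N D' Q) : Rec N (D * D') fun c => P c ∧ Q c := by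
  obtain ⟨σ, i, A, hA, hP⟩ := h
  obtain ⟨τ, j, B, hB, hQ⟩ := h'
  refine ⟨σ × τ, inferInstance, A.inter B, ?_, fun c hc => ?_⟩
  · rw [Fintype.card_prod]
    exact Nat.mul_le_mul hA hB
  · exact (and_congr (hP c hc) (hQ c hc)).trans (A.inter_acc B hc).symm

theorem comap {K' : Type} (h : Rec N D P) (f : K → K') :
    Rec N D fun c : K' → ℝ → ℕ => P fun k => c (f k) := by
  obtain ⟨σ, i, A, hA, hP⟩ := h
  exact ⟨σ, i, A.comap f, hA, fun c hc =>
    (hP _ (hc.comp f)).trans (A.comap_acc f hc).symm⟩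

theorem exists_track [DecidableEq K] (h : Rec N D P) (k : K) :
    Rec N (2 ^ D) fun c => ∃ a : ℝ → ℕ, (∀ x, a x ≠ 0 → 0 ≤ x ∧ x < N) ∧ {x | a x ≠ 0}.Finite ∧
      P (Function.update c k a) := by
  classical
  obtain ⟨σ, i, A, hA, hP⟩ := h
  refine ⟨Set σ, inferInstance, A.proj N k, ?_, fun c hc => ?_⟩
  · rw [Fintype.card_set]
    exact Nat.pow_le_pow_right two_pos hA
  · rw [A.proj_acc hc]
    refine exists_congr fun a => and_congr_right fun h1 => and_congr_right fun h2 => ?_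
    exact hP _ (Aut.good_update hc k h1 h2)

theorem atZero (S : (K → ℕ → ℕ) → Prop) : Rec N 2 fun c : K → ℝ → ℕ => S (col c 0) :=
  ⟨Prop, inferInstance, Aut.atZero S, by simp, fun _ hc => (Aut.atZero_acc S hc).symm⟩

theorem any (S : (K → ℕ → ℕ) → Prop) (hS : ¬ S 0) :
    Rec N 2 fun c : K → ℝ → ℕ => ∃ f, 0 ≤ f ∧ f < 1 ∧ S (col c f) :=
  ⟨Prop, inferInstance, Aut.any S hS, by simp, fun _ hc => (Aut.any_acc S hS hc).symm⟩

theorem pairs {ι : Type} [Fintype ι] (S S' : ι → (K → ℕ → ℕ) → Prop) (hS : ∀ i, ¬ S i 0)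
    (hS' : ∀ i, ¬ S' i 0) :
    Rec N (2 ^ Fintype.card ι * 2) fun c : K → ℝ → ℕ =>
      ∃ i f f', 0 ≤ f ∧ f < f' ∧ f' < 1 ∧ S i (col c f) ∧ S' i (col c f') := by
  classical
  exact ⟨Set ι × Prop, inferInstance, Aut.pairs S S' hS hS', by simp,
    fun _ hc => (Aut.pairs_acc S S' hS hS' hc).symm⟩

end Rec

/-! ### Definable predicates -/

/-- Track names: runs, a scratch run and points. -/
inductive Trk where
  | run (π : ℕ)
  | tmp
  | pt (j : ℕ)
  deriving DecidableEq

/-- The indicator of a point. -/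
noncomputable def ind (x : ℝ) : ℝ → ℕ := fun y => if y = x then 1 else 0

/-- The configuration given by runs `c`, a scratch run `a` and points `v`. -/
noncomputable def cfg (c : ℕ → ℝ → ℕ) (a : ℝ → ℕ) (v : ℕ → ℝ) : Trk → ℝ → ℕ
  | .run π => c π
  | .tmp => a
  | .pt j => ind (v j)

/-- Towers of exponentials over `b`. -/
def tw (b : ℕ) : ℕ → ℕ
  | 0 => b
  | h + 1 => 2 ^ tw b h

theorem tw_mono (b : ℕ) : Monotone (tw b) :=
  monotone_nat_of_le_succ fun _ => Nat.lt_two_pow_self.le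

theorem le_tw (b h : ℕ) : b ≤ tw b h := tw_mono b (Nat.zero_le h)

/-- The content of `[0, N)` is finite. -/
def Supp (N : ℕ) (a : ℝ → ℕ) : Prop := (∀ x, a x ≠ 0 → 0 ≤ x ∧ x < N) ∧ {x | a x ≠ 0}.Finite

theorem supp_ind {N : ℕ} {x : ℝ} (h0 : 0 ≤ x) (h1 : x < N) : Supp N (ind x) := by
  refine ⟨fun y hy => ?_, (Set.finite_singleton x).subset fun y hy => ?_⟩
  · by_cases h : y = x
    · exact h ▸ ⟨h0, h1⟩
    · simp [ind, h] at hy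
  · by_contra h
    simp only [Set.mem_singleton_iff] at h
    simp [ind, h] at hy

theorem update_run (c : ℕ → ℝ → ℕ) (a : ℝ → ℕ) (v : ℕ → ℝ) (π : ℕ) (a' : ℝ → ℕ) :
    Function.update (cfg c a v) (.run π) a' = cfg (Function.update c π a') a v := by
  funext k
  cases k with
  | run π' => by_cases h : π' = π <;> simp [cfg, h]
  | tmp => rfl
  | pt j => rfl

theorem update_tmp (c : ℕ → ℝ → ℕ) (a : ℝ → ℕ) (v : ℕ → ℝ) (a' : ℝ → ℕ) :
    Function.update (cfg c a v) .tmp a' = cfg c a' v := by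
  funext k
  cases k <;> rfl

theorem update_pt (c : ℕ → ℝ → ℕ) (a : ℝ → ℕ) (v : ℕ → ℝ) (j : ℕ) (x : ℝ) :
    Function.update (cfg c a v) (.pt j) (ind x) = cfg c a (Function.update v j x) := by
  funext k
  cases k with
  | run π' => rfl
  | tmp => rfl
  | pt j' => by_cases h : j' = j <;> simp [cfg, h]

theorem Good.pt_mem {N : ℕ} {c : ℕ → ℝ → ℕ} {a : ℝ → ℕ} {v : ℕ → ℝ} (h : Good N (cfg c a v))
    (j : ℕ) : 0 ≤ v j ∧ v j < N :=
  h.1 (.pt j) (v j) (by simp [cfg, ind])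

theorem exists_col {x : ℝ} (h : 0 ≤ x) : ∃ (i : ℕ) (f : ℝ), 0 ≤ f ∧ f < 1 ∧ x = i + f :=
  ⟨⌊x⌋₊, Int.fract x, Int.fract_nonneg x, Int.fract_lt_one x, by
    rw [natCast_floor_eq_intCast_floor h, Int.floor_add_fract]⟩

theorem col_unique {i i' : ℕ} {f f' : ℝ} (h0 : 0 ≤ f) (h1 : f < 1) (h0' : 0 ≤ f') (h1' : f' < 1)
    (h : (i : ℝ) + f = i' + f') : i = i' ∧ f = f' := by
  have hf : f = f' := by
    have := congrArg Int.fract h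
    rwa [Int.fract_natCast_add, Int.fract_natCast_add, Int.fract_eq_self.2 ⟨h0, h1⟩,
      Int.fract_eq_self.2 ⟨h0', h1'⟩] at this
  subst hf
  exact ⟨by exact_mod_cast add_right_cancel h, rfl⟩

/-- Recognising indicators of points. -/
theorem rec_ind {K : Type} (N : ℕ) (k : K) :
    Rec N 16 fun c : K → ℝ → ℕ => ∃ x, c k = ind x := by
  have h1 := Rec.any (N := N) (fun b : K → ℕ → ℕ => ∃ i, b k i ≠ 0) (by simp)
  have h2 := Rec.any (N := N) (fun b : K → ℕ → ℕ => ∃ i i', b k i ≠ 0 ∧ b k i' ≠ 0 ∧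
    (b k i ≠ 1 ∨ i ≠ i')) (by simp)
  have h3 := Rec.pairs (N := N) (ι := Unit) (fun _ (b : K → ℕ → ℕ) => ∃ i, b k i ≠ 0)
    (fun _ (b : K → ℕ → ℕ) => ∃ i, b k i ≠ 0) (by simp) (by simp)
  refine (((h1.and h2.not).and h3.not).mono (by simp)).congr fun c hc => ?_
  constructor
  · rintro ⟨x, hx⟩
    have hx0 : 0 ≤ x := (hc.1 k x (by simp [hx, ind])).1
    have hiff : ∀ y, c k y ≠ 0 ↔ y = x := fun y => by simp [hx, ind]
    obtain ⟨i, f, h0, h1, rfl⟩ := exists_col hx0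
    refine ⟨⟨⟨f, h0, h1, i, (hiff _).2 rfl⟩, ?_⟩, ?_⟩
    · rintro ⟨f', h0', h1', j, j', hj, hj', hor⟩
      have e1 := (hiff _).1 hj
      have e2 := (hiff _).1 hj'
      rcases hor with hor | hor
      · exact hor (by simp [col, hx, ind, e1])
      · exact hor (by exact_mod_cast add_right_cancel (e1.trans e2.symm))
    · rintro ⟨-, f', f'', h0', hlt, h1', ⟨j, hj⟩, ⟨j', hj'⟩⟩
      have e := ((hiff _).1 hj).trans ((hiff _).1 hj').symm
      exact hlt.ne (col_unique h0' (hlt.trans h1') (h0'.trans hlt.le) h1' e).2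
  · rintro ⟨⟨⟨f, h0, h1, i, hi⟩, hn⟩, hn'⟩
    refine ⟨i + f, ?_⟩
    funext y
    have hone : ∀ y, c k y ≠ 0 → c k y = 1 := by
      intro y hy
      obtain ⟨j, g, g0, g1, rfl⟩ := exists_col (hc.1 k y hy).1
      by_contra hne
      exact hn ⟨g, g0, g1, j, j, hy, hy, Or.inl hne⟩
    by_cases hy : c k y = 0
    · rw [hy, ind, if_neg]
      rintro rfl
      exact hi hy
    · rw [hone y hy, ind, if_pos]
      obtain ⟨j, g, g0, g1, rfl⟩ := exists_col (hc.1 k y hy).1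
      rcases lt_trichotomy g f with h | rfl | h
      · exact absurd ⟨(), g, f, g0, h, h1, ⟨j, hy⟩, ⟨i, hi⟩⟩ hn'
      · by_contra hne
        exact hn ⟨g, g0, g1, j, i, hy, hi, Or.inr fun h => hne (by rw [h])⟩
      · exact absurd ⟨(), f, g, h0, h, g1, ⟨i, hi⟩, ⟨j, hy⟩⟩ hn'

theorem rec_const {K : Type} (N : ℕ) (p : Prop) : Rec N 1 fun _ : K → ℝ → ℕ => p :=
  ⟨Unit, inferInstance, ⟨fun _ => (), fun q _ => q, fun _ => p, fun _ => rfl⟩, by simp,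
    fun _ hc => ⟨fun hp => let ⟨l, hl⟩ := hc.exists_cover; ⟨l, hl, hp⟩, fun ⟨_, _, hp⟩ => hp⟩⟩

/-- Definability by automata of size at most `tw b h`. -/
def Def (N b h : ℕ) (P : (ℕ → ℝ → ℕ) → (ℝ → ℕ) → (ℕ → ℝ) → Prop) : Prop :=
  ∃ P', Rec N (tw b h) P' ∧ ∀ c a v, Good N (cfg c a v) → (P c a v ↔ P' (cfg c a v))

theorem mul_self_le_two_pow {x : ℕ} (h : 4 ≤ x) : x * x ≤ 2 ^ x := by
  induction x, h using Nat.le_induction with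
  | base => norm_num
  | succ x h ih =>
    rw [pow_succ]
    nlinarith

namespace Def

variable {N b h h' : ℕ} {P Q : (ℕ → ℝ → ℕ) → (ℝ → ℕ) → (ℕ → ℝ) → Prop}

theorem mono (hP : Def N b h P) (hh : h ≤ h') : Def N b h' P :=
  let ⟨P', h1, h2⟩ := hP
  ⟨P', h1.mono (tw_mono b hh), h2⟩

theorem congr (hP : Def N b h P) (hPQ : ∀ c a v, Good N (cfg c a v) → (Q c a v ↔ P c a v)) :
    Def N b h Q :=
  let ⟨P', h1, h2⟩ := hP
  ⟨P', h1, fun c a v hc => (hPQ c a v hc).trans (h2 c a v hc)⟩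

theorem not (hP : Def N b h P) : Def N b h fun c a v => ¬ P c a v :=
  let ⟨_, h1, h2⟩ := hP
  ⟨_, h1.not, fun c a v hc => not_congr (h2 c a v hc)⟩

theorem and (hb : 16 ≤ b) (hP : Def N b h P) (hQ : Def N b h Q) :
    Def N b (h + 1) fun c a v => P c a v ∧ Q c a v := by
  obtain ⟨P', h1, h2⟩ := hP
  obtain ⟨Q', h3, h4⟩ := hQ
  exact ⟨_, (h1.and h3).mono (mul_self_le_two_pow (by have := le_tw b h; omega)),
    fun c a v hc => and_congr (h2 c a v hc) (h4 c a v hc)⟩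

theorem or (hb : 16 ≤ b) (hP : Def N b h P) (hQ : Def N b h Q) :
    Def N b (h + 1) fun c a v => P c a v ∨ Q c a v :=
  (hP.not.and hb hQ.not).not.congr fun c a v _ => by tauto

theorem forall_mem {α : Type} (hb : 16 ≤ b) (l : List α) (hl : l.length ≤ b)
    {R : α → (ℕ → ℝ → ℕ) → (ℝ → ℕ) → (ℕ → ℝ) → Prop} (hR : ∀ x ∈ l, Def N b h (R x)) :
    Def N b (h + 2) fun c a v => ∀ x ∈ l, R x c a v := by
  have key : ∃ P', Rec N (tw b h ^ l.length) P' ∧ ∀ c a v, Good N (cfg c a v) →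
      ((∀ x ∈ l, R x c a v) ↔ P' (cfg c a v)) := by
    clear hl
    induction l with
    | nil =>
      exact ⟨_, by simpa using rec_const N True, fun c a v _ => by simp⟩
    | cons x l ih =>
      obtain ⟨P', h1, h2⟩ := ih fun y hy => hR y (by simp [hy])
      obtain ⟨Q', h3, h4⟩ := hR x (by simp)
      refine ⟨_, (h1.and h3).mono (by rw [List.length_cons, pow_succ]), fun c a v hc => ?_⟩
      rw [List.forall_mem_cons, and_comm]
      exact and_congr (h2 c a v hc) (h4 c a v hc)
  obtain ⟨P', h1, h2⟩ := key
  refine ⟨P', h1.mono ?_, h2⟩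
  have hbt := le_tw b h
  have h4 : 4 ≤ tw b h := by omega
  calc tw b h ^ l.length ≤ (2 ^ tw b h) ^ tw b h := by
        refine (Nat.pow_le_pow_left Nat.lt_two_pow_self.le _).trans ?_
        exact Nat.pow_le_pow_right (by positivity) (hl.trans hbt)
    _ = 2 ^ (tw b h * tw b h) := by rw [← pow_mul]
    _ ≤ 2 ^ (2 ^ tw b h) := Nat.pow_le_pow_right two_pos (mul_self_le_two_pow h4)

theorem ex_pt (hb : 16 ≤ b) (hP : Def N b h P) (j : ℕ) :
    Def N b (h + 2) fun c a v => ∃ x : ℝ, 0 ≤ x ∧ x < N ∧ P c a (Function.update v j x) := by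
  obtain ⟨P', h1, h2⟩ := hP
  have hbt := le_tw b h
  refine ⟨_, ((h1.and (rec_ind N (Trk.pt j))).exists_track (.pt j)).mono
    (Nat.pow_le_pow_right two_pos ?_), fun c a v hc => ?_⟩
  · exact (Nat.mul_le_mul_left _ (by omega)).trans
      (mul_self_le_two_pow (x := tw b h) (by omega))
  · constructor
    · rintro ⟨x, h0, hN, hx⟩
      have hs := supp_ind h0 hN
      refine ⟨ind x, hs.1, hs.2, ?_, x, by simp⟩
      have hg := Aut.good_update hc (.pt j) hs.1 hs.2
      rw [update_pt] at hg ⊢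
      exact (h2 _ _ _ hg).1 hx
    · rintro ⟨t, ht, ht', hP', x, hx⟩
      rw [Function.update_self] at hx
      subst hx
      have hxN := ht x (by simp [ind])
      have hg := Aut.good_update hc (.pt j) ht ht'
      rw [update_pt] at hg hP'
      exact ⟨x, hxN.1, hxN.2, (h2 _ _ _ hg).2 hP'⟩

theorem all_pt (hb : 16 ≤ b) (hP : Def N b h P) (j : ℕ) :
    Def N b (h + 2) fun c a v => ∀ x : ℝ, 0 ≤ x → x < N → P c a (Function.update v j x) :=
  (hP.not.ex_pt hb j).not.congr fun c a v _ => by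
    push Not
    rfl

theorem ex_tmp (hP : Def N b h P) :
    Def N b (h + 1) fun c _ v => ∃ a, Supp N a ∧ P c a v := by
  obtain ⟨P', h1, h2⟩ := hP
  refine ⟨_, h1.exists_track .tmp, fun c a v hc => exists_congr fun a' => ?_⟩
  rw [Supp, and_assoc]
  refine and_congr_right fun h3 => and_congr_right fun h4 => ?_
  have hg := Aut.good_update hc .tmp h3 h4
  rw [update_tmp] at hg ⊢
  exact h2 _ _ _ hg

theorem move_tmp (hP : Def N b h P) (π : ℕ) :
    Def N b h fun c a v => P (Function.update c π a) a v := by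
  obtain ⟨P', h1, h2⟩ := hP
  let f : Trk → Trk := fun k => if k = .run π then .tmp else k
  have hf : ∀ c a v, (fun k => cfg c a v (f k)) = cfg (Function.update c π a) a v := by
    intro c a v
    rw [← update_run]
    funext k
    by_cases hk : k = .run π
    · subst hk; simp [f, cfg]
    · simp [f, hk]
  refine ⟨_, h1.comap f, fun c a v hc => ?_⟩
  have := hc.comp f
  rw [hf] at this ⊢
  exact h2 _ _ _ this

theorem move_pt (hP : Def N b h P) (g : ℕ → ℕ) :
    Def N b h fun c a v => P c a fun j => v (g j) := by
  obtain ⟨P', h1, h2⟩ := hP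
  let f : Trk → Trk := fun k => match k with
    | .pt j => .pt (g j)
    | k => k
  have hf : ∀ c a v, (fun k => cfg c a v (f k)) = cfg c a fun j => v (g j) := by
    intro c a v
    funext k
    cases k <;> rfl
  refine ⟨_, h1.comap f, fun c a v hc => ?_⟩
  have := hc.comp f
  rw [hf] at this ⊢
  exact h2 _ _ _ this

theorem col_at (hb : 16 ≤ b) (j : ℕ) (R : (ℕ → ℕ) → ℕ → Prop) :
    Def N b h fun c a v => R (fun π => c π (v j)) (a (v j)) := by
  have h1 := Rec.any (N := N) (fun b : Trk → ℕ → ℕ => ∃ i, b (.pt j) i ≠ 0 ∧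
    R (fun π => b (.run π) i) (b .tmp i)) (by simp)
  refine ⟨_, h1.mono (by have := le_tw b h; omega), fun c a v hc => ?_⟩
  constructor
  · intro hR
    obtain ⟨i, f, h0, h1, hv⟩ := exists_col (hc.pt_mem j).1
    refine ⟨f, h0, h1, i, ?_, ?_⟩
    · simp [col, cfg, ind, hv]
    · simpa only [col, cfg, ← hv] using hR
  · rintro ⟨f, h0, h1, i, hi, hR⟩
    have hv : (i : ℝ) + f = v j := by
      by_contra hne
      simp [col, cfg, ind, hne] at hi
    simpa only [col, cfg, hv] using hR

theorem pt_zero (hb : 16 ≤ b) (j : ℕ) : Def N b h fun _ _ v => v j = 0 := by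
  refine ⟨_, (Rec.atZero fun b : Trk → ℕ → ℕ => b (.pt j) 0 ≠ 0).mono
    (by have := le_tw b h; omega), fun c a v _ => ?_⟩
  simp [col, cfg, ind, eq_comm]

end Def

/-- Relations on time points that only depend on integer parts and on the order of the fractional
parts. -/
def RegInv (R : ℝ → ℝ → Prop) : Prop :=
  ∀ (i i' : ℕ) (f f' : ℝ), 0 ≤ f → f < f' → f' < 1 →
    (R (i + f) (i' + f') ↔ R i (i' + 1 / 2)) ∧ (R (i + f') (i' + f) ↔ R (i + 1 / 2) i') ∧
      (R (i + f) (i' + f) ↔ R i i')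

namespace RegInv

variable {R S : ℝ → ℝ → Prop}

theorem not (hR : RegInv R) : RegInv fun x y => ¬ R x y := fun i i' f f' h0 h h1 =>
  let ⟨a, b, c⟩ := hR i i' f f' h0 h h1
  ⟨not_congr a, not_congr b, not_congr c⟩

theorem and (hR : RegInv R) (hS : RegInv S) : RegInv fun x y => R x y ∧ S x y :=
  fun i i' f f' h0 h h1 =>
    let ⟨a, b, c⟩ := hR i i' f f' h0 h h1
    let ⟨a', b', c'⟩ := hS i i' f f' h0 h h1
    ⟨and_congr a a', and_congr b b', and_congr c c'⟩

theorem or (hR : RegInv R) (hS : RegInv S) : RegInv fun x y => R x y ∨ S x y :=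
  fun i i' f f' h0 h h1 =>
    let ⟨a, b, c⟩ := hR i i' f f' h0 h h1
    let ⟨a', b', c'⟩ := hS i i' f f' h0 h h1
    ⟨or_congr a a', or_congr b b', or_congr c c'⟩

theorem const (p : Prop) : RegInv fun _ _ => p :=
  fun _ _ _ _ _ _ _ => ⟨Iff.rfl, Iff.rfl, Iff.rfl⟩

theorem congr (hR : RegInv R) (h : ∀ x y, S x y ↔ R x y) : RegInv S := by
  have : S = R := funext fun x => funext fun y => propext (h x y)
  rwa [this]

theorem int_add_lt {m k : ℤ} {e : ℝ} (h0 : 0 < e) (h1 : e < 1) : (m : ℝ) + e < k ↔ m < k := by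
  constructor
  · intro h
    exact_mod_cast (by linarith : (m : ℝ) < k)
  · intro h
    have : (m : ℝ) + 1 ≤ k := by exact_mod_cast h
    linarith

theorem int_sub_lt {m k : ℤ} {e : ℝ} (h0 : 0 < e) (h1 : e < 1) : (m : ℝ) - e < k ↔ m ≤ k := by
  constructor
  · intro h
    have : (m : ℝ) < (k + 1 : ℤ) := by push_cast; linarith
    exact Int.lt_add_one_iff.1 (by exact_mod_cast this)
  · intro h
    have : (m : ℝ) ≤ k := by exact_mod_cast h
    linarith

theorem sub_lt (k : ℕ) : RegInv fun x y => y - x < k := by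
  intro i i' f f' h0 h h1
  have e : ∀ a b : ℝ, ((i' : ℝ) + a - (i + b) < (k : ℝ)) =
      (((i' - i : ℤ) : ℝ) + (a - b) < ((k : ℤ) : ℝ)) := by
    intro a b
    push_cast
    rw [eq_iff_iff]
    constructor <;> intro h <;> linarith
  have e' : ∀ a b : ℝ, ((i' : ℝ) + a - (i + b) < (k : ℝ)) =
      (((i' - i : ℤ) : ℝ) - (b - a) < ((k : ℤ) : ℝ)) := by
    intro a b
    push_cast
    rw [eq_iff_iff]
    constructor <;> intro h <;> linarith
  refine ⟨?_, ?_, ?_⟩ <;> beta_reduce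
  · conv_rhs => rw [← add_zero (i : ℝ)]
    rw [e, e, int_add_lt (by linarith) (by linarith), int_add_lt (by norm_num) (by norm_num)]
  · conv_rhs => rw [← add_zero (i' : ℝ)]
    rw [e', e', int_sub_lt (by linarith) (by linarith), int_sub_lt (by norm_num) (by norm_num)]
  · rw [add_sub_add_right_eq_sub]

theorem sub_gt (k : ℕ) : RegInv fun x y => k < y - x := by
  intro i i' f f' h0 h h1
  have e : ∀ a b : ℝ, ((k : ℝ) < (i' : ℝ) + a - (i + b)) =
      (((i - i' : ℤ) : ℝ) - (a - b) < ((-k : ℤ) : ℝ)) := by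
    intro a b
    push_cast
    rw [eq_iff_iff]
    constructor <;> intro h <;> linarith
  have e' : ∀ a b : ℝ, ((k : ℝ) < (i' : ℝ) + a - (i + b)) =
      (((i - i' : ℤ) : ℝ) + (b - a) < ((-k : ℤ) : ℝ)) := by
    intro a b
    push_cast
    rw [eq_iff_iff]
    constructor <;> intro h <;> linarith
  refine ⟨?_, ?_, ?_⟩ <;> beta_reduce
  · conv_rhs => rw [← add_zero (i : ℝ)]
    rw [e, e, int_sub_lt (by linarith) (by linarith), int_sub_lt (by norm_num) (by norm_num)]
  · conv_rhs => rw [← add_zero (i' : ℝ)]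
    rw [e', e', int_add_lt (by linarith) (by linarith), int_add_lt (by norm_num) (by norm_num)]
  · rw [add_sub_add_right_eq_sub]

theorem lt : RegInv fun x y => x < y :=
  (sub_gt 0).congr fun x y => by rw [Nat.cast_zero, sub_pos]

theorem mem (I : FIvl ℕ) : RegInv fun x y => FIvl.Mem natR x y I := by
  refine and ?_ ?_
  · cases I.loC
    · exact (sub_gt I.lo).congr fun x y => by
        simp only [natR, Bool.false_eq_true, if_false]
        constructor <;> intro h <;> linarith
    · exact (sub_lt I.lo).not.congr fun x y => by
        simp only [natR, if_true, not_lt]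
        constructor <;> intro h <;> linarith
  · cases I.hi with
    | none => exact (const True).congr fun x y => by simp
    | some k =>
      cases I.hiC
      · exact (sub_lt k).congr fun x y => by
          simp only [natR, Option.some.injEq, Bool.false_eq_true, if_false, forall_eq']
          constructor <;> intro h <;> linarith
      · exact (sub_gt k).not.congr fun x y => by
          simp only [natR, Option.some.injEq, if_true, forall_eq', not_lt]
          constructor <;> intro h <;> linarith

theorem holds (g : ClkC ℕ) : RegInv fun x y => ClkC.holds natR (y - x) g := by
  induction g with
  | atom o k =>
    cases o
    · exact sub_lt k
    · exact (sub_gt k).not.congr fun x y => by simp [ClkC.holds, Cmp.denote, natR]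
    · exact ((sub_lt k).not.and (sub_gt k).not).congr fun x y => by
        simp only [ClkC.holds, Cmp.denote, natR, not_lt]
        exact ⟨fun h => ⟨h.ge, h.le⟩, fun h => le_antisymm h.2 h.1⟩
    · exact (sub_lt k).not.congr fun x y => by simp [ClkC.holds, Cmp.denote, natR]
    · exact sub_gt k
  | disj a b ha hb => exact ha.or hb
  | conj a b ha hb => exact ha.and hb

end RegInv

/-- Region-invariant relations between two points are definable. -/
theorem Def.rel {N b h : ℕ} (hb : 16 ≤ b) (hN : 2 ^ N * 2 ≤ b) (j j' : ℕ) {R : ℝ → ℝ → Prop}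
    (hR : RegInv R) : Def N b (h + 2) fun _ _ v => R (v j) (v j') := by
  have hcol : ∀ {c a v} (j : ℕ) {f : ℝ} {i : ℕ}, col (cfg c a v) f (.pt j) i ≠ 0 → v j = i + f := by
    intro c a v j f i hi
    by_contra hne
    exact hi (by simp [col, cfg, ind, Ne.symm hne])
  have hcol' : ∀ {c a v} (j : ℕ) {f : ℝ} {i : ℕ}, v j = i + f →
      col (cfg c a v) f (.pt j) i ≠ 0 := by
    intro c a v j f i hi
    simp [col, cfg, ind, hi]
  have hbt := le_tw b h
  have def1 : Def N b h fun c a v => ∃ (i : Fin N) (f f' : ℝ), 0 ≤ f ∧ f < f' ∧ f' < 1 ∧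
      col (cfg c a v) f (.pt j) i ≠ 0 ∧
      ∃ i', col (cfg c a v) f' (.pt j') i' ≠ 0 ∧ R (i : ℕ) (i' + 1 / 2) :=
    ⟨_, (Rec.pairs (ι := Fin N) (fun i b => b (Trk.pt j) i ≠ 0)
      (fun i b => ∃ i', b (Trk.pt j') i' ≠ 0 ∧ R (i : ℕ) (i' + 1 / 2)) (by simp) (by simp)).mono
      (by rw [Fintype.card_fin]; omega), fun c a v _ => Iff.rfl⟩
  have def2 : Def N b h fun c a v => ∃ (i' : Fin N) (f f' : ℝ), 0 ≤ f ∧ f < f' ∧ f' < 1 ∧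
      col (cfg c a v) f (.pt j') i' ≠ 0 ∧
      ∃ i, col (cfg c a v) f' (.pt j) i ≠ 0 ∧ R (i + 1 / 2) (i' : ℕ) :=
    ⟨_, (Rec.pairs (ι := Fin N) (fun i' b => b (Trk.pt j') i' ≠ 0)
      (fun i' b => ∃ i, b (Trk.pt j) i ≠ 0 ∧ R (i + 1 / 2) (i' : ℕ)) (by simp) (by simp)).mono
      (by rw [Fintype.card_fin]; omega), fun c a v _ => Iff.rfl⟩
  have def3 : Def N b (h + 1) fun c a v => ∃ f : ℝ, 0 ≤ f ∧ f < 1 ∧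
      ∃ i i' : ℕ, col (cfg c a v) f (.pt j) i ≠ 0 ∧ col (cfg c a v) f (.pt j') i' ≠ 0 ∧ R i i' :=
    ⟨_, (Rec.any (fun b => ∃ i i' : ℕ, b (Trk.pt j) i ≠ 0 ∧ b (Trk.pt j') i' ≠ 0 ∧ R i i')
      (by simp)).mono (by have := le_tw b (h + 1); omega), fun c a v _ => Iff.rfl⟩
  refine ((def1.or hb def2).or hb def3).congr fun c a v hc => ?_
  constructor
  · intro h
    obtain ⟨hj0, hjN⟩ := hc.pt_mem j
    obtain ⟨hj0', hjN'⟩ := hc.pt_mem j'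
    obtain ⟨i, f, f0, f1, hv⟩ := exists_col hj0
    obtain ⟨i', f', f0', f1', hv'⟩ := exists_col hj0'
    have hiN : i < N := by
      have : (i : ℝ) < N := by linarith
      exact_mod_cast this
    have hiN' : i' < N := by
      have : (i' : ℝ) < N := by linarith
      exact_mod_cast this
    rw [hv, hv'] at h
    rcases lt_trichotomy f f' with hlt | rfl | hlt
    · exact Or.inl (Or.inl ⟨⟨i, hiN⟩, f, f', f0, hlt, f1', hcol' j hv, i', hcol' j' hv',
        (hR i i' f f' f0 hlt f1').1.1 h⟩)
    · obtain ⟨g, hg, hg1⟩ := exists_between f1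
      exact Or.inr ⟨f, f0, f1, i, i', hcol' j hv, hcol' j' hv', (hR i i' f g f0 hg hg1).2.2.1 h⟩
    · exact Or.inl (Or.inr ⟨⟨i', hiN'⟩, f', f, f0', hlt, f1, hcol' j' hv', i, hcol' j hv,
        (hR i i' f' f f0' hlt f1).2.1.1 h⟩)
  · rintro ((⟨i, f, f', f0, hlt, f1', h1, i', h2, h⟩ | ⟨i', f, f', f0, hlt, f1', h1, i, h2, h⟩) |
      ⟨f, f0, f1, i, i', h1, h2, h⟩)
    · rw [hcol j h1, hcol j' h2]
      exact (hR i i' f f' f0 hlt f1').1.2 h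
    · rw [hcol j h2, hcol j' h1]
      exact (hR i i' f f' f0 hlt f1').2.1.2 h
    · obtain ⟨g, hg, hg1⟩ := exists_between f1
      rw [hcol j h1, hcol j' h2]
      exact (hR i i' f g f0 hg hg1).2.2.2 h

/-! ### Codes of transitions -/

/-- The list of natural numbers with the given code. -/
def unlist (n : ℕ) : List ℕ := Denumerable.ofNat (List ℕ) n

theorem encList_eq {α : Type} (f : α → ℕ) (l : List α) : encList f l = Encodable.encode (l.map f) := by
  induction l with
  | nil => rfl
  | cons a l ih => simp [encList, ih]

theorem unlist_encList {α : Type} (f : α → ℕ) (l : List α) : unlist (encList f l) = l.map f := by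
  rw [encList_eq, unlist, Denumerable.ofNat_encode]

theorem unlist_encList_id (l : List ℕ) : unlist (encList id l) = l := by
  rw [unlist_encList, List.map_id]

theorem unlist_zero : unlist 0 = [] := unlist_encList_id []

theorem encList_injective {α : Type} {f : α → ℕ} (hf : Function.Injective f) :
    Function.Injective (encList f) := fun l l' h => by
  have := congrArg unlist h
  rw [unlist_encList, unlist_encList] at this
  exact hf.list_map this

theorem encClkC_injective : Function.Injective encClkC := by
  intro g
  induction g with
  | atom o k =>
    intro g' h
    cases g' with
    | atom o' k' =>
      simp only [encClkC, Nat.pair_eq_pair] at h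
      have : o = o' := by
        have := h.2.1
        cases o <;> cases o' <;> simp [Cmp.code] at this <;> rfl
      rw [this, h.2.2]
    | disj a b => simp [encClkC, Nat.pair_eq_pair] at h
    | conj a b => simp [encClkC, Nat.pair_eq_pair] at h
  | disj a b ha hb =>
    intro g' h
    cases g' with
    | atom o' k' => simp [encClkC, Nat.pair_eq_pair] at h
    | disj a' b' =>
      simp only [encClkC, Nat.pair_eq_pair] at h
      rw [ha h.2.1, hb h.2.2]
    | conj a b => simp [encClkC, Nat.pair_eq_pair] at h
  | conj a b ha hb =>
    intro g' h
    cases g' with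
    | atom o' k' => simp [encClkC, Nat.pair_eq_pair] at h
    | disj a b => simp [encClkC, Nat.pair_eq_pair] at h
    | conj a' b' =>
      simp only [encClkC, Nat.pair_eq_pair] at h
      rw [ha h.2.1, hb h.2.2]

theorem encPEdge_injective : Function.Injective encPEdge := by
  rintro ⟨s, ev, g, r, d⟩ ⟨s', ev', g', r', d'⟩ h
  simp only [encPEdge, Nat.pair_eq_pair, PEdge.src, PEdge.event, PEdge.guard, PEdge.rst,
    PEdge.dst, encGuard] at h
  obtain ⟨rfl, h2, h3, h4, rfl⟩ := h
  rw [encList_injective Function.injective_id h2, encList_injective Function.injective_id h4,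
    encList_injective (fun p q hpq => ?_) h3]
  rw [Nat.pair_eq_pair] at hpq
  exact Prod.ext hpq.1 (encClkC_injective hpq.2)

/-- Source of the transition with code `k - 1`. -/
def srcC (k : ℕ) : ℕ := (k - 1).unpair.1
/-- Event of the transition with code `k - 1`. -/
def evtC (k : ℕ) : List ℕ := unlist (k - 1).unpair.2.unpair.1
/-- Guard codes of the transition with code `k - 1`. -/
def grdC (k : ℕ) : List ℕ := unlist (k - 1).unpair.2.unpair.2.unpair.1
/-- Resets of the transition with code `k - 1`. -/
def rstC (k : ℕ) : List ℕ := unlist (k - 1).unpair.2.unpair.2.unpair.2.unpair.1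
/-- Target of the transition with code `k - 1`. -/
def dstC (k : ℕ) : ℕ := (k - 1).unpair.2.unpair.2.unpair.2.unpair.2

section
variable (e : PEdge ℕ)

theorem srcC_enc : srcC (encPEdge e + 1) = PEdge.src e := by simp [srcC, encPEdge]
theorem evtC_enc : evtC (encPEdge e + 1) = PEdge.event e := by
  simp [evtC, encPEdge, unlist_encList_id]
theorem grdC_enc : grdC (encPEdge e + 1) =
    (PEdge.guard e).map fun q => Nat.pair q.1 (encClkC q.2) := by
  simp [grdC, encPEdge, encGuard, unlist_encList]
theorem rstC_enc : rstC (encPEdge e + 1) = PEdge.rst e := by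
  simp [rstC, encPEdge, unlist_encList_id]
theorem dstC_enc : dstC (encPEdge e + 1) = PEdge.dst e := by simp [dstC, encPEdge]

end

theorem rstC_zero : rstC 0 = [] := by simp [rstC, unlist_zero]

/-! ### Runs as functions of time -/

section
variable {T : Type} [LinearOrder T] [Zero T]

/-- `s` is the time from which the value of the clock `z` at time `x` is measured. -/
def LastReset (a : T → ℕ) (z : ℕ) (x s : T) : Prop :=
  (s = 0 ∧ ∀ y, y < x → z ∉ rstC (a y)) ∨
    (s < x ∧ z ∈ rstC (a s) ∧ ∀ y, s < y → y < x → z ∉ rstC (a y))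

theorem LastReset.unique {a : T → ℕ} {z : ℕ} {x s s' : T} (h : LastReset a z x s)
    (h' : LastReset a z x s') : s = s' := by
  rcases h with ⟨rfl, h⟩ | ⟨hs, hz, h⟩ <;> rcases h' with ⟨rfl, h'⟩ | ⟨hs', hz', h'⟩
  · rfl
  · exact absurd hz' (h _ hs')
  · exact absurd hz (h' _ hs)
  · rcases lt_trichotomy s s' with hlt | heq | hlt
    · exact absurd hz' (h _ hlt hs')
    · exact heq
    · exact absurd hz (h' _ hlt hs)

/-- The coded data of a point-based timed automaton. -/
structure Code where
  trans : List ℕ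
  start : ℕ
  final : List ℕ

/-- The coded data of `B`. -/
def codeOf (B : PTA ℕ) : Code := ⟨B.trans.map encPEdge, B.start, B.final⟩

/-- The function `a` describes an accepting run; `H s x g` says that the clock constraint with
code `g` holds at `x` if the clock was last reset at `s`. -/
structure Valid (C : Code) (H : T → T → ℕ → Prop) (a : T → ℕ) : Prop where
  mem : ∀ x, a x ≠ 0 → ∃ e ∈ C.trans, a x = e + 1
  nonempty : ∃ x, a x ≠ 0
  start : ∀ x, a x ≠ 0 → (∀ y, y < x → a y = 0) → srcC (a x) = C.start
  step : ∀ x y, x < y → a x ≠ 0 → a y ≠ 0 → (∀ z, x < z → z < y → a z = 0) →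
    srcC (a y) = dstC (a x)
  final : ∀ x, a x ≠ 0 → (∀ y, x < y → a y = 0) → dstC (a x) ∈ C.final
  guard : ∀ x, a x ≠ 0 → ∀ q ∈ grdC (a x), ∀ s, LastReset a q.unpair.1 x s → H s x q.unpair.2

end

/-- Truth of coded clock constraints. -/
def HR (s x : ℝ) (n : ℕ) : Prop := ∃ g, encClkC g = n ∧ ClkC.holds natR (x - s) g

theorem HR_enc (s x : ℝ) (g : ClkC ℕ) : HR s x (encClkC g) ↔ ClkC.holds natR (x - s) g :=
  ⟨fun ⟨_, h, h'⟩ => encClkC_injective h ▸ h', fun h => ⟨g, rfl, h⟩⟩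

/-- Runs with increasing times. -/
def Inc (η : PRun ℕ) : Prop := η.times.length = η.n ∧ ∀ i, i + 1 < η.n → η.time i < η.time (i + 1)

open Classical in
/-- The function of time describing a run. -/
noncomputable def fn (η : PRun ℕ) (x : ℝ) : ℕ :=
  if h : ∃ i, i < η.n ∧ η.time i = x then encPEdge (η.edge h.choose) + 1 else 0

section
variable {η η' : PRun ℕ}

theorem Inc.lt (h : Inc η) {i j : ℕ} (hij : i < j) (hj : j < η.n) : η.time i < η.time j := by
  induction j, hij using Nat.le_induction with
  | base => exact h.2 _ hj
  | succ j hij ih => exact (ih (by omega)).trans (h.2 _ hj)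

theorem Inc.lt_iff (h : Inc η) {i j : ℕ} (hi : i < η.n) (hj : j < η.n) :
    η.time i < η.time j ↔ i < j := by
  refine ⟨fun hlt => ?_, fun hij => h.lt hij hj⟩
  rcases lt_trichotomy i j with hij | rfl | hij
  · exact hij
  · exact absurd hlt (lt_irrefl _)
  · exact absurd (hlt.trans (h.lt hij hi)) (lt_irrefl _)

theorem Inc.inj (h : Inc η) {i j : ℕ} (hi : i < η.n) (hj : j < η.n)
    (hij : η.time i = η.time j) : i = j := by
  rcases lt_trichotomy i j with h' | h' | h'
  · exact absurd hij (h.lt h' hj).ne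
  · exact h'
  · exact absurd hij (h.lt h' hi).ne'

theorem fn_ne_zero {x : ℝ} : fn η x ≠ 0 ↔ ∃ i, i < η.n ∧ η.time i = x := by
  unfold fn
  split_ifs with h <;> simp [h]

theorem Inc.fn_time (h : Inc η) {i : ℕ} (hi : i < η.n) :
    fn η (η.time i) = encPEdge (η.edge i) + 1 := by
  have hex : ∃ j, j < η.n ∧ η.time j = η.time i := ⟨i, hi, rfl⟩
  rw [fn, dif_pos hex, h.inj hex.choose_spec.1 hi hex.choose_spec.2]

theorem fn_default : fn default = 0 := by
  funext x
  by_contra h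
  obtain ⟨i, hi, -⟩ := fn_ne_zero.1 h
  exact absurd hi (Nat.not_lt_zero i)

theorem inc_default : Inc default := ⟨rfl, fun _ hi => absurd hi (Nat.not_lt_zero _)⟩

theorem Inc.exists_evt (h : Inc η) {t : ℝ} (P : ℕ → List ℕ → Prop) (p : ℕ) :
    (∃ i, i < η.n ∧ η.time i = t ∧ P p (PEdge.event (η.edge i))) ↔
      fn η t ≠ 0 ∧ P p (evtC (fn η t)) := by
  constructor
  · rintro ⟨i, hi, rfl, hP⟩
    exact ⟨fn_ne_zero.2 ⟨i, hi, rfl⟩, by rwa [h.fn_time hi, evtC_enc]⟩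
  · rintro ⟨h0, hP⟩
    obtain ⟨i, hi, rfl⟩ := fn_ne_zero.1 h0
    exact ⟨i, hi, rfl, by rwa [h.fn_time hi, evtC_enc] at hP⟩

theorem Inc.le_len (h : Inc η) (h0 : 0 < η.n) {t : ℝ} :
    t ≤ η.len ↔ ∃ x, t ≤ x ∧ fn η x ≠ 0 := by
  constructor
  · exact fun ht => ⟨_, ht, fn_ne_zero.2 ⟨η.n - 1, by omega, rfl⟩⟩
  · rintro ⟨x, hx, hne⟩
    obtain ⟨i, hi, rfl⟩ := fn_ne_zero.1 hne
    refine hx.trans ?_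
    rcases (by omega : i < η.n - 1 ∨ i = η.n - 1) with h' | h'
    · exact (h.lt h' (by omega)).le
    · exact h' ▸ le_rfl

theorem Inc.mu_eq (h : Inc η) (z : ℕ) {i : ℕ} (hi : i < η.n) :
    ∃ s, LastReset (fn η) z (η.time i) s ∧
      η.mu i z + (η.time i - η.tprev i) = η.time i - s := by
  have hrst : ∀ y, z ∈ rstC (fn η y) → ∃ j, j < η.n ∧ η.time j = y ∧ z ∈ PEdge.rst (η.edge j) := by
    intro y hy
    have h0 : fn η y ≠ 0 := fun h0 => by simp [h0, rstC_zero] at hy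
    obtain ⟨j, hj, rfl⟩ := fn_ne_zero.1 h0
    exact ⟨j, hj, rfl, by rwa [h.fn_time hj, rstC_enc] at hy⟩
  induction i with
  | zero =>
    refine ⟨0, Or.inl ⟨rfl, fun y hy hz => ?_⟩, by simp [PRun.mu, PRun.tprev]⟩
    obtain ⟨j, hj, rfl, -⟩ := hrst y hz
    exact absurd ((h.lt_iff hj hi).1 hy) (Nat.not_lt_zero _)
  | succ i ih =>
    have hi' : i < η.n := by omega
    have hp : η.tprev (i + 1) = η.time i := by simp [PRun.tprev]
    have hbtw : ∀ y, η.time i < y → y < η.time (i + 1) → z ∉ rstC (fn η y) := by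
      intro y hy hy' hz
      obtain ⟨j, hj, rfl, -⟩ := hrst y hz
      have h1 := (h.lt_iff hi' hj).1 hy
      have h2 := (h.lt_iff hj hi).1 hy'
      omega
    by_cases hz : z ∈ PEdge.rst (η.edge i)
    · refine ⟨η.time i, Or.inr ⟨h.2 i hi, ?_, hbtw⟩, ?_⟩
      · rwa [h.fn_time hi', rstC_enc]
      · simp [PRun.mu, hz, hp]
    · obtain ⟨s, hs, hmu⟩ := ih hi'
      have hni : z ∉ rstC (fn η (η.time i)) := by rwa [h.fn_time hi', rstC_enc]
      refine ⟨s, ?_, ?_⟩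
      · rcases hs with ⟨rfl, hs⟩ | ⟨hs, hzs, hs'⟩
        · refine Or.inl ⟨rfl, fun y hy => ?_⟩
          rcases lt_trichotomy y (η.time i) with h' | rfl | h'
          · exact hs y h'
          · exact hni
          · exact hbtw y h' hy
        · refine Or.inr ⟨hs.trans (h.2 i hi), hzs, fun y hy hy' => ?_⟩
          rcases lt_trichotomy y (η.time i) with h' | rfl | h'
          · exact hs' y hy h'
          · exact hni
          · exact hbtw y h' hy'
      · rw [PRun.mu, if_neg hz, hmu, hp]
        ring

theorem Inc.supp (h : Inc η) (h0 : 0 ≤ η.time 0) {N : ℕ} (hN : η.BoundedBy N) :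
    Supp N (fn η) := by
  refine ⟨fun x hx => ?_, ?_⟩
  · obtain ⟨i, hi, rfl⟩ := fn_ne_zero.1 hx
    refine ⟨h0.trans ?_, hN i hi⟩
    rcases Nat.eq_zero_or_pos i with rfl | h'
    · exact le_rfl
    · exact (h.lt h' hi).le
  · refine ((Set.finite_Iio η.n).image η.time).subset fun x hx => ?_
    obtain ⟨i, hi, rfl⟩ := fn_ne_zero.1 hx
    exact ⟨i, hi, rfl⟩

theorem inc_of_inSem {B : PTA ℕ} {bd : Option ℝ} (h : η.InSem natR B bd) : Inc η :=
  ⟨h.1.1.2.1, h.1.1.2.2.2.1⟩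

theorem supp_of_inSem {B : PTA ℕ} {N : ℕ} (h : η.InSem natR B (some (N : ℝ))) : Supp N (fn η) :=
  (inc_of_inSem h).supp h.1.1.2.2.1 (h.2 _ rfl)

/-- A nonempty increasing run satisfies the automaton conditions iff its function is valid. -/
theorem Inc.isAccRun_iff (h : Inc η) {B : PTA ℕ} (h0 : 0 < η.n) (ht : 0 ≤ η.time 0) :
    η.IsAccRun natR B ↔ Valid (codeOf B) HR (fn η) := by
  have hz : ∀ y, fn η y = 0 ↔ ∀ i, i < η.n → η.time i ≠ y := fun y => by
    rw [← not_iff_not, ← ne_eq, fn_ne_zero]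
    push Not
    rfl
  constructor
  · rintro ⟨⟨-, -, -, -, hstart, hmem, hstep, hgrd⟩, hfin⟩
    refine ⟨fun x hx => ?_, ⟨_, fn_ne_zero.2 ⟨0, h0, rfl⟩⟩, fun x hx hlt => ?_,
      fun x y hxy hx hy hb => ?_, fun x hx hlt => ?_, fun x hx q hq s hs => ?_⟩
    · obtain ⟨i, hi, rfl⟩ := fn_ne_zero.1 hx
      exact ⟨_, List.mem_map_of_mem (hmem i hi), h.fn_time hi⟩
    · obtain ⟨i, hi, rfl⟩ := fn_ne_zero.1 hx
      rcases Nat.eq_zero_or_pos i with rfl | h'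
      · rw [h.fn_time hi, srcC_enc]
        exact hstart
      · exact absurd rfl ((hz _).1 (hlt _ (h.lt h' hi)) 0 h0)
    · obtain ⟨i, hi, rfl⟩ := fn_ne_zero.1 hx
      obtain ⟨j, hj, rfl⟩ := fn_ne_zero.1 hy
      have hij := (h.lt_iff hi hj).1 hxy
      rcases (by omega : j = i + 1 ∨ i + 1 < j) with rfl | h'
      · rw [h.fn_time hi, h.fn_time hj, srcC_enc, dstC_enc]
        exact hstep i hj
      · exact absurd rfl ((hz _).1 (hb _ (h.2 i (by omega)) (h.lt h' hj)) (i + 1) (by omega))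
    · obtain ⟨i, hi, rfl⟩ := fn_ne_zero.1 hx
      rcases (by omega : i = η.n - 1 ∨ i < η.n - 1) with rfl | h'
      · rw [h.fn_time hi, dstC_enc]
        exact hfin
      · exact absurd rfl ((hz _).1 (hlt _ (h.lt h' (by omega))) (η.n - 1) (by omega))
    · obtain ⟨i, hi, rfl⟩ := fn_ne_zero.1 hx
      rw [h.fn_time hi, grdC_enc] at hq
      obtain ⟨⟨z, g⟩, hq', rfl⟩ := List.mem_map.1 hq
      simp only [Nat.unpair_pair] at hs ⊢
      obtain ⟨s', hs', hmu⟩ := h.mu_eq z hi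
      rw [HR_enc, hs.unique hs', ← hmu]
      exact hgrd i hi _ hq'
  · intro hV
    refine ⟨⟨h0, h.1, ht, h.2, ?_, fun i hi => ?_, fun i hi => ?_, fun i hi q hq => ?_⟩, ?_⟩
    · have := hV.start (η.time 0) (fn_ne_zero.2 ⟨0, h0, rfl⟩) fun y hy => (hz y).2 ?_
      · rwa [h.fn_time h0, srcC_enc] at this
      · rintro i hi rfl
        exact absurd ((h.lt_iff hi h0).1 hy) (Nat.not_lt_zero _)
    · obtain ⟨e, he, heq⟩ := hV.mem (η.time i) (fn_ne_zero.2 ⟨i, hi, rfl⟩)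
      rw [h.fn_time hi] at heq
      obtain ⟨e', he', rfl⟩ := List.mem_map.1 he
      rwa [encPEdge_injective (Nat.succ_injective heq)]
    · have hi' : i < η.n := by omega
      have := hV.step _ _ (h.2 i hi) (fn_ne_zero.2 ⟨i, hi', rfl⟩) (fn_ne_zero.2 ⟨_, hi, rfl⟩)
        fun y hy hy' => (hz y).2 ?_
      · rwa [h.fn_time hi, h.fn_time hi', srcC_enc, dstC_enc] at this
      · rintro j hj rfl
        have h1 := (h.lt_iff hi' hj).1 hy
        have h2 := (h.lt_iff hj hi).1 hy'
        omega
    · obtain ⟨s, hs, hmu⟩ := h.mu_eq q.1 hi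
      rw [hmu, ← HR_enc]
      have := hV.guard (η.time i) (fn_ne_zero.2 ⟨i, hi, rfl⟩) (Nat.pair q.1 (encClkC q.2)) ?_ s
      · simp only [Nat.unpair_pair] at this
        exact this hs
      · rw [h.fn_time hi, grdC_enc]
        exact List.mem_map_of_mem hq
    · have hl : η.n - 1 < η.n := by omega
      have := hV.final (η.time (η.n - 1)) (fn_ne_zero.2 ⟨_, hl, rfl⟩) fun y hy => (hz y).2 ?_
      · rwa [h.fn_time hl, dstC_enc] at this
      · rintro j hj rfl
        have h1 := (h.lt_iff hl hj).1 hy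
        omega

theorem valid_of_inSem {B : PTA ℕ} {bd : Option ℝ} (h : η.InSem natR B bd) :
    Valid (codeOf B) HR (fn η) :=
  ((inc_of_inSem h).isAccRun_iff h.1.1.1 h.1.1.2.2.1).1 h.1

theorem exists_run {B : PTA ℕ} {N : ℕ} {a : ℝ → ℕ} (hs : Supp N a)
    (hV : Valid (codeOf B) HR a) : ∃ η : PRun ℕ, η.InSem natR B (some (N : ℝ)) ∧ fn η = a := by
  classical
  have hmem : ∀ x, a x ≠ 0 → ∃ e, a x = encPEdge e + 1 := fun x hx => by
    obtain ⟨e, he, h⟩ := hV.mem x hx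
    obtain ⟨e', -, rfl⟩ := List.mem_map.1 he
    exact ⟨e', h⟩
  let ed : ℝ → PEdge ℕ := fun x => if h : a x ≠ 0 then (hmem x h).choose else default
  have hed : ∀ x, a x ≠ 0 → a x = encPEdge (ed x) + 1 := fun x hx => by
    simp only [ed, dif_pos hx]
    exact (hmem x hx).choose_spec
  let l : List ℝ := hs.2.toFinset.sort (· ≤ ·)
  have hl : ∀ x, x ∈ l ↔ a x ≠ 0 := fun x => by simp [l]
  have hlt : l.Pairwise (· < ·) := (Finset.sortedLT_sort _).pairwise
  let η : PRun ℕ := ⟨l.map ed, l⟩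
  have hn : η.n = l.length := List.length_map ..
  have htime : ∀ i (hi : i < l.length), η.time i = l[i] := fun i hi => by
    simp [η, PRun.time, hi]
  have hedge : ∀ i (hi : i < l.length), η.edge i = ed l[i] := fun i hi => by
    simp [η, PRun.edge, hi]
  have hinc : Inc η := ⟨hn.symm, fun i hi => by
    rw [hn] at hi
    rw [htime i (by omega), htime (i + 1) hi]
    exact List.pairwise_iff_getElem.1 hlt _ _ _ _ (Nat.lt_succ_self i)⟩
  have hfn : fn η = a := by
    funext x
    by_cases hx : a x = 0
    · rw [hx]
      by_contra h
      obtain ⟨i, hi, rfl⟩ := fn_ne_zero.1 h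
      rw [hn] at hi
      rw [htime i hi] at hx
      exact (hl _).1 (List.getElem_mem hi) hx
    · obtain ⟨i, hi, rfl⟩ := List.getElem_of_mem ((hl x).2 hx)
      rw [← htime i hi, hinc.fn_time (by omega), hedge i hi, htime i hi, ← hed _ hx]
  have hall : ∀ i, i < η.n → 0 ≤ η.time i ∧ η.time i < N := fun i hi => by
    rw [hn] at hi
    rw [htime i hi]
    exact hs.1 _ ((hl _).1 (List.getElem_mem hi))
  have h0 : 0 < η.n := by
    obtain ⟨x, hx⟩ := hV.nonempty
    rw [hn]
    exact List.length_pos_of_mem ((hl x).2 hx)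
  refine ⟨η, ⟨(hinc.isAccRun_iff h0 (hall 0 h0).1).2 (hfn ▸ hV), ?_⟩, hfn⟩
  rintro _ ⟨⟩ i hi
  exact (hall i hi).2

theorem Inc.exists_cut (h : Inc η) (t : ℝ) : ∃ i, i ≤ η.n ∧ (∀ j, j < i → η.time j ≤ t) ∧
    ∀ j, i ≤ j → j < η.n → t < η.time j := by
  classical
  have hex : ∃ i, i = η.n ∨ t < η.time i := ⟨_, Or.inl rfl⟩
  refine ⟨Nat.find hex, Nat.find_min' hex (Or.inl rfl), fun j hj => ?_, fun j hj hjn => ?_⟩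
  · have := Nat.find_min hex hj
    push Not at this
    exact this.2
  · rcases Nat.find_spec hex with h' | h'
    · omega
    · rcases hj.lt_or_eq with h1 | h1
      · exact h'.trans (h.lt h1 hjn)
      · rwa [h1] at h'

theorem Inc.extendsFrom_iff (h : Inc η) (h' : Inc η') (t : ℝ) :
    η'.ExtendsFrom η t ↔ ∀ x, x ≤ t → fn η' x = fn η x := by
  constructor
  · rintro ⟨i, hi, hi', hE, hT, hle, hgt, hgt'⟩ x hx
    have hed : ∀ j, j < i → η'.edge j = η.edge j := fun j hj => by
      have := congrArg (fun l => l.getD j default) hE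
      simpa [List.getElem?_take, hj, PRun.edge] using this
    have htm : ∀ j, j < i → η'.time j = η.time j := fun j hj => by
      have := congrArg (fun l => l.getD j 0) hT
      simpa [List.getElem?_take, hj, PRun.time] using this
    by_cases h0 : fn η x = 0
    · rw [h0]
      by_contra h1
      obtain ⟨j, hj, rfl⟩ := fn_ne_zero.1 h1
      have hji : j < i := by
        by_contra hn
        exact absurd (hgt' j (by omega) hj) (not_lt.2 hx)
      exact fn_ne_zero.2 ⟨j, by omega, (htm j hji).symm⟩ h0
    · obtain ⟨j, hj, rfl⟩ := fn_ne_zero.1 h0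
      have hji : j < i := by
        by_contra hn
        exact absurd (hgt j (by omega) hj) (not_lt.2 hx)
      rw [h.fn_time hj, ← htm j hji, h'.fn_time (by omega), hed j hji]
  · intro hx
    obtain ⟨i, hi, hle, hgt⟩ := h.exists_cut t
    obtain ⟨i', hi', hle', hgt'⟩ := h'.exists_cut t
    have key : ∀ {ζ : PRun ℕ} (hζ : Inc ζ) {k : ℕ} (hk : k ≤ ζ.n)
        (hle : ∀ j, j < k → ζ.time j ≤ t) (hgt : ∀ j, k ≤ j → j < ζ.n → t < ζ.time j),
        (ζ.times.take k).Pairwise (· < ·) ∧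
          (∀ x, x ∈ ζ.times.take k ↔ x ≤ t ∧ fn ζ x ≠ 0) ∧
          (ζ.edges.take k).map (fun e => encPEdge e + 1) = (ζ.times.take k).map (fn ζ) ∧
          (ζ.times.take k).length = k := by
      intro ζ hζ k hk hle hgt
      have hlen : (ζ.times.take k).length = k := by rw [List.length_take, hζ.1, min_eq_left hk]
      have hget : ∀ j (hj : j < (ζ.times.take k).length), (ζ.times.take k)[j] = ζ.time j := by
        intro j hj
        rw [List.getElem_take, PRun.time, List.getD_eq_getElem]
      refine ⟨List.pairwise_iff_getElem.2 fun a b ha hb hab => ?_, fun x => ⟨fun hx => ?_, ?_⟩, ?_,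
        hlen⟩
      · rw [hget, hget]
        exact hζ.lt hab (by omega)
      · obtain ⟨j, hj, rfl⟩ := List.getElem_of_mem hx
        rw [hget]
        rw [hlen] at hj
        exact ⟨hle j hj, fn_ne_zero.2 ⟨j, by omega, rfl⟩⟩
      · rintro ⟨hxt, hx⟩
        obtain ⟨j, hj, rfl⟩ := fn_ne_zero.1 hx
        have hjk : j < k := by
          by_contra hn
          exact absurd (hgt j (by omega) hj) (not_lt.2 hxt)
        rw [← hget j (by omega)]
        exact List.getElem_mem _
      · refine List.ext_getElem ?_ fun j hj hj' => ?_
        · have := hζ.1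
          simp only [List.length_map, List.length_take]
          simp only [PRun.n] at this
          rw [this]
        · simp only [List.length_map] at hj hj'
          have hjn : j < ζ.n := by omega
          rw [List.getElem_map, List.getElem_map, hget, hζ.fn_time hjn, List.getElem_take,
            PRun.edge, List.getD_eq_getElem]
    obtain ⟨hp, hm, he, hl⟩ := key h hi hle hgt
    obtain ⟨hp', hm', he', hl'⟩ := key h' hi' hle' hgt'
    have hT : η'.times.take i' = η.times.take i := by
      refine List.Perm.eq_of_pairwise (le := (· < ·)) (fun a b _ _ hab hba => absurd (hab.trans hba)
        (lt_irrefl _)) hp' hp ((List.perm_ext_iff_of_nodup ?_ ?_).2 fun x => ?_)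
      · exact hp'.imp fun h => h.ne
      · exact hp.imp fun h => h.ne
      · rw [hm, hm']
        exact and_congr_right fun hxt => by rw [hx x hxt]
    have hii : i' = i := by rw [← hl', hT, hl]
    subst hii
    refine ⟨i', hi, hi', ?_, hT, hle, hgt, hgt'⟩
    have hinj : Function.Injective fun e : PEdge ℕ => encPEdge e + 1 := fun a b hab =>
      encPEdge_injective (Nat.succ_injective hab)
    refine hinj.list_map ?_
    rw [he, he', hT]
    exact List.map_congr_left fun x hx' => hx x ((hm x).1 hx').1

end

/-! ### Satisfaction in terms of functions of time -/

section
variable {T : Type} [LinearOrder T] [Zero T]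

/-- The function `f` may be chosen by a quantifier at time `t` in the context of `d`. -/
def Ext (c : ℕ → T → ℕ) (t : T) (d : Option ℕ) (f : T → ℕ) : Prop :=
  (d = none ∧ t = 0) ∨
    ∃ d₀, d = some d₀ ∧ (∃ x, t ≤ x ∧ c d₀ x ≠ 0) ∧ ∀ x, x ≤ t → f x = c d₀ x

/-- Satisfaction over functions of time; `mem` interprets intervals, and `adm (encHF φ)` are the
functions over which quantifiers in front of `φ` range. -/
def GSat (mem : T → T → FIvl ℕ → Prop) (adm : ℕ → (T → ℕ) → Prop) :
    HF ℕ → (ℕ → T → ℕ) → T → Option ℕ → Prop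
  | .pos p π, c, t, _ => c π t ≠ 0 ∧ p ∈ evtC (c π t)
  | .neg p π, c, t, _ => c π t ≠ 0 ∧ p ∉ evtC (c π t)
  | .disj φ ψ, c, t, d => GSat mem adm φ c t d ∨ GSat mem adm ψ c t d
  | .conj φ ψ, c, t, d => GSat mem adm φ c t d ∧ GSat mem adm ψ c t d
  | .fut I φ, c, t, d => ∃ x, t < x ∧ mem t x I ∧ (∃ π, c π x ≠ 0) ∧ GSat mem adm φ c x d
  | .glob I φ, c, t, d => ∀ x, t < x → mem t x I → (∃ π, c π x ≠ 0) → GSat mem adm φ c x d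
  | .untl I φ ψ, c, t, d => ∃ x, t < x ∧ mem t x I ∧ (∃ π, c π x ≠ 0) ∧ GSat mem adm ψ c x d ∧
      ∀ y, t < y → y < x → (∃ π, c π y ≠ 0) → GSat mem adm φ c y d
  | .ex π φ, c, t, d => ∃ f, adm (encHF φ) f ∧ Ext c t d f ∧
      GSat mem adm φ (Function.update c π f) t (some π)
  | .all π φ, c, t, d => ∀ f, adm (encHF φ) f → Ext c t d f →
      GSat mem adm φ (Function.update c π f) t (some π)

end

/-- Interval membership for real times. -/
def memR (s x : ℝ) (I : FIvl ℕ) : Prop := FIvl.Mem natR s x I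

/-- Functions describing accepting runs with times in `[0, N)`. -/
def RunFn (C : Code) (N : ℕ) (f : ℝ → ℕ) : Prop := Supp N f ∧ Valid C HR f

theorem runFn_iff {B : PTA ℕ} {N : ℕ} {f : ℝ → ℕ} :
    RunFn (codeOf B) N f ↔ ∃ η : PRun ℕ, η.InSem natR B (some (N : ℝ)) ∧ fn η = f :=
  ⟨fun h => exists_run h.1 h.2, fun ⟨_, h, h'⟩ => h' ▸ ⟨supp_of_inSem h, valid_of_inSem h⟩⟩

/-- Functions over `ℝ` that a quantifier ranges over. -/
def admR (C : Code) (N : ℕ) (_ : ℕ) (f : ℝ → ℕ) : Prop := RunFn C N f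

theorem psat_iff (B : PTA ℕ) (N : ℕ) (φ : HF ℕ) (V : Finset ℕ) (Γ : ℕ → PRun ℕ) (t : ℝ)
    (d : Option ℕ) (hV : ∀ π ∈ V, (Γ π).InSem natR B (some (N : ℝ)))
    (hV' : ∀ π, π ∉ V → Γ π = default) (hd : ∀ d₀, d = some d₀ → d₀ ∈ V) :
    PSat natR B (some (N : ℝ)) φ V Γ t d ↔
      GSat memR (admR (codeOf B) N) φ (fun π => fn (Γ π)) t d := by
  induction φ generalizing V Γ t d with
  | pos p π =>
    have h : Inc (Γ π) := by
      by_cases h : π ∈ V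
      · exact inc_of_inSem (hV π h)
      · exact hV' π h ▸ inc_default
    exact h.exists_evt (fun p l => p ∈ l) p
  | neg p π =>
    have h : Inc (Γ π) := by
      by_cases h : π ∈ V
      · exact inc_of_inSem (hV π h)
      · exact hV' π h ▸ inc_default
    exact h.exists_evt (fun p l => p ∉ l) p
  | disj φ ψ hφ hψ => exact or_congr (hφ V Γ t d hV hV' hd) (hψ V Γ t d hV hV' hd)
  | conj φ ψ hφ hψ => exact and_congr (hφ V Γ t d hV hV' hd) (hψ V Γ t d hV hV' hd)
  | fut I φ hφ =>
    refine exists_congr fun x => and_congr_right fun _ => ?_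
    rw [hφ V Γ x d hV hV' hd, evt_iff hV hV']
    exact ⟨fun h => h.2, fun h => ⟨lt_of_evt hV hV' h.2.1, h⟩⟩
  | glob I φ hφ =>
    refine forall_congr' fun x => forall_congr' fun _ => ?_
    rw [hφ V Γ x d hV hV' hd, evt_iff hV hV']
    exact ⟨fun h h1 h2 => h (lt_of_evt hV hV' h2) h1 h2, fun h _ => h⟩
  | untl I φ ψ hφ hψ =>
    refine exists_congr fun x => and_congr_right fun _ => ?_
    rw [hψ V Γ x d hV hV' hd, evt_iff hV hV']
    have : (∀ y, t < y → y < x → (∃ π ∈ V, (Γ π).EvtTime y) →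
        PSat natR B (some (N : ℝ)) φ V Γ y d) ↔ ∀ y, t < y → y < x →
        (∃ π, fn (Γ π) y ≠ 0) → GSat memR (admR (codeOf B) N) φ (fun π => fn (Γ π)) y d :=
      forall_congr' fun y => forall_congr' fun _ => forall_congr' fun _ =>
        imp_congr (evt_iff hV hV') (hφ V Γ y d hV hV' hd)
    rw [this]
    exact ⟨fun h => h.2, fun h => ⟨lt_of_evt hV hV' h.2.1, h⟩⟩
  | ex π φ hφ =>
    constructor
    · rintro ⟨η, hη, he, h⟩
      refine ⟨fn η, runFn_iff.2 ⟨η, hη, rfl⟩, (ext_iff hV hd hη).1 he, ?_⟩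
      rw [update_fn]
      exact (hφ _ _ _ _ (mem_upd hV hη) (mem_upd' hV') (by simp)).1 h
    · rintro ⟨f, hf, he, h⟩
      obtain ⟨η, hη, rfl⟩ := runFn_iff.1 hf
      rw [update_fn] at h
      exact ⟨η, hη, (ext_iff hV hd hη).2 he,
        (hφ _ _ _ _ (mem_upd hV hη) (mem_upd' hV') (by simp)).2 h⟩
  | all π φ hφ =>
    constructor
    · rintro h f hf he
      obtain ⟨η, hη, rfl⟩ := runFn_iff.1 hf
      rw [update_fn]
      exact (hφ _ _ _ _ (mem_upd hV hη) (mem_upd' hV') (by simp)).1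
        (h η hη ((ext_iff hV hd hη).2 he))
    · rintro h η hη he
      have := h (fn η) (runFn_iff.2 ⟨η, hη, rfl⟩) ((ext_iff hV hd hη).1 he)
      rw [update_fn] at this
      exact (hφ _ _ _ _ (mem_upd hV hη) (mem_upd' hV') (by simp)).2 this
where
  evt_iff {V : Finset ℕ} {Γ : ℕ → PRun ℕ} (_ : ∀ π ∈ V, (Γ π).InSem natR B (some (N : ℝ)))
      (hV' : ∀ π, π ∉ V → Γ π = default) {x : ℝ} :
      (∃ π ∈ V, (Γ π).EvtTime x) ↔ ∃ π, fn (Γ π) x ≠ 0 := by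
    constructor
    · rintro ⟨π, -, h⟩
      exact ⟨π, fn_ne_zero.2 h⟩
    · rintro ⟨π, h⟩
      refine ⟨π, ?_, fn_ne_zero.1 h⟩
      by_contra hπ
      rw [hV' π hπ, fn_default] at h
      exact h rfl
  lt_of_evt {V : Finset ℕ} {Γ : ℕ → PRun ℕ} (hV : ∀ π ∈ V, (Γ π).InSem natR B (some (N : ℝ)))
      (hV' : ∀ π, π ∉ V → Γ π = default) {x : ℝ} (h : ∃ π, fn (Γ π) x ≠ 0) :
      inBd (some (N : ℝ)) x := by
    obtain ⟨π, h⟩ := h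
    by_cases hπ : π ∈ V
    · exact ((supp_of_inSem (hV π hπ)).1 x h).2
    · rw [hV' π hπ, fn_default] at h
      exact absurd rfl h
  update_fn {Γ : ℕ → PRun ℕ} {π : ℕ} {η : PRun ℕ} :
      Function.update (fun π => fn (Γ π)) π (fn η) = fun π' => fn (Function.update Γ π η π') := by
    funext π'
    by_cases h : π' = π
    · subst h; simp
    · simp [h]
  mem_upd {V : Finset ℕ} {Γ : ℕ → PRun ℕ} (hV : ∀ π ∈ V, (Γ π).InSem natR B (some (N : ℝ)))
      {π : ℕ} {η : PRun ℕ} (hη : η.InSem natR B (some (N : ℝ))) :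
      ∀ π' ∈ insert π V, (Function.update Γ π η π').InSem natR B (some (N : ℝ)) := by
    intro π' h
    by_cases h' : π' = π
    · subst h'; simpa using hη
    · simpa [h'] using hV π' (Finset.mem_of_mem_insert_of_ne h h')
  mem_upd' {V : Finset ℕ} {Γ : ℕ → PRun ℕ} (hV' : ∀ π, π ∉ V → Γ π = default)
      {π : ℕ} {η : PRun ℕ} : ∀ π', π' ∉ insert π V → Function.update Γ π η π' = default := by
    intro π' h
    rw [Finset.mem_insert, not_or] at h
    simpa [h.1] using hV' π' h.2
  ext_iff {V : Finset ℕ} {Γ : ℕ → PRun ℕ} {d : Option ℕ} {t : ℝ}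
      (hV : ∀ π ∈ V, (Γ π).InSem natR B (some (N : ℝ))) (hd : ∀ d₀, d = some d₀ → d₀ ∈ V)
      {η : PRun ℕ} (hη : η.InSem natR B (some (N : ℝ))) :
      ((d = none ∧ t = 0) ∨
        ∃ d₀, d = some d₀ ∧ t ≤ PRun.len (Γ d₀) ∧ PRun.ExtendsFrom η (Γ d₀) t) ↔
        Ext (fun π => fn (Γ π)) t d (fn η) := by
    refine or_congr Iff.rfl (exists_congr fun d₀ => and_congr_right fun h => ?_)
    have h0 := hV d₀ (hd d₀ h)
    exact and_congr ((inc_of_inSem h0).le_len h0.1.1.1)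
      ((inc_of_inSem h0).extendsFrom_iff (inc_of_inSem hη) t)

/-! ### Definability of satisfaction -/

namespace Def

variable {N b h h' : ℕ} {P Q : (ℕ → ℝ → ℕ) → (ℝ → ℕ) → (ℕ → ℝ) → Prop}

theorem and_max (hb : 16 ≤ b) (hP : Def N b h P) (hQ : Def N b h' Q) :
    Def N b (max h h' + 1) fun c a v => P c a v ∧ Q c a v :=
  (hP.mono (le_max_left _ _)).and hb (hQ.mono (le_max_right _ _))

theorem or_max (hb : 16 ≤ b) (hP : Def N b h P) (hQ : Def N b h' Q) :
    Def N b (max h h' + 1) fun c a v => P c a v ∨ Q c a v :=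
  (hP.mono (le_max_left _ _)).or hb (hQ.mono (le_max_right _ _))

theorem imp_max (hb : 16 ≤ b) (hP : Def N b h P) (hQ : Def N b h' Q) :
    Def N b (max h h' + 1) fun c a v => P c a v → Q c a v :=
  (hP.not.or_max hb hQ).congr fun _ _ _ _ => imp_iff_not_or

end Def

theorem Good.supp_tmp {N : ℕ} {c : ℕ → ℝ → ℕ} {a : ℝ → ℕ} {v : ℕ → ℝ} (h : Good N (cfg c a v)) :
    Supp N a :=
  ⟨fun x hx => h.1 .tmp x hx, h.2.subset fun _ hx => ⟨.tmp, hx⟩⟩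

theorem Good.supp_run {N : ℕ} {c : ℕ → ℝ → ℕ} {a : ℝ → ℕ} {v : ℕ → ℝ} (h : Good N (cfg c a v))
    (π : ℕ) : Supp N (c π) :=
  ⟨fun x hx => h.1 (.run π) x hx, h.2.subset fun _ hx => ⟨.run π, hx⟩⟩

theorem regInv_HR (n : ℕ) : RegInv fun s x => HR s x n := by
  by_cases h : ∃ g, encClkC g = n
  · obtain ⟨g, rfl⟩ := h
    exact (RegInv.holds g).congr fun s x => HR_enc s x g
  · exact (RegInv.const False).congr fun s x =>
      ⟨fun ⟨g, hg, _⟩ => h ⟨g, hg⟩, fun h => h.elim⟩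

section
variable {N b : ℕ}

theorem def_lastReset (hb : 16 ≤ b) (hN : 2 ^ N * 2 ≤ b) (z : ℕ) :
    Def N b 9 fun _ a v => LastReset a z (v 1) (v 2) := by
  have r (j : ℕ) : Def N b 0 fun _ a v => z ∈ rstC (a (v j)) :=
    Def.col_at hb j fun _ k => z ∈ rstC k
  have l (j j' : ℕ) : Def N b 2 fun _ _ v => v j < v j' := Def.rel (h := 0) hb hN j j' RegInv.lt
  have d1 := (Def.pt_zero (N := N) (h := 0) hb 2).and_max hb
    (((l 3 1).imp_max hb (r 3).not).all_pt hb 3)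
  have d2 := (l 2 1).and_max hb ((r 2).and_max hb
    (((l 2 3).imp_max hb ((l 3 1).imp_max hb (r 3).not)).all_pt hb 3))
  refine ((d1.or_max hb d2).mono (by decide)).congr fun c a v hc => ?_
  have hs := hc.supp_tmp
  have hr : ∀ y, z ∈ rstC (a y) → 0 ≤ y ∧ y < N := fun y hy => hs.1 y fun h0 => by
    simp [h0, rstC_zero] at hy
  simp only [Function.update_apply, Nat.reduceEqDiff, if_true, if_false, LastReset]
  refine or_congr (and_congr_right fun _ => ?_)
    (and_congr_right fun _ => and_congr_right fun _ => ?_)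
  · exact ⟨fun h y _ _ => h y, fun h y hy hz => h y (hr y hz).1 (hr y hz).2 hy hz⟩
  · exact ⟨fun h y _ _ => h y, fun h y hy hy' hz => h y (hr y hz).1 (hr y hz).2 hy hy' hz⟩

theorem def_valid (hb : 16 ≤ b) (hN : 2 ^ N * 2 ≤ b) {C : Code} (hC : C.trans.length ≤ b)
    (hG : ∀ e ∈ C.trans, (grdC (e + 1)).length ≤ b) :
    Def N b 30 fun _ a _ => Valid C HR a := by
  have k (j : ℕ) (R : ℕ → Prop) : Def N b 0 fun _ a v => R (a (v j)) :=
    Def.col_at hb j fun _ => R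
  have l (j j' : ℕ) : Def N b 2 fun _ _ v => v j < v j' := Def.rel (h := 0) hb hN j j' RegInv.lt
  have d1 := (k 1 fun i => i ≠ 0 → ∃ e ∈ C.trans, i = e + 1).all_pt hb 1
  have d2 := (k 1 fun i => i ≠ 0).ex_pt hb 1
  have d3 := ((((l 2 1).imp_max hb (k 2 fun i => i = 0)).all_pt hb 2).imp_max hb
    (k 1 fun i => i ≠ 0 → srcC i = C.start)).all_pt hb 1
  have d4 := (((l 1 2).imp_max hb
    ((((l 1 3).imp_max hb ((l 3 2).imp_max hb (k 3 fun i => i = 0))).all_pt hb 3).imp_max hb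
      (Def.forall_mem hb C.trans hC (R := fun e _ a v => a (v 1) = e + 1 → a (v 2) ≠ 0 →
        srcC (a (v 2)) = dstC (e + 1)) fun e _ =>
        (k 1 fun i => i = e + 1).imp_max hb
          (k 2 fun i => i ≠ 0 → srcC i = dstC (e + 1))))).all_pt hb 2).all_pt hb 1
  have d5 := ((((l 1 2).imp_max hb (k 2 fun i => i = 0)).all_pt hb 2).imp_max hb
    (k 1 fun i => i ≠ 0 → dstC i ∈ C.final)).all_pt hb 1
  have d6 := (Def.forall_mem hb C.trans hC (R := fun e _ a v => a (v 1) = e + 1 →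
    ∀ q ∈ grdC (e + 1), ∀ s : ℝ, 0 ≤ s → s < N →
      LastReset a q.unpair.1 (v 1) s → HR s (v 1) q.unpair.2) fun e he =>
    (k 1 fun i => i = e + 1).imp_max hb (Def.forall_mem hb _ (hG e he) (R := fun q _ a v =>
      ∀ s : ℝ, 0 ≤ s → s < N → LastReset a q.unpair.1 (v 1) s → HR s (v 1) q.unpair.2) fun q _ =>
      (((def_lastReset hb hN q.unpair.1).imp_max hb
        (Def.rel (h := 0) hb hN 2 1 (regInv_HR q.unpair.2))).all_pt hb 2))).all_pt hb 1
  refine ((d1.and_max hb (d2.and_max hb (d3.and_max hb (d4.and_max hb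
    (d5.and_max hb d6))))).mono (by decide)).congr fun c a v hc => ?_
  have hs := hc.supp_tmp.1
  simp only [Function.update_apply, Nat.reduceEqDiff, if_true, if_false]
  have hlr : ∀ {z x s}, a x ≠ 0 → LastReset a z x s → 0 ≤ s ∧ s < N := by
    rintro z x s hx (⟨rfl, -⟩ | ⟨hlt, hz, -⟩)
    · exact ⟨le_rfl, (hs x hx).1.trans_lt (hs x hx).2⟩
    · exact hs s fun h0 => by simp [h0, rstC_zero] at hz
  constructor
  · intro h
    refine ⟨fun x _ _ => h.mem x, ?_, fun x _ _ hlt hx => h.start x hx fun y hy => ?_,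
      fun x _ _ y _ _ hxy hz e _ he hy => ?_, fun x _ _ hlt hx => h.final x hx fun y hy => ?_,
      fun x _ _ e _ he q hq s _ _ => ?_⟩
    · obtain ⟨x, hx⟩ := h.nonempty
      exact ⟨x, (hs x hx).1, (hs x hx).2, hx⟩
    · by_contra h0
      exact h0 (hlt y (hs y h0).1 (hs y h0).2 hy)
    · rw [← he]
      refine h.step x y hxy (by omega) hy fun z h1 h2 => ?_
      by_contra h0
      exact h0 (hz z (hs z h0).1 (hs z h0).2 h1 h2)
    · by_contra h0
      exact h0 (hlt y (hs y h0).1 (hs y h0).2 hy)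
    · rw [← he] at hq
      exact h.guard x (by omega) q hq s
  · rintro ⟨h1, ⟨x₀, -, -, h2⟩, h3, h4, h5, h6⟩
    have hm : ∀ x, a x ≠ 0 → ∃ e ∈ C.trans, a x = e + 1 := fun x hx =>
      h1 x (hs x hx).1 (hs x hx).2 hx
    refine ⟨hm, ⟨x₀, h2⟩, fun x hx hlt => h3 x (hs x hx).1 (hs x hx).2 (fun y _ _ => hlt y) hx,
      fun x y hxy hx hy hz => ?_,
      fun x hx hlt => h5 x (hs x hx).1 (hs x hx).2 (fun y _ _ => hlt y) hx, fun x hx q hq s hls => ?_⟩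
    · obtain ⟨e, he, hxe⟩ := hm x hx
      rw [hxe]
      exact h4 x (hs x hx).1 (hs x hx).2 y (hs y hy).1 (hs y hy).2 hxy (fun z _ _ => hz z) e he hxe hy
    · obtain ⟨e, he, hxe⟩ := hm x hx
      rw [hxe] at hq
      exact h6 x (hs x hx).1 (hs x hx).2 e he hxe q hq s (hlr hx hls).1 (hlr hx hls).2 hls

theorem def_ext (hb : 16 ≤ b) (hN : 2 ^ N * 2 ≤ b) (d : Option ℕ) :
    Def N b 7 fun c a v => Ext c (v 0) d a := by
  cases d with
  | none =>
    refine ((Def.pt_zero (h := 0) hb 0).mono (by decide)).congr fun c a v _ => ?_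
    simp [Ext]
  | some d₀ =>
    have l (j j' : ℕ) : Def N b 2 fun _ _ v => v j < v j' := Def.rel (h := 0) hb hN j j' RegInv.lt
    have d1 := ((l 1 0).not.and_max hb
      (Def.col_at (h := 0) hb 1 fun c _ => c d₀ ≠ 0)).ex_pt hb 1
    have d2 := ((l 0 1).not.imp_max hb
      (Def.col_at (h := 0) hb 1 fun c a => a = c d₀)).all_pt hb 1
    refine ((d1.and_max hb d2).mono (by decide)).congr fun c a v hc => ?_
    have hs := (hc.supp_run d₀).1
    have hs' := hc.supp_tmp.1
    simp only [Function.update_apply, if_true, if_false, zero_ne_one, not_lt]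
    have e : Ext c (v 0) (some d₀) a ↔
        (∃ x, v 0 ≤ x ∧ c d₀ x ≠ 0) ∧ ∀ x, x ≤ v 0 → a x = c d₀ x := by
      simp [Ext]
    rw [e]
    refine and_congr ⟨?_, ?_⟩ ⟨fun h x _ _ => h x, fun h x hx => ?_⟩
    · rintro ⟨x, h1, h2⟩
      exact ⟨x, (hs x h2).1, (hs x h2).2, h1, h2⟩
    · rintro ⟨x, -, -, h1, h2⟩
      exact ⟨x, h1, h2⟩
    · by_cases h1 : a x = 0
      · by_cases h2 : c d₀ x = 0
        · rw [h1, h2]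
        · exact h x (hs x h2).1 (hs x h2).2 hx
      · exact h x (hs' x h1).1 (hs' x h1).2 hx

/-- The condition under an existential quantifier in front of a definable formula. -/
theorem def_quant (hb : 16 ≤ b) (hN : 2 ^ N * 2 ≤ b) {C : Code} (hC : C.trans.length ≤ b)
    (hG : ∀ e ∈ C.trans, (grdC (e + 1)).length ≤ b) {h : ℕ} {F : (ℕ → ℝ → ℕ) → ℝ → Prop}
    (hF : Def N b h fun c _ v => F c (v 0)) (d : Option ℕ) (π : ℕ) :
    Def N b (h + 32) fun c a v => Valid C HR a ∧ Ext c (v 0) d a ∧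
      F (Function.update c π a) (v 0) :=
  ((def_valid hb hN hC hG).and_max hb ((def_ext hb hN d).and_max hb (hF.move_tmp π))).mono
    (by omega)

theorem def_evt (hb : 16 ≤ b) (j : ℕ) : Def N b 0 fun c _ v => ∃ π, c π (v j) ≠ 0 :=
  Def.col_at hb j fun c _ => ∃ π, c π ≠ 0

theorem encHF_pos_sub {k x y : ℕ} (hk : 0 < k) : x < Nat.pair k (Nat.pair y x) ∧
    y < Nat.pair k (Nat.pair y x) := by
  have h1 := Nat.add_le_pair k (Nat.pair y x)
  have h2 := Nat.left_le_pair y x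
  have h3 := Nat.right_le_pair y x
  omega

theorem def_gsat (hb : 16 ≤ b) (hN : 2 ^ N * 2 ≤ b) {C : Code} (hC : C.trans.length ≤ b)
    (hG : ∀ e ∈ C.trans, (grdC (e + 1)).length ≤ b) (φ : HF ℕ) (d : Option ℕ) :
    Def N b (40 * encHF φ + 40) fun c _ v => GSat memR (admR C N) φ c (v 0) d := by
  have l (j j' : ℕ) : Def N b 2 fun _ _ v => v j < v j' := Def.rel (h := 0) hb hN j j' RegInv.lt
  have m (I : FIvl ℕ) : Def N b 2 fun _ _ v => memR (v 0) (v 1) I :=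
    Def.rel (h := 0) hb hN 0 1 (RegInv.mem I)
  have hex : ∀ {h : ℕ} {F : (ℕ → ℝ → ℕ) → ℝ → Prop} (_ : Def N b h fun c _ v => F c (v 0))
      (d : Option ℕ) (π : ℕ), Def N b (h + 33) fun c _ v => ∃ f, RunFn C N f ∧ Ext c (v 0) d f ∧
        F (Function.update c π f) (v 0) := by
    intro h F hF d π
    refine ((def_quant hb hN hC hG hF d π).ex_tmp).congr fun c a v _ => ?_
    exact exists_congr fun f => and_assoc
  induction φ generalizing d with
  | pos p π =>
    exact Def.col_at hb 0 fun c _ => c π ≠ 0 ∧ p ∈ evtC (c π)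
  | neg p π =>
    exact Def.col_at hb 0 fun c _ => c π ≠ 0 ∧ p ∉ evtC (c π)
  | disj φ ψ hφ hψ =>
    have := encHF_pos_sub (k := 2) (x := encHF ψ) (y := encHF φ) (by omega)
    exact ((hφ d).or_max hb (hψ d)).mono (by rw [encHF]; omega)
  | conj φ ψ hφ hψ =>
    have := encHF_pos_sub (k := 3) (x := encHF ψ) (y := encHF φ) (by omega)
    exact ((hφ d).and_max hb (hψ d)).mono (by rw [encHF]; omega)
  | fut I φ hφ =>
    have := encHF_pos_sub (k := 4) (x := encHF φ) (y := encFIvl I) (by omega)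
    refine ((((l 0 1).and_max hb ((m I).and_max hb ((def_evt hb 1).and_max hb
      ((hφ d).move_pt fun _ => 1)))).ex_pt hb 1).mono (by rw [encHF]; omega)).congr
      fun c a v hc => ?_
    simp only [Function.update_apply, if_true, if_false, zero_ne_one, GSat]
    refine exists_congr fun x => ⟨fun h => ?_, fun h => h.2.2⟩
    obtain ⟨π, hπ⟩ := h.2.2.1
    exact ⟨((hc.supp_run π).1 x hπ).1, ((hc.supp_run π).1 x hπ).2, h⟩
  | glob I φ hφ =>
    have := encHF_pos_sub (k := 5) (x := encHF φ) (y := encFIvl I) (by omega)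
    refine ((((l 0 1).imp_max hb ((m I).imp_max hb ((def_evt hb 1).imp_max hb
      ((hφ d).move_pt fun _ => 1)))).all_pt hb 1).mono (by rw [encHF]; omega)).congr
      fun c a v hc => ?_
    simp only [Function.update_apply, if_true, if_false, zero_ne_one, GSat]
    refine forall_congr' fun x => ⟨fun h _ _ => h, fun h h1 h2 h3 => ?_⟩
    obtain ⟨π, hπ⟩ := h3
    exact h ((hc.supp_run π).1 x hπ).1 ((hc.supp_run π).1 x hπ).2 h1 h2 ⟨π, hπ⟩
  | untl I φ ψ hφ hψ =>
    have h1 := encHF_pos_sub (k := 6) (x := Nat.pair (encHF φ) (encHF ψ)) (y := encFIvl I)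
      (by omega)
    have h2 := Nat.left_le_pair (encHF φ) (encHF ψ)
    have h3 := Nat.right_le_pair (encHF φ) (encHF ψ)
    have d1 := ((l 0 2).imp_max hb ((l 2 1).imp_max hb ((def_evt hb 2).imp_max hb
      ((hφ d).move_pt fun _ => 2)))).all_pt hb 2
    refine ((((l 0 1).and_max hb ((m I).and_max hb ((def_evt hb 1).and_max hb
      (((hψ d).move_pt fun _ => 1).and_max hb d1)))).ex_pt hb 1).mono
      (by rw [encHF]; omega)).congr fun c a v hc => ?_
    simp only [Function.update_apply, if_true, if_false, zero_ne_one, GSat, Nat.reduceEqDiff,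
      OfNat.zero_ne_ofNat]
    refine exists_congr fun x => ⟨fun h => ?_, fun h => ?_⟩
    · obtain ⟨π, hπ⟩ := h.2.2.1
      exact ⟨((hc.supp_run π).1 x hπ).1, ((hc.supp_run π).1 x hπ).2, h.1, h.2.1, h.2.2.1,
        h.2.2.2.1, fun y _ _ => h.2.2.2.2 y⟩
    · refine ⟨h.2.2.1, h.2.2.2.1, h.2.2.2.2.1, h.2.2.2.2.2.1, fun y hy hy' he => ?_⟩
      obtain ⟨π, hπ⟩ := he
      exact h.2.2.2.2.2.2 y ((hc.supp_run π).1 y hπ).1 ((hc.supp_run π).1 y hπ).2 hy hy' ⟨π, hπ⟩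
  | ex π φ hφ =>
    have := encHF_pos_sub (k := 7) (x := encHF φ) (y := π) (by omega)
    exact (hex (F := fun c t => GSat memR (admR C N) φ c t (some π)) (hφ (some π)) d π).mono
      (by rw [encHF]; omega)
  | all π φ hφ =>
    have := encHF_pos_sub (k := 8) (x := encHF φ) (y := π) (by omega)
    refine ((hex (F := fun c t => ¬ GSat memR (admR C N) φ c t (some π))
      (hφ (some π)).not d π).not.mono (by rw [encHF]; omega)).congr fun c a v _ => ?_
    simp only [GSat, admR]
    push Not
    rfl

end

/-! ### Discretization of time -/

/-- Extension of a function on the grid of mesh `1 / U` by zero. -/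
noncomputable def gr (U : ℕ) (f : ℕ → ℕ) (x : ℝ) : ℕ :=
  if x = (⌊x * U⌋₊ : ℝ) / U then f ⌊x * U⌋₊ else 0

/-- Truth of coded clock constraints, times being measured in units of `1 / U`. -/
def HN (U : ℕ) (s x n : ℕ) : Prop := HR ((s : ℝ) / U) ((x : ℝ) / U) n

/-- Interval membership, times being measured in units of `1 / U`. -/
def memN (U : ℕ) (s x : ℕ) (I : FIvl ℕ) : Prop := memR ((s : ℝ) / U) ((x : ℝ) / U) I

/-- Functions of discrete time that a quantifier ranges over. -/
def admN (C : Code) (N U L m : ℕ) (f : ℕ → ℕ) : Prop :=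
  (∀ τ, f τ ≠ 0 → τ < N * U ∧ L ^ m ∣ τ) ∧ Valid C (HN U) f

section
variable {U : ℕ} (hU : 0 < U)
include hU

theorem gr_div (f : ℕ → ℕ) (τ : ℕ) : gr U f ((τ : ℝ) / U) = f τ := by
  have hU' : (U : ℝ) ≠ 0 := by positivity
  have h : ((τ : ℝ) / U) * U = τ := by field_simp
  simp [gr, h]

theorem gr_comp {a : ℝ → ℕ} (ha : ∀ x, a x ≠ 0 → ∃ τ : ℕ, x = (τ : ℝ) / U) :
    gr U (fun τ => a ((τ : ℝ) / U)) = a := by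
  funext x
  by_cases hx : ∃ τ : ℕ, x = (τ : ℝ) / U
  · obtain ⟨τ, rfl⟩ := hx
    exact gr_div hU _ τ
  · have h0 : a x = 0 := by_contra fun h => hx (ha x h)
    rw [gr, if_neg fun h => hx ⟨_, h⟩, h0]

theorem div_lt_div_iff' {σ τ : ℕ} : (σ : ℝ) / U < (τ : ℝ) / U ↔ σ < τ := by
  rw [div_lt_div_iff_of_pos_right (by positivity), Nat.cast_lt]

theorem div_le_div_iff' {σ τ : ℕ} : (σ : ℝ) / U ≤ (τ : ℝ) / U ↔ σ ≤ τ := by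
  rw [div_le_div_iff_of_pos_right (by positivity), Nat.cast_le]

end

theorem gr_ne {U : ℕ} {f : ℕ → ℕ} {x : ℝ} (h : gr U f x ≠ 0) :
    ∃ τ : ℕ, x = (τ : ℝ) / U ∧ f τ ≠ 0 := by
  rw [gr] at h
  split_ifs at h with hx
  · exact ⟨_, hx, h⟩
  · exact absurd rfl h

section
variable {U : ℕ} (hU : 0 < U)
include hU

theorem forall_gr {f : ℕ → ℕ} {P : ℝ → Prop} :
    (∀ x, gr U f x ≠ 0 → P x) ↔ ∀ τ, f τ ≠ 0 → P ((τ : ℝ) / U) :=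
  ⟨fun h τ hτ => h _ (by rwa [gr_div hU]), fun h x hx => by
    obtain ⟨τ, rfl, hτ⟩ := gr_ne hx
    exact h τ hτ⟩

theorem forall_gr_eq {f : ℕ → ℕ} {P : ℝ → Prop} :
    (∀ x, P x → gr U f x = 0) ↔ ∀ τ : ℕ, P ((τ : ℝ) / U) → f τ = 0 :=
  ⟨fun h τ hτ => by rw [← gr_div hU f]; exact h _ hτ, fun h x hx => by
    by_contra h0
    obtain ⟨τ, rfl, hτ⟩ := gr_ne h0
    exact hτ (h τ hx)⟩

theorem forall_gr_rst {f : ℕ → ℕ} {P : ℝ → Prop} {z : ℕ} :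
    (∀ x, P x → z ∉ rstC (gr U f x)) ↔ ∀ τ : ℕ, P ((τ : ℝ) / U) → z ∉ rstC (f τ) :=
  ⟨fun h τ hτ => by rw [← gr_div hU f]; exact h _ hτ, fun h x hx hz => by
    obtain ⟨τ, rfl, hτ⟩ := gr_ne (U := U) (f := f) (x := x) fun h0 => by simp [h0, rstC_zero] at hz
    rw [gr_div hU] at hz
    exact h τ hx hz⟩

theorem lastReset_gr {f : ℕ → ℕ} {z x s : ℕ} :
    LastReset (gr U f) z ((x : ℝ) / U) ((s : ℝ) / U) ↔ LastReset f z x s := by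
  have hU' : (U : ℝ) ≠ 0 := by positivity
  have h1 := forall_gr_rst hU (f := f) (P := fun y => y < (x : ℝ) / U) (z := z)
  have h2 := forall_gr_rst hU (f := f) (P := fun y => (s : ℝ) / U < y ∧ y < (x : ℝ) / U) (z := z)
  simp only [and_imp] at h2
  simp only [LastReset, h1, h2, div_lt_div_iff' hU, gr_div hU, div_eq_zero_iff, hU', or_false,
    Nat.cast_eq_zero]

omit hU in
theorem LastReset.exists_div {f : ℕ → ℕ} {z : ℕ} {x s : ℝ} (h : LastReset (gr U f) z x s) :
    ∃ σ : ℕ, s = (σ : ℝ) / U := by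
  rcases h with ⟨rfl, -⟩ | ⟨-, hz, -⟩
  · exact ⟨0, by simp⟩
  · obtain ⟨τ, h, -⟩ := gr_ne (U := U) (f := f) (x := s) fun h0 => by simp [h0, rstC_zero] at hz
    exact ⟨τ, h⟩

theorem valid_gr {C : Code} {f : ℕ → ℕ} : Valid C HR (gr U f) ↔ Valid C (HN U) f := by
  constructor
  · intro h
    refine ⟨fun x hx => ?_, ?_, fun x hx hy => ?_, fun x y hxy hx hy hz => ?_, fun x hx hy => ?_,
      fun x hx q hq s hs => ?_⟩
    · simpa only [gr_div hU] using h.mem ((x : ℝ) / U) (by rwa [gr_div hU])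
    · obtain ⟨x, hx⟩ := h.nonempty
      obtain ⟨τ, -, hτ⟩ := gr_ne hx
      exact ⟨τ, hτ⟩
    · simpa only [gr_div hU] using h.start ((x : ℝ) / U) (by rwa [gr_div hU])
        ((forall_gr_eq hU).2 fun τ hτ => hy τ ((div_lt_div_iff' hU).1 hτ))
    · have := h.step ((x : ℝ) / U) ((y : ℝ) / U) ((div_lt_div_iff' hU).2 hxy) (by rwa [gr_div hU])
        (by rwa [gr_div hU]) fun z h1 h2 => (forall_gr_eq hU (P := fun z => _ < z ∧ z < _)).2
          (fun τ hτ => hz τ ((div_lt_div_iff' hU).1 hτ.1) ((div_lt_div_iff' hU).1 hτ.2)) z ⟨h1, h2⟩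
      simpa only [gr_div hU] using this
    · simpa only [gr_div hU] using h.final ((x : ℝ) / U) (by rwa [gr_div hU])
        ((forall_gr_eq hU).2 fun τ hτ => hy τ ((div_lt_div_iff' hU).1 hτ))
    · exact h.guard ((x : ℝ) / U) (by rwa [gr_div hU]) q (by rwa [gr_div hU]) ((s : ℝ) / U)
        ((lastReset_gr hU).2 hs)
  · intro h
    refine ⟨(forall_gr hU).2 fun x hx => ?_, ?_, (forall_gr hU).2 fun x hx hy => ?_,
      fun x y hxy hx hy hz => ?_, (forall_gr hU).2 fun x hx hy => ?_,
      (forall_gr hU).2 fun x hx q hq s hs => ?_⟩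
    · simpa only [gr_div hU] using h.mem x hx
    · obtain ⟨x, hx⟩ := h.nonempty
      exact ⟨(x : ℝ) / U, by rwa [gr_div hU]⟩
    · simpa only [gr_div hU] using h.start x hx fun y hyx =>
        (forall_gr_eq hU).1 hy y ((div_lt_div_iff' hU).2 hyx)
    · obtain ⟨σ, rfl, hσ⟩ := gr_ne hx
      obtain ⟨τ, rfl, hτ⟩ := gr_ne hy
      simpa only [gr_div hU] using h.step σ τ ((div_lt_div_iff' hU).1 hxy) hσ hτ fun z h1 h2 => by
        simpa only [gr_div hU] using
          hz ((z : ℝ) / U) ((div_lt_div_iff' hU).2 h1) ((div_lt_div_iff' hU).2 h2)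
    · simpa only [gr_div hU] using h.final x hx fun y hyx =>
        (forall_gr_eq hU).1 hy y ((div_lt_div_iff' hU).2 hyx)
    · rw [gr_div hU] at hq
      obtain ⟨σ, rfl⟩ := hs.exists_div
      exact h.guard x hx q hq σ ((lastReset_gr hU).1 hs)

theorem ext_gr {c : ℕ → ℕ → ℕ} {τ : ℕ} {d : Option ℕ} {f : ℕ → ℕ} :
    Ext (fun π => gr U (c π)) ((τ : ℝ) / U) d (gr U f) ↔ Ext c τ d f := by
  have hU' : (U : ℝ) ≠ 0 := by positivity
  have h1 : ∀ d₀, (∃ x, (τ : ℝ) / U ≤ x ∧ gr U (c d₀) x ≠ 0) ↔ ∃ x, τ ≤ x ∧ c d₀ x ≠ 0 := by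
    refine fun d₀ => ⟨fun ⟨x, hx, h0⟩ => ?_, fun ⟨x, hx, h0⟩ =>
      ⟨(x : ℝ) / U, (div_le_div_iff' hU).2 hx, by rwa [gr_div hU]⟩⟩
    obtain ⟨σ, rfl, hσ⟩ := gr_ne h0
    exact ⟨σ, (div_le_div_iff' hU).1 hx, hσ⟩
  have h2 : ∀ d₀, (∀ x, x ≤ (τ : ℝ) / U → gr U f x = gr U (c d₀) x) ↔
      ∀ x, x ≤ τ → f x = c d₀ x := by
    refine fun d₀ => ⟨fun h x hx => ?_, fun h x hx => ?_⟩
    · simpa only [gr_div hU] using h ((x : ℝ) / U) ((div_le_div_iff' hU).2 hx)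
    · by_cases hg : ∃ σ : ℕ, x = (σ : ℝ) / U
      · obtain ⟨σ, rfl⟩ := hg
        rw [gr_div hU, gr_div hU]
        exact h σ ((div_le_div_iff' hU).1 hx)
      · have : ∀ g, gr U g x = 0 := fun g => by
          by_contra h0
          obtain ⟨σ, h, -⟩ := gr_ne h0
          exact hg ⟨σ, h⟩
        rw [this, this]
  simp only [Ext, h1, h2, div_eq_zero_iff, hU', or_false, Nat.cast_eq_zero]

theorem supp_gr {N : ℕ} {f : ℕ → ℕ} (hf : ∀ τ, f τ ≠ 0 → τ < N * U) : Supp N (gr U f) := by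
  refine ⟨(forall_gr hU).2 fun τ hτ => ⟨by positivity, ?_⟩, ?_⟩
  · rw [div_lt_iff₀ (by positivity)]
    exact_mod_cast hf τ hτ
  · refine ((Set.finite_Iio (N * U)).image fun τ : ℕ => (τ : ℝ) / U).subset fun x hx => ?_
    obtain ⟨τ, rfl, hτ⟩ := gr_ne hx
    exact ⟨τ, hf τ hτ, rfl⟩

theorem runFn_gr {C : Code} {N : ℕ} {f : ℕ → ℕ} (hf : ∀ τ, f τ ≠ 0 → τ < N * U) :
    RunFn C N (gr U f) ↔ Valid C (HN U) f :=
  ⟨fun h => (valid_gr hU).1 h.2, fun h => ⟨supp_gr hU hf, (valid_gr hU).2 h⟩⟩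

omit hU in
theorem update_gr (c : ℕ → ℕ → ℕ) (π : ℕ) (f : ℕ → ℕ) :
    Function.update (fun π => gr U (c π)) π (gr U f) =
      fun π' => gr U (Function.update c π f π') := by
  funext π'
  by_cases h : π' = π
  · subst h; simp
  · simp [h]

end

/-- The events of `c` happen at multiples of `l` below `n`. -/
def OnGrid (n l : ℕ) (c : ℕ → ℕ → ℕ) : Prop := ∀ π τ, c π τ ≠ 0 → τ < n ∧ l ∣ τ

theorem OnGrid.mono {n l l' : ℕ} {c : ℕ → ℕ → ℕ} (h : OnGrid n l c) (hl : l' ∣ l) : OnGrid n l' c :=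
  fun π τ hτ => ⟨(h π τ hτ).1, hl.trans (h π τ hτ).2⟩

theorem OnGrid.update {n l : ℕ} {c : ℕ → ℕ → ℕ} (h : OnGrid n l c) {f : ℕ → ℕ}
    (hf : ∀ τ, f τ ≠ 0 → τ < n ∧ l ∣ τ) (π : ℕ) : OnGrid n l (Function.update c π f) := by
  intro π' τ hτ
  by_cases hπ : π' = π
  · subst hπ
    exact hf τ (by simpa using hτ)
  · exact h π' τ (by simpa [hπ] using hτ)

theorem good_gr {N U : ℕ} (hU : 0 < U) {l : ℕ} {c : ℕ → ℕ → ℕ} (hc : OnGrid (N * U) l c) {τ : ℕ}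
    (hτ : τ < N * U) :
    Good N (cfg (fun π => gr U (c π)) 0 fun _ => (τ : ℝ) / U) := by
  have hτ' : 0 ≤ (τ : ℝ) / U ∧ (τ : ℝ) / U < N := by
    refine ⟨by positivity, ?_⟩
    rw [div_lt_iff₀ (by positivity)]
    exact_mod_cast hτ
  refine ⟨fun k x hx => ?_, ?_⟩
  · cases k with
    | run π => exact (supp_gr hU fun σ hσ => (hc π σ hσ).1).1 x hx
    | tmp => exact absurd rfl hx
    | pt j => exact (supp_ind hτ'.1 hτ'.2).1 x hx
  · refine ((Set.finite_Iio (N * U)).image fun τ : ℕ => (τ : ℝ) / U).subset fun x hx => ?_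
    obtain ⟨k, hk⟩ := hx
    cases k with
    | run π =>
      obtain ⟨σ, rfl, hσ⟩ := gr_ne hk
      exact ⟨σ, (hc π σ hσ).1, rfl⟩
    | tmp => exact absurd rfl hk
    | pt j =>
      refine ⟨τ, hτ, ?_⟩
      by_contra h
      simp only [cfg, ind, ne_eq, ite_eq_right_iff, one_ne_zero, imp_false, not_not] at hk
      exact h hk.symm

section
variable {N b : ℕ} (hb : 16 ≤ b) (hN : 2 ^ N * 2 ≤ b) {C : Code} (hC : C.trans.length ≤ b)
  (hG : ∀ e ∈ C.trans, (grdC (e + 1)).length ≤ b)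
include hb hN hC hG

theorem exists_gr_iff {h L K m n τ : ℕ} (hL : tw b (h + 32) ≤ L) (hmn : m < n) (hnK : n ≤ K)
    {F : (ℕ → ℝ → ℕ) → ℝ → Prop} {F' : (ℕ → ℕ → ℕ) → Prop}
    (hF : Def N b h fun c _ v => F c (v 0)) {c : ℕ → ℕ → ℕ} (hc : OnGrid (N * L ^ K) (L ^ n) c)
    (hτ : τ < N * L ^ K) (hτ' : L ^ n ∣ τ) (d : Option ℕ) (π : ℕ)
    (hFF : ∀ c', OnGrid (N * L ^ K) (L ^ m) c' →
      (F (fun π => gr (L ^ K) (c' π)) ((τ : ℝ) / (L ^ K : ℕ)) ↔ F' c')) :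
    (∃ a, RunFn C N a ∧ Ext (fun π => gr (L ^ K) (c π)) ((τ : ℝ) / (L ^ K : ℕ)) d a ∧
      F (Function.update (fun π => gr (L ^ K) (c π)) π a) ((τ : ℝ) / (L ^ K : ℕ))) ↔
    ∃ f, admN C N (L ^ K) L m f ∧ Ext c τ d f ∧ F' (Function.update c π f) := by
  have hL0 : 0 < L := by have := le_tw b (h + 32); omega
  have hU : 0 < L ^ K := Nat.pow_pos hL0
  have hcm : OnGrid (N * L ^ K) (L ^ m) c := hc.mono (pow_dvd_pow L hmn.le)
  have hgood := good_gr hU hc hτ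
  constructor
  · rintro ⟨a, hrun, hext, hFa⟩
    obtain ⟨P', ⟨σ, inst, A, hσ, hA⟩, hP'⟩ := def_quant hb hN hC hG hF d π
    have hiff : ∀ a, Supp N a → ((Valid C HR a ∧
        Ext (fun π => gr (L ^ K) (c π)) ((τ : ℝ) / (L ^ K : ℕ)) d a ∧
        F (Function.update (fun π => gr (L ^ K) (c π)) π a) ((τ : ℝ) / (L ^ K : ℕ))) ↔
        A.Acc (Function.update (cfg (fun π => gr (L ^ K) (c π)) 0
          fun _ => (τ : ℝ) / (L ^ K : ℕ)) .tmp a)) := by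
      intro a ha
      have hg := Aut.good_update hgood .tmp ha.1 ha.2
      rw [← hA _ hg]
      rw [update_tmp] at hg ⊢
      exact hP' _ a _ hg
    have hpow : L ^ K = L ^ (K - n) * L * L ^ (n - 1) := by
      rw [mul_assoc, ← pow_succ', ← pow_add]
      congr 1
      omega
    have hgrid : ∀ k x, cfg (fun π => gr (L ^ K) (c π)) 0 (fun _ => (τ : ℝ) / (L ^ K : ℕ)) k x ≠ 0 →
        ∃ j : ℕ, x = (j : ℝ) / (L ^ (K - n) : ℕ) := by
      have hdiv : ∀ σ, L ^ n ∣ σ → ∃ j : ℕ, (σ : ℝ) / (L ^ K : ℕ) = (j : ℝ) / (L ^ (K - n) : ℕ) := by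
        rintro _ ⟨j, rfl⟩
        refine ⟨j, ?_⟩
        rw [show L ^ K = L ^ n * L ^ (K - n) by rw [← pow_add]; congr 1; omega]
        push_cast
        rw [mul_div_mul_left _ _ (by positivity)]
      intro k x hx
      cases k with
      | run π =>
        obtain ⟨σ, rfl, hσ⟩ := gr_ne hx
        exact hdiv σ (hc π σ hσ).2
      | tmp => exact absurd rfl hx
      | pt j =>
        obtain rfl : x = (τ : ℝ) / (L ^ K : ℕ) := by
          by_contra h
          exact hx (if_neg h)
        exact hdiv τ hτ'
    obtain ⟨a', h1, h2, h3, h4⟩ := A.exists_grid (M := L ^ (K - n)) (Nat.pow_pos hL0)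
      (hσ.trans hL) hgood hgrid hrun.1.1 hrun.1.2 ((hiff a hrun.1).1 ⟨hrun.2, hext, hFa⟩)
    have h3' : ∀ x, a' x ≠ 0 → ∃ j : ℕ, x = ((j * L ^ (n - 1) : ℕ) : ℝ) / (L ^ K : ℕ) := by
      intro x hx
      obtain ⟨j, rfl⟩ := h3 x hx
      refine ⟨j, ?_⟩
      rw [hpow, Nat.cast_mul j, Nat.cast_mul (L ^ (K - n) * L) (L ^ (n - 1))]
      exact (mul_div_mul_right _ _ (by positivity)).symm
    obtain ⟨f, hf, rfl⟩ : ∃ f : ℕ → ℕ, (∀ σ, f σ ≠ 0 → σ < N * L ^ K ∧ L ^ m ∣ σ) ∧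
        gr (L ^ K) f = a' := by
      refine ⟨fun σ => a' ((σ : ℝ) / (L ^ K : ℕ)), fun σ hσ => ⟨?_, ?_⟩,
        gr_comp hU fun x hx => ⟨_, (h3' x hx).choose_spec⟩⟩
      · have := (h1 _ hσ).2
        rw [div_lt_iff₀ (by positivity)] at this
        exact_mod_cast this
      · obtain ⟨j, hj⟩ := h3' _ hσ
        rw [div_left_inj' (by positivity), Nat.cast_inj] at hj
        rw [hj]
        exact (pow_dvd_pow L (by omega)).mul_left j
    obtain ⟨hV, hext', hFa'⟩ := (hiff _ ⟨h1, h2⟩).2 h4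
    refine ⟨f, ⟨hf, (valid_gr hU).1 hV⟩, (ext_gr hU).1 hext', ?_⟩
    rw [update_gr, hFF _ (hcm.update hf π)] at hFa'
    exact hFa'
  · rintro ⟨f, ⟨hf, hV⟩, hext, hF'⟩
    refine ⟨gr (L ^ K) f, (runFn_gr hU fun τ hτ => (hf τ hτ).1).2 hV, (ext_gr hU).2 hext, ?_⟩
    rw [update_gr, hFF _ (hcm.update hf π)]
    exact hF'

/-- Satisfaction over real times reduces to satisfaction over discrete times. -/
theorem gsat_gr {L K n : ℕ} (φ : HF ℕ) (hL : tw b (40 * K + 72) ≤ L) (hn : encHF φ ≤ n)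
    (hnK : n ≤ K) {c : ℕ → ℕ → ℕ} (hc : OnGrid (N * L ^ K) (L ^ n) c) {τ : ℕ}
    (hτ : τ < N * L ^ K) (hτ' : L ^ n ∣ τ) (d : Option ℕ) :
    GSat memR (admR C N) φ (fun π => gr (L ^ K) (c π)) ((τ : ℝ) / (L ^ K : ℕ)) d ↔
      GSat (memN (L ^ K)) (admN C N (L ^ K) L) φ c τ d := by
  have hL0 : 0 < L := by have := le_tw b (40 * K + 72); omega
  have hU : 0 < L ^ K := Nat.pow_pos hL0
  have hex : ∀ {c : ℕ → ℕ → ℕ} {x : ℝ}, (∃ π, gr (L ^ K) (c π) x ≠ 0) →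
      ∃ σ : ℕ, x = (σ : ℝ) / (L ^ K : ℕ) ∧ ∃ π, c π σ ≠ 0 := fun ⟨π, h⟩ =>
    let ⟨σ, h1, h2⟩ := gr_ne h
    ⟨σ, h1, π, h2⟩
  induction φ generalizing n c τ d with
  | pos p π => simp only [GSat, gr_div hU]
  | neg p π => simp only [GSat, gr_div hU]
  | disj φ ψ hφ hψ =>
    have := encHF_pos_sub (k := 2) (x := encHF ψ) (y := encHF φ) (by omega)
    rw [encHF] at hn
    exact or_congr (hφ (by omega) hnK hc hτ hτ' d) (hψ (by omega) hnK hc hτ hτ' d)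
  | conj φ ψ hφ hψ =>
    have := encHF_pos_sub (k := 3) (x := encHF ψ) (y := encHF φ) (by omega)
    rw [encHF] at hn
    exact and_congr (hφ (by omega) hnK hc hτ hτ' d) (hψ (by omega) hnK hc hτ hτ' d)
  | fut I φ hφ =>
    have := encHF_pos_sub (k := 4) (x := encHF φ) (y := encFIvl I) (by omega)
    rw [encHF] at hn
    have ih : ∀ {σ}, (∃ π, c π σ ≠ 0) → _ := fun {σ} ⟨π, h⟩ =>
      hφ (by omega) hnK hc (hc π σ h).1 (hc π σ h).2 d
    constructor
    · rintro ⟨x, h1, h2, h3, h4⟩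
      obtain ⟨σ, rfl, h3'⟩ := hex h3
      exact ⟨σ, (div_lt_div_iff' hU).1 h1, h2, h3', (ih h3').1 h4⟩
    · rintro ⟨σ, h1, h2, h3, h4⟩
      exact ⟨(σ : ℝ) / (L ^ K : ℕ), (div_lt_div_iff' hU).2 h1, h2,
        h3.imp fun π h => by simpa only [gr_div hU] using h, (ih h3).2 h4⟩
  | glob I φ hφ =>
    have := encHF_pos_sub (k := 5) (x := encHF φ) (y := encFIvl I) (by omega)
    rw [encHF] at hn
    have ih : ∀ {σ}, (∃ π, c π σ ≠ 0) → _ := fun {σ} ⟨π, h⟩ =>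
      hφ (by omega) hnK hc (hc π σ h).1 (hc π σ h).2 d
    constructor
    · intro h σ h1 h2 h3
      exact (ih h3).1 (h ((σ : ℝ) / (L ^ K : ℕ)) ((div_lt_div_iff' hU).2 h1) h2
        (h3.imp fun π h => by simpa only [gr_div hU] using h))
    · intro h x h1 h2 h3
      obtain ⟨σ, rfl, h3'⟩ := hex h3
      exact (ih h3').2 (h σ ((div_lt_div_iff' hU).1 h1) h2 h3')
  | untl I φ ψ hφ hψ =>
    have h1 := encHF_pos_sub (k := 6) (x := Nat.pair (encHF φ) (encHF ψ)) (y := encFIvl I)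
      (by omega)
    have h2 := Nat.left_le_pair (encHF φ) (encHF ψ)
    have h3 := Nat.right_le_pair (encHF φ) (encHF ψ)
    rw [encHF] at hn
    have ih : ∀ {σ}, (∃ π, c π σ ≠ 0) → _ := fun {σ} ⟨π, h⟩ =>
      hφ (by omega) hnK hc (hc π σ h).1 (hc π σ h).2 d
    have ih' : ∀ {σ}, (∃ π, c π σ ≠ 0) → _ := fun {σ} ⟨π, h⟩ =>
      hψ (by omega) hnK hc (hc π σ h).1 (hc π σ h).2 d
    constructor
    · rintro ⟨x, h1, h2, h3, h4, h5⟩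
      obtain ⟨σ, rfl, h3'⟩ := hex h3
      refine ⟨σ, (div_lt_div_iff' hU).1 h1, h2, h3', (ih' h3').1 h4, fun ρ hρ hρ' hev => ?_⟩
      exact (ih hev).1 (h5 ((ρ : ℝ) / (L ^ K : ℕ)) ((div_lt_div_iff' hU).2 hρ)
        ((div_lt_div_iff' hU).2 hρ') (hev.imp fun π h => by simpa only [gr_div hU] using h))
    · rintro ⟨σ, h1, h2, h3, h4, h5⟩
      refine ⟨(σ : ℝ) / (L ^ K : ℕ), (div_lt_div_iff' hU).2 h1, h2,
        h3.imp fun π h => by simpa only [gr_div hU] using h, (ih' h3).2 h4, fun y hy hy' hev => ?_⟩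
      obtain ⟨ρ, rfl, hev'⟩ := hex hev
      exact (ih hev').2 (h5 ρ ((div_lt_div_iff' hU).1 hy) ((div_lt_div_iff' hU).1 hy') hev')
  | ex π φ hφ =>
    have := encHF_pos_sub (k := 7) (x := encHF φ) (y := π) (by omega)
    rw [encHF] at hn
    exact exists_gr_iff hb hN hC hG ((tw_mono b (by omega)).trans hL)
      (by omega : encHF φ < n) hnK
      (F := fun c t => GSat memR (admR C N) φ c t (some π)) (def_gsat hb hN hC hG φ (some π)) hc hτ
      hτ' d π fun c' hc' => hφ le_rfl (by omega) hc' hτ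
        ((pow_dvd_pow L (by omega)).trans hτ') (some π)
  | all π φ hφ =>
    have := encHF_pos_sub (k := 8) (x := encHF φ) (y := π) (by omega)
    rw [encHF] at hn
    have := exists_gr_iff hb hN hC hG (L := L) (h := 40 * encHF φ + 40)
      ((tw_mono b (by omega)).trans hL) (by omega : encHF φ < n) hnK
      (F := fun c t => ¬ GSat memR (admR C N) φ c t (some π))
      (F' := fun c => ¬ GSat (memN (L ^ K)) (admN C N (L ^ K) L) φ c τ (some π))
      (def_gsat hb hN hC hG φ (some π)).not hc hτ
      hτ' d π fun c' hc' => not_congr (hφ le_rfl (by omega) hc' hτ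
        ((pow_dvd_pow L (by omega)).trans hτ') (some π))
    rw [← not_iff_not]
    simp only [GSat, admR]
    push Not
    exact this

end

/-! ### Closure properties of primitive recursion -/

section
variable {α β γ : Type} [Primcodable α] [Primcodable β] [Primcodable γ]

attribute [fun_prop] Primrec

@[fun_prop]
theorem prim_id : Primrec fun a : α => a := Primrec.id

@[fun_prop]
theorem prim_const (b : β) : Primrec fun _ : α => b := Primrec.const b

@[fun_prop]
theorem prim_comp {f : β → γ} {g : α → β} (hf : Primrec f) (hg : Primrec g) :
    Primrec fun a => f (g a) := hf.comp hg

@[fun_prop]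
theorem prim_fst {f : α → β × γ} (hf : Primrec f) : Primrec fun a => (f a).1 := Primrec.fst.comp hf

@[fun_prop]
theorem prim_snd {f : α → β × γ} (hf : Primrec f) : Primrec fun a => (f a).2 := Primrec.snd.comp hf

@[fun_prop]
theorem prim_mk {f : α → β} {g : α → γ} (hf : Primrec f) (hg : Primrec g) :
    Primrec fun a => (f a, g a) := hf.pair hg

section
variable {f g : α → ℕ} (hf : Primrec f) (hg : Primrec g)
include hf

@[fun_prop]
theorem prim_unpair : Primrec fun a => (f a).unpair := Primrec.unpair.comp hf

@[fun_prop]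
theorem prim_unlist : Primrec fun a => unlist (f a) := (Primrec.ofNat (List ℕ)).comp hf

@[fun_prop]
theorem prim_range : Primrec fun a => List.range (f a) := Primrec.list_range.comp hf

include hg

@[fun_prop]
theorem prim_add : Primrec fun a => f a + g a := Primrec.nat_add.comp hf hg

@[fun_prop]
theorem prim_sub : Primrec fun a => f a - g a := Primrec.nat_sub.comp hf hg

@[fun_prop]
theorem prim_mul : Primrec fun a => f a * g a := Primrec.nat_mul.comp hf hg

@[fun_prop]
theorem prim_div : Primrec fun a => f a / g a := Primrec.nat_div.comp hf hg

@[fun_prop]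
theorem prim_mod : Primrec fun a => f a % g a := Primrec.nat_mod.comp hf hg

@[fun_prop]
theorem prim_pow : Primrec fun a => f a ^ g a :=
  (Primrec₂.unpaired'.1 Nat.Primrec.pow).comp hf hg

@[fun_prop]
theorem prim_pair : Primrec fun a => Nat.pair (f a) (g a) := Primrec₂.natPair.comp hf hg

theorem pred_lt : PrimrecPred fun a => f a < g a := Primrec.nat_lt.comp hf hg

theorem pred_le : PrimrecPred fun a => f a ≤ g a := Primrec.nat_le.comp hf hg

end

@[fun_prop]
theorem prim_getD {f : α → List β} {g : α → ℕ} (hf : Primrec f) (hg : Primrec g) (b : β) :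
    Primrec fun a => (f a).getD (g a) b := (Primrec.list_getD b).comp hf hg

theorem pred_eq {f g : α → β} (hf : Primrec f) (hg : Primrec g) :
    PrimrecPred fun a => f a = g a := Primrec.eq.comp hf hg

theorem pred_imp {p q : α → Prop} (hp : PrimrecPred p) (hq : PrimrecPred q) :
    PrimrecPred fun a => p a → q a :=
  (hp.not.or hq).of_eq fun _ => imp_iff_not_or.symm

theorem pred_ex_mem {l : α → List β} (hl : Primrec l) {P : α → β → Prop}
    (hP : PrimrecPred fun q : α × β => P q.1 q.2) : PrimrecPred fun a => ∃ x ∈ l a, P a x :=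
  have h : PrimrecRel fun x a => P a x := hP.comp (Primrec.snd.pair Primrec.fst)
  h.exists_mem_list.comp (f := l) (g := fun a => a) hl Primrec.id

theorem pred_all_mem {l : α → List β} (hl : Primrec l) {P : α → β → Prop}
    (hP : PrimrecPred fun q : α × β => P q.1 q.2) : PrimrecPred fun a => ∀ x ∈ l a, P a x :=
  have h : PrimrecRel fun x a => P a x := hP.comp (Primrec.snd.pair Primrec.fst)
  h.forall_mem_list.comp (f := l) (g := fun a => a) hl Primrec.id

theorem pred_mem {l : α → List β} {f : α → β} (hl : Primrec l) (hf : Primrec f) :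
    PrimrecPred fun a => f a ∈ l a :=
  (pred_ex_mem hl (P := fun a x => x = f a) (pred_eq (by fun_prop) (by fun_prop))).of_eq
    fun a => by simp

theorem pred_ex {f : α → ℕ} (hf : Primrec f) {P : α → ℕ → Prop}
    (hP : PrimrecPred fun q : α × ℕ => P q.1 q.2) : PrimrecPred fun a => ∃ x < f a, P a x :=
  (pred_ex_mem (prim_range hf) hP).of_eq fun a => by simp

theorem pred_all {f : α → ℕ} (hf : Primrec f) {P : α → ℕ → Prop}
    (hP : PrimrecPred fun q : α × ℕ => P q.1 q.2) : PrimrecPred fun a => ∀ x < f a, P a x :=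
  (pred_all_mem (prim_range hf) hP).of_eq fun a => by simp

end

/-! ### Tables -/

/-- The entry `X` of row `m` of the table `t` is `true`. -/
def lk (t : List (List Bool)) (m X : ℕ) : Prop := (t.getD m []).getD X false = true

section
variable (bd : ℕ → ℕ) (G : ℕ → ℕ → ℕ → List (List Bool) → Prop)

open Classical in
/-- The table whose row `m` has `bd a` entries, obtained by `G` from the rows before. -/
noncomputable def tabs (a : ℕ) : ℕ → List (List Bool)
  | 0 => []
  | n + 1 => tabs a n ++ [(List.range (bd a)).map fun X => decide (G a n X (tabs a n))]

/-- The entry `X` of row `m` of the tables for `a`. -/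
def Look (a m X : ℕ) : Prop := lk (tabs bd G a (m + 1)) m X

variable {bd G}

theorem length_tabs (a n : ℕ) : (tabs bd G a n).length = n := by
  induction n with
  | zero => rfl
  | succ n ih => simp [tabs, ih]

theorem lk_tabs {a m n : ℕ} (h : m < n) (X : ℕ) : lk (tabs bd G a n) m X ↔ Look bd G a m X := by
  induction n, h using Nat.le_induction with
  | base => rfl
  | succ n hn ih =>
    rw [← ih, lk, lk, tabs, List.getD_append _ _ _ _ (by rw [length_tabs]; omega)]

theorem look_iff {a X : ℕ} (n : ℕ) (h : X < bd a) :
    Look bd G a n X ↔ G a n X (tabs bd G a n) := by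
  simp [Look, lk, tabs, length_tabs, List.getD_eq_getElem?_getD, h]

theorem prim_tabs (hbd : Primrec bd) (hG : PrimrecPred fun q : (ℕ × ℕ) × ℕ × List (List Bool) =>
    G q.1.1 q.2.1 q.1.2 q.2.2) : Primrec fun q : ℕ × ℕ => tabs bd G q.1 q.2 := by
  classical
  have h : Primrec fun q : ℕ × ℕ × List (List Bool) =>
      (List.range (bd q.1)).map fun X => decide (G q.1 q.2.1 X q.2.2) := by
    refine Primrec.list_map (by fun_prop) ?_
    exact hG.decide.comp (f := fun q => decide _)
      (g := fun q : (ℕ × ℕ × List (List Bool)) × ℕ => ((q.1.1, q.2), q.1.2)) (by fun_prop)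
  have h' : Primrec fun q : ℕ × ℕ × List (List Bool) =>
      q.2.2 ++ [(List.range (bd q.1)).map fun X => decide (G q.1 q.2.1 X q.2.2)] :=
    Primrec.list_concat.comp (Primrec.snd.comp Primrec.snd) h
  have h'' := Primrec.nat_rec (f := fun _ : ℕ => ([] : List (List Bool))) (g := fun a p => p.2 ++
    [(List.range (bd a)).map fun X => decide (G a p.1 X p.2)]) (Primrec.const [])
    (Primrec₂.mk h')
  refine Primrec.of_eq h'' fun q => ?_
  obtain ⟨a, n⟩ := q
  induction n with
  | zero => rfl
  | succ n ih =>
    simp only [tabs, ← ih]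

theorem pred_lk {α : Type} [Primcodable α] {t : α → List (List Bool)} {m X : α → ℕ}
    (ht : Primrec t) (hm : Primrec m) (hX : Primrec X) : PrimrecPred fun a => lk (t a) (m a) (X a) :=
  pred_eq (by fun_prop) (by fun_prop)

theorem pred_look (hbd : Primrec bd) (hG : PrimrecPred fun q : (ℕ × ℕ) × ℕ × List (List Bool) =>
    G q.1.1 q.2.1 q.1.2 q.2.2) {α : Type} [Primcodable α] {a m X : α → ℕ}
    (ha : Primrec a) (hm : Primrec m) (hX : Primrec X) :
    PrimrecPred fun i => Look bd G (a i) (m i) (X i) := by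
  have := prim_tabs hbd hG
  have h : Primrec fun i => tabs bd G (a i) (m i + 1) :=
    this.comp (g := fun i => (a i, m i + 1)) (by fun_prop)
  exact pred_lk h hm hX

end

/-! ### The evaluator -/

/-- The automaton in the input `a`. -/
def codeN (a : ℕ) : Code where
  trans := unlist a.unpair.1.unpair.2.unpair.2.unpair.2.unpair.2.unpair.1
  start := a.unpair.1.unpair.2.unpair.1
  final := unlist a.unpair.1.unpair.2.unpair.2.unpair.2.unpair.2.unpair.2

/-- The refinement factor for the input `a`. -/
def bigL (a : ℕ) : ℕ := tw (2 ^ (a + 4)) (40 * a + 72)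

/-- The number of grid points in the unit interval. -/
def unitN (a : ℕ) : ℕ := bigL a ^ a

/-- The number of grid points. -/
def horN (a : ℕ) : ℕ := a.unpair.2.unpair.2 * unitN a

/-- The number of coded environments. -/
def envN (a : ℕ) : ℕ := (a + 2) ^ ((a + 1) * horN a)

/-- The environment coded by `e`. -/
def dig (a e π τ : ℕ) : ℕ :=
  if τ < horN a then e / (a + 2) ^ (π * horN a + τ) % (a + 2) else 0

/-- Evaluation of codes of clock constraints at `δ`. -/
def clkG (a n δ : ℕ) (t : List (List Bool)) : Prop :=
  (n.unpair.1 = 0 ∧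
    ((n.unpair.2.unpair.1 = 0 ∧ δ < n.unpair.2.unpair.2 * unitN a) ∨
      (n.unpair.2.unpair.1 = 1 ∧ δ ≤ n.unpair.2.unpair.2 * unitN a) ∨
      (n.unpair.2.unpair.1 = 2 ∧ δ = n.unpair.2.unpair.2 * unitN a) ∨
      (n.unpair.2.unpair.1 = 3 ∧ n.unpair.2.unpair.2 * unitN a ≤ δ) ∨
      (n.unpair.2.unpair.1 = 4 ∧ n.unpair.2.unpair.2 * unitN a < δ))) ∨
  (n.unpair.1 = 1 ∧ (lk t n.unpair.2.unpair.1 δ ∨ lk t n.unpair.2.unpair.2 δ)) ∨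
  (n.unpair.1 = 2 ∧ (lk t n.unpair.2.unpair.1 δ ∧ lk t n.unpair.2.unpair.2 δ))

/-- Truth of the clock constraint with code `n` at `δ`. -/
def clkN (a n δ : ℕ) : Prop := Look horN clkG a n δ

/-- `LastReset` with bounded quantifiers. -/
def lastB (a e π z x s : ℕ) : Prop :=
  (s = 0 ∧ ∀ y < x, z ∉ rstC (dig a e π y)) ∨
    (s < x ∧ z ∈ rstC (dig a e π s) ∧ ∀ y < x, s < y → z ∉ rstC (dig a e π y))

/-- `Valid` with bounded quantifiers. -/
def validB (a e π : ℕ) : Prop :=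
  (∀ x < horN a, dig a e π x ≠ 0 → ∃ k ∈ (codeN a).trans, dig a e π x = k + 1) ∧
  (∃ x < horN a, dig a e π x ≠ 0) ∧
  (∀ x < horN a, dig a e π x ≠ 0 → (∀ y < x, dig a e π y = 0) →
    srcC (dig a e π x) = (codeN a).start) ∧
  (∀ x < horN a, ∀ y < horN a, x < y → dig a e π x ≠ 0 → dig a e π y ≠ 0 →
    (∀ z < y, x < z → dig a e π z = 0) → srcC (dig a e π y) = dstC (dig a e π x)) ∧
  (∀ x < horN a, dig a e π x ≠ 0 → (∀ y < horN a, x < y → dig a e π y = 0) →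
    dstC (dig a e π x) ∈ (codeN a).final) ∧
  (∀ x < horN a, dig a e π x ≠ 0 → ∀ q ∈ grdC (dig a e π x), ∀ s < x + 1,
    lastB a e π q.unpair.1 x s → clkN a q.unpair.2 (x - s))

/-- The coded environment `e'` is obtained from `e` by an admissible choice of the run `π`. -/
def quantB (a e τ d π m e' : ℕ) : Prop :=
  (∀ π' < a + 1, π' ≠ π → ∀ x < horN a, dig a e' π' x = dig a e π' x) ∧
  (∀ x < horN a, dig a e' π x ≠ 0 → x % bigL a ^ m = 0) ∧
  validB a e' π ∧
  ((d = 0 ∧ τ = 0) ∨ (d ≠ 0 ∧ (∃ x < horN a, τ ≤ x ∧ dig a e (d - 1) x ≠ 0) ∧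
    ∀ x < τ + 1, dig a e' π x = dig a e (d - 1) x))

/-- Interval membership. -/
def memB (a τ x I : ℕ) : Prop :=
  ((I.unpair.2.unpair.2.unpair.1 ≠ 0 ∧ τ + I.unpair.1 * unitN a ≤ x) ∨
    (I.unpair.2.unpair.2.unpair.1 = 0 ∧ τ + I.unpair.1 * unitN a < x)) ∧
  (I.unpair.2.unpair.1 = 0 ∨
    (I.unpair.2.unpair.2.unpair.2 ≠ 0 ∧ x ≤ τ + (I.unpair.2.unpair.1 - 1) * unitN a) ∨
    (I.unpair.2.unpair.2.unpair.2 = 0 ∧ x < τ + (I.unpair.2.unpair.1 - 1) * unitN a))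

/-- The code of a position, a time and an environment. -/
def ptN (d τ e : ℕ) : ℕ := Nat.pair d (Nat.pair τ e)

/-- A bound for the codes of positions, times and environments. -/
def ptBd (a : ℕ) : ℕ := ptN (a + 2) (horN a) (envN a)

/-- Some run has an event at `x`. -/
def evB (a e x : ℕ) : Prop := ∃ π < a + 1, dig a e π x ≠ 0

/-- Evaluation of formulas with code `Nat.pair k r` at `ptN d τ e`. -/
def satK (a k r d τ e : ℕ) (t : List (List Bool)) : Prop :=
  (k = 0 ∧ dig a e r.unpair.2 τ ≠ 0 ∧ r.unpair.1 ∈ evtC (dig a e r.unpair.2 τ)) ∨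
  (k = 1 ∧ dig a e r.unpair.2 τ ≠ 0 ∧ r.unpair.1 ∉ evtC (dig a e r.unpair.2 τ)) ∨
  (k = 2 ∧ (lk t r.unpair.1 (ptN d τ e) ∨ lk t r.unpair.2 (ptN d τ e))) ∨
  (k = 3 ∧ (lk t r.unpair.1 (ptN d τ e) ∧ lk t r.unpair.2 (ptN d τ e))) ∨
  (k = 4 ∧ ∃ x < horN a, τ < x ∧ memB a τ x r.unpair.1 ∧ evB a e x ∧
    lk t r.unpair.2 (ptN d x e)) ∨
  (k = 5 ∧ ∀ x < horN a, τ < x → memB a τ x r.unpair.1 → evB a e x →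
    lk t r.unpair.2 (ptN d x e)) ∨
  (k = 6 ∧ ∃ x < horN a, τ < x ∧ memB a τ x r.unpair.1 ∧ evB a e x ∧
    lk t r.unpair.2.unpair.2 (ptN d x e) ∧ ∀ y < x, τ < y → evB a e y →
      lk t r.unpair.2.unpair.1 (ptN d y e)) ∨
  (k = 7 ∧ ∃ e' < envN a, quantB a e τ d r.unpair.1 r.unpair.2 e' ∧
    lk t r.unpair.2 (ptN (r.unpair.1 + 1) τ e')) ∨
  (k = 8 ∧ ∀ e' < envN a, quantB a e τ d r.unpair.1 r.unpair.2 e' →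
    lk t r.unpair.2 (ptN (r.unpair.1 + 1) τ e'))

/-- Evaluation of the formula with code `n` at the code `X`. -/
def satG (a n X : ℕ) (t : List (List Bool)) : Prop :=
  satK a n.unpair.1 n.unpair.2 X.unpair.1 X.unpair.2.unpair.1 X.unpair.2.unpair.2 t

/-- Truth of the formula with code `n` at `X`. -/
def satN (a n X : ℕ) : Prop := Look ptBd satG a n X

/-! ### The evaluator is primitive recursive -/

section
variable {α : Type} [Primcodable α]

@[fun_prop]
theorem prim_tw {b h : α → ℕ} (hb : Primrec b) (hh : Primrec h) :
    Primrec fun i => tw (b i) (h i) := by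
  have : Primrec₂ fun b h : ℕ => (Nat.rec b (fun _ r => 2 ^ r) h : ℕ) :=
    Primrec.nat_rec (f := fun b : ℕ => b) (g := fun _ p => 2 ^ p.2) Primrec.id
      (Primrec₂.mk (by fun_prop))
  refine (this.comp hb hh).of_eq fun i => ?_
  induction h i with
  | zero => rfl
  | succ n ih => simp only [tw, ih]

variable {a e π τ d m z x s n δ e' I : α → ℕ} (ha : Primrec a) (he : Primrec e) (hπ : Primrec π)
  (hτ : Primrec τ) (hd : Primrec d) (hm : Primrec m) (hz : Primrec z) (hx : Primrec x)
  (hs : Primrec s) (hn : Primrec n) (hδ : Primrec δ) (he' : Primrec e') (hI : Primrec I)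

include hn in
@[fun_prop]
theorem prim_srcC : Primrec fun i => srcC (n i) := by unfold srcC; fun_prop

include hn in
@[fun_prop]
theorem prim_dstC : Primrec fun i => dstC (n i) := by unfold dstC; fun_prop

include hn in
@[fun_prop]
theorem prim_evtC : Primrec fun i => evtC (n i) := by unfold evtC; fun_prop

include hn in
@[fun_prop]
theorem prim_grdC : Primrec fun i => grdC (n i) := by unfold grdC; fun_prop

include hn in
@[fun_prop]
theorem prim_rstC : Primrec fun i => rstC (n i) := by unfold rstC; fun_prop

include hd hτ he in
@[fun_prop]
theorem prim_ptN : Primrec fun i => ptN (d i) (τ i) (e i) := by unfold ptN; fun_prop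

section
include ha

@[fun_prop]
theorem prim_trans : Primrec fun i => (codeN (a i)).trans := by unfold codeN; fun_prop

@[fun_prop]
theorem prim_start : Primrec fun i => (codeN (a i)).start := by unfold codeN; fun_prop

@[fun_prop]
theorem prim_final : Primrec fun i => (codeN (a i)).final :=
  have h := prim_unpair (prim_snd (prim_unpair (prim_fst (prim_unpair ha))))
  prim_unlist (prim_snd (prim_unpair (prim_snd (prim_unpair (prim_snd (prim_unpair (prim_snd h)))))))

@[fun_prop]
theorem prim_bigL : Primrec fun i => bigL (a i) :=
  prim_tw (prim_pow (prim_const 2) (prim_add ha (prim_const 4)))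
    (prim_add (prim_mul (prim_const 40) ha) (prim_const 72))

@[fun_prop]
theorem prim_unitN : Primrec fun i => unitN (a i) := by unfold unitN; fun_prop

@[fun_prop]
theorem prim_horN : Primrec fun i => horN (a i) := by unfold horN; fun_prop

@[fun_prop]
theorem prim_envN : Primrec fun i => envN (a i) := by unfold envN; fun_prop

@[fun_prop]
theorem prim_ptBd : Primrec fun i => ptBd (a i) := by unfold ptBd; fun_prop

include he hπ hτ in
@[fun_prop]
theorem prim_dig : Primrec fun i => dig (a i) (e i) (π i) (τ i) :=
  Primrec.ite (pred_lt hτ (prim_horN ha))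
    (prim_mod (prim_div he (prim_pow (prim_add ha (prim_const 2))
      (prim_add (prim_mul hπ (prim_horN ha)) hτ))) (prim_add ha (prim_const 2)))
    (prim_const 0)

attribute [irreducible] bigL unitN horN envN dig ptBd

include hn hδ in
theorem pred_clkN : PrimrecPred fun i => clkN (a i) (n i) (δ i) := by
  refine pred_look (by fun_prop) ?_ ha hn hδ
  unfold clkG
  repeat' with_reducible first
    | fun_prop
    | apply PrimrecPred.or
    | apply PrimrecPred.and
    | apply pred_eq
    | apply pred_lt
    | apply pred_le
    | apply pred_lk

include he hπ hz hx hs in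
theorem pred_lastB : PrimrecPred fun i => lastB (a i) (e i) (π i) (z i) (x i) (s i) := by
  unfold lastB
  repeat' with_reducible first
    | fun_prop
    | apply PrimrecPred.or
    | apply PrimrecPred.and
    | apply PrimrecPred.not
    | apply pred_eq
    | apply pred_lt
    | apply pred_le
    | apply pred_all
    | apply pred_imp
    | apply pred_mem

include he hπ in
theorem pred_validB : PrimrecPred fun i => validB (a i) (e i) (π i) := by
  unfold validB
  repeat' with_reducible first
    | exact prim_trans (by fun_prop)
    | exact prim_start (by fun_prop)
    | exact prim_final (by fun_prop)
    | fun_prop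
    | apply PrimrecPred.or
    | apply PrimrecPred.and
    | apply PrimrecPred.not
    | apply pred_eq
    | apply pred_lt
    | apply pred_le
    | apply pred_all
    | apply pred_ex
    | apply pred_ex_mem
    | apply pred_all_mem
    | apply pred_imp
    | apply pred_mem
    | apply pred_lastB
    | apply pred_clkN

include he hπ hτ hd hm he' in
theorem pred_quantB :
    PrimrecPred fun i => quantB (a i) (e i) (τ i) (d i) (π i) (m i) (e' i) := by
  unfold quantB
  repeat' with_reducible first
    | fun_prop
    | apply pred_validB
    | apply PrimrecPred.or
    | apply PrimrecPred.and
    | apply PrimrecPred.not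
    | apply pred_eq
    | apply pred_lt
    | apply pred_le
    | apply pred_all
    | apply pred_ex
    | apply pred_imp

include hτ hx hI in
theorem pred_memB : PrimrecPred fun i => memB (a i) (τ i) (x i) (I i) := by
  unfold memB
  repeat' with_reducible first
    | fun_prop
    | apply PrimrecPred.or
    | apply PrimrecPred.and
    | apply PrimrecPred.not
    | apply pred_eq
    | apply pred_lt
    | apply pred_le

include he hx in
theorem pred_evB : PrimrecPred fun i => evB (a i) (e i) (x i) := by
  unfold evB
  repeat' with_reducible first
    | fun_prop
    | apply pred_ex
    | apply PrimrecPred.not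
    | apply pred_eq

include hn hx in
theorem pred_satN : PrimrecPred fun i => satN (a i) (n i) (x i) := by
  refine pred_look (by fun_prop) ?_ ha hn hx
  unfold satG satK
  repeat' with_reducible first
    | fun_prop
    | apply pred_memB
    | apply pred_evB
    | apply pred_quantB
    | apply pred_lk
    | apply PrimrecPred.or
    | apply PrimrecPred.and
    | apply PrimrecPred.not
    | apply pred_eq
    | apply pred_lt
    | apply pred_le
    | apply pred_all
    | apply pred_ex
    | apply pred_imp
    | apply pred_mem

end
end

/-! ### Correctness of the evaluator -/

theorem lt_encList {α : Type} (f : α → ℕ) {l : List α} {x : α} (hx : x ∈ l) :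
    f x < encList f l := by
  induction l with
  | nil => exact absurd hx List.not_mem_nil
  | cons y l ih =>
    rcases List.mem_cons.1 hx with rfl | hx
    · exact Nat.lt_succ_of_le (Nat.left_le_pair _ _)
    · exact (ih hx).trans_le ((Nat.right_le_pair _ _).trans (Nat.le_succ _))

theorem length_le_encList {α : Type} (f : α → ℕ) (l : List α) : l.length ≤ encList f l := by
  induction l with
  | nil => exact le_rfl
  | cons y l ih => exact Nat.succ_le_succ (ih.trans (Nat.right_le_pair _ _))

theorem codeN_pair (B : PTA ℕ) (w : ℕ) : codeN (Nat.pair (encPTA B) w) = codeOf B := by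
  simp [codeN, codeOf, encPTA, unlist_encList]

theorem encList_trans_le (B : PTA ℕ) : encList encPEdge B.trans ≤ encPTA B := by
  unfold encPTA
  iterate 4 refine le_trans ?_ (Nat.right_le_pair _ _)
  exact Nat.left_le_pair _ _

theorem lt_encPTA {B : PTA ℕ} {k : ℕ} (hk : k ∈ (codeOf B).trans) : k < encPTA B := by
  obtain ⟨e, he, rfl⟩ := List.mem_map.1 hk
  exact (lt_encList encPEdge he).trans_le (encList_trans_le B)

theorem exists_digits {Z : ℕ} (hZ : 0 < Z) (n : ℕ) (g : ℕ → ℕ) (hg : ∀ i, g i < Z) :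
    ∃ e < Z ^ n, ∀ i < n, e / Z ^ i % Z = g i := by
  induction n generalizing g with
  | zero => exact ⟨0, by simp, fun i hi => absurd hi (Nat.not_lt_zero i)⟩
  | succ n ih =>
    obtain ⟨e, he, h⟩ := ih (fun i => g (i + 1)) fun i => hg _
    refine ⟨g 0 + Z * e, ?_, fun i hi => ?_⟩
    · have h1 : Z * (e + 1) ≤ Z * Z ^ n := Nat.mul_le_mul_left Z he
      have := hg 0
      rw [pow_succ']
      linarith
    · cases i with
      | zero => simp [Nat.mod_eq_of_lt (hg 0)]
      | succ i =>
        rw [pow_succ', ← Nat.div_div_eq_div_mul, Nat.add_mul_div_left _ _ hZ,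
          Nat.div_eq_of_lt (hg 0), zero_add]
        exact h i (by omega)

theorem dig_lt (a e π τ : ℕ) : dig a e π τ < a + 2 := by
  unfold dig
  split_ifs
  · exact Nat.mod_lt _ (by omega)
  · omega

theorem dig_ne_zero {a e π τ : ℕ} (h : dig a e π τ ≠ 0) : τ < horN a := by
  by_contra h'
  unfold dig at h
  exact h (if_neg h')

theorem dig_ne_zero' {a e π τ : ℕ} (he : e < envN a) (h : dig a e π τ ≠ 0) : π < a + 1 := by
  by_contra h'
  unfold dig at h
  unfold envN at he
  refine h ?_
  split_ifs
  · have : (a + 1) * horN a ≤ π * horN a + τ :=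
      (Nat.mul_le_mul_right _ (not_lt.1 h')).trans (Nat.le_add_right _ _)
    rw [Nat.div_eq_of_lt (he.trans_le (Nat.pow_le_pow_right (by omega) this)), Nat.zero_mod]
  · rfl

theorem dig_zero (a : ℕ) : dig a 0 = 0 := by
  funext π τ
  simp [dig]

theorem exists_dig {a : ℕ} {c : ℕ → ℕ → ℕ} (hc : ∀ π τ, c π τ < a + 2)
    (h0 : ∀ π τ, c π τ ≠ 0 → π < a + 1 ∧ τ < horN a) : ∃ e < envN a, dig a e = c := by
  obtain ⟨e, he, h⟩ := exists_digits (Z := a + 2) (by omega) ((a + 1) * horN a)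
    (fun i => c (i / horN a) (i % horN a)) fun i => hc _ _
  refine ⟨e, by unfold envN; exact he, ?_⟩
  funext π τ
  have he' : e < envN a := by unfold envN; exact he
  by_cases hπ : π < a + 1 ∧ τ < horN a
  · have hi : π * horN a + τ < (a + 1) * horN a := by nlinarith [hπ.1, hπ.2]
    unfold dig
    rw [if_pos hπ.2, h _ hi, add_comm, Nat.add_mul_div_right _ _ (by omega),
      Nat.div_eq_of_lt hπ.2, zero_add, Nat.add_mul_mod_self_right, Nat.mod_eq_of_lt hπ.2]
  · rw [not_imp_comm.1 (h0 π τ) hπ]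
    by_contra h
    exact hπ ⟨dig_ne_zero' he' h, dig_ne_zero h⟩

theorem unitN_pos (a : ℕ) : 0 < unitN a := by
  unfold unitN bigL
  have := le_tw (2 ^ (a + 4)) (40 * a + 72)
  have h : 0 < 2 ^ (a + 4) := by positivity
  exact Nat.pow_pos (by omega)

theorem clkN_enc {a : ℕ} (g : ClkC ℕ) {δ : ℕ} (hδ : δ < horN a) :
    clkN a (encClkC g) δ ↔ g.holds natR ((δ : ℝ) / unitN a) := by
  have hU : (0 : ℝ) < unitN a := Nat.cast_pos.2 (unitN_pos a)
  induction g with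
  | atom c k =>
    rw [clkN, look_iff _ hδ]
    have h1 : (δ : ℝ) / unitN a < k ↔ δ < k * unitN a := by
      rw [div_lt_iff₀ hU]; exact_mod_cast Iff.rfl
    have h2 : (δ : ℝ) / unitN a ≤ k ↔ δ ≤ k * unitN a := by
      rw [div_le_iff₀ hU]; exact_mod_cast Iff.rfl
    have h3 : (k : ℝ) ≤ (δ : ℝ) / unitN a ↔ k * unitN a ≤ δ := by
      rw [le_div_iff₀ hU]; exact_mod_cast Iff.rfl
    have h4 : (k : ℝ) < (δ : ℝ) / unitN a ↔ k * unitN a < δ := by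
      rw [lt_div_iff₀ hU]; exact_mod_cast Iff.rfl
    have h5 : (δ : ℝ) / unitN a = k ↔ δ = k * unitN a := by
      rw [div_eq_iff hU.ne']; exact_mod_cast Iff.rfl
    cases c <;> simp [clkG, encClkC, ClkC.holds, Cmp.code, Cmp.denote, natR, *]
  | disj g g' ih ih' =>
    have h := encHF_pos_sub (k := 1) (x := encClkC g') (y := encClkC g) one_pos
    refine Iff.trans ?_ (or_congr ih ih')
    rw [clkN, look_iff _ hδ, clkN, clkN, ← lk_tabs h.1, ← lk_tabs h.2]
    simp [clkG, encClkC]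
  | conj g g' ih ih' =>
    have h := encHF_pos_sub (k := 2) (x := encClkC g') (y := encClkC g) two_pos
    refine Iff.trans ?_ (and_congr ih ih')
    rw [clkN, look_iff _ hδ, clkN, clkN, ← lk_tabs h.1, ← lk_tabs h.2]
    simp [clkG, encClkC]

theorem lastB_iff {a e π z x s : ℕ} : lastB a e π z x s ↔ LastReset (dig a e π) z x s :=
  or_congr Iff.rfl <| and_congr Iff.rfl <| and_congr Iff.rfl
    ⟨fun h y hy hy' => h y hy' hy, fun h y hy hy' => h y hy' hy⟩

theorem memB_iff {a τ x : ℕ} (I : FIvl ℕ) : memB a τ x (encFIvl I) ↔ memN (unitN a) τ x I := by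
  have hU : (0 : ℝ) < unitN a := Nat.cast_pos.2 (unitN_pos a)
  have h (k : ℕ) : (τ : ℝ) / unitN a + k = ((τ + k * unitN a : ℕ) : ℝ) / unitN a := by
    push_cast
    field_simp
  obtain ⟨lo, hi, lc, hc⟩ := I
  rw [memN, memR, FIvl.Mem]
  cases lc <;> cases hc <;> cases hi <;>
    simp [memB, encFIvl, natR, h, div_lt_div_iff' (unitN_pos a), div_le_div_iff' (unitN_pos a),
      -Nat.cast_add, -Nat.cast_mul]

theorem evB_iff {a e x : ℕ} (he : e < envN a) : evB a e x ↔ ∃ π, dig a e π x ≠ 0 :=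
  ⟨fun ⟨π, _, h⟩ => ⟨π, h⟩, fun ⟨π, h⟩ => ⟨π, dig_ne_zero' he h, h⟩⟩

section
variable {B : PTA ℕ} {w a : ℕ} (ha : a = Nat.pair (encPTA B) w)
include ha

theorem validB_iff {e π : ℕ} :
    validB a e π ↔ Valid (codeOf B) (HN (unitN a)) (dig a e π) := by
  have hg : ∀ x, (∃ k ∈ (codeOf B).trans, dig a e π x = k + 1) → x < horN a →
      ∀ q ∈ grdC (dig a e π x), ∀ s, s ≤ x →
        (clkN a q.unpair.2 (x - s) ↔ HN (unitN a) s x q.unpair.2) := by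
    rintro x ⟨k, hk, hx⟩ hxh q hq s hs
    obtain ⟨p, -, rfl⟩ := List.mem_map.1 hk
    rw [hx, grdC_enc] at hq
    obtain ⟨⟨z, g⟩, -, rfl⟩ := List.mem_map.1 hq
    rw [Nat.unpair_pair, clkN_enc g (by omega), HN, HR_enc, Nat.cast_sub hs, sub_div]
  have hs : ∀ z x s, LastReset (dig a e π) z x s → s ≤ x := by
    rintro z x s (⟨rfl, -⟩ | ⟨h, -⟩)
    · exact Nat.zero_le x
    · exact h.le
  have hc : codeN a = codeOf B := by rw [ha, codeN_pair]
  rw [validB, hc]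
  constructor
  · rintro ⟨h1, ⟨x0, -, h2⟩, h3, h4, h5, h6⟩
    refine ⟨fun x hx => h1 x (dig_ne_zero hx) hx, ⟨x0, h2⟩,
      fun x hx hy => h3 x (dig_ne_zero hx) hx hy, fun x y hxy hx hy hz =>
      h4 x (dig_ne_zero hx) y (dig_ne_zero hy) hxy hx hy fun z hzy hxz => hz z hxz hzy,
      fun x hx hy => h5 x (dig_ne_zero hx) hx fun y _ hxy => hy y hxy, fun x hx q hq s hl => ?_⟩
    have hx' := dig_ne_zero hx
    have := hs _ _ _ hl
    exact (hg x (h1 x hx' hx) hx' q hq s this).1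
      (h6 x hx' hx q hq s (by omega) (lastB_iff.2 hl))
  · intro h
    refine ⟨fun x _ hx => h.mem x hx, h.nonempty.imp fun x hx => ⟨dig_ne_zero hx, hx⟩,
      fun x _ hx hy => h.start x hx hy, fun x _ y _ hxy hx hy hz => h.step x y hxy hx hy
        fun z hxz hzy => hz z hzy hxz, fun x _ hx hy => h.final x hx fun y hxy => ?_,
      fun x hxh hx q hq s hsx hl => ?_⟩
    · by_contra h0
      exact h0 (hy y (dig_ne_zero h0) hxy)
    · exact (hg x (h.mem x hx) hxh q hq s (by omega)).2 (h.guard x hx q hq s (lastB_iff.1 hl))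

end

/-- Code of the current position. -/
def posE : Option ℕ → ℕ
  | none => 0
  | some π => π + 1

section
variable {B : PTA ℕ} {v N a : ℕ} (ha : a = Nat.pair (encPTA B) (Nat.pair v N))
include ha

theorem horN_eq : horN a = N * unitN a := by
  unfold horN
  simp [ha]

theorem quantB_iff {e τ π m e' : ℕ} {d : Option ℕ} (he : e < envN a) (he' : e' < envN a) :
    quantB a e τ (posE d) π m e' ↔ dig a e' = Function.update (dig a e) π (dig a e' π) ∧
      admN (codeOf B) N (unitN a) (bigL a) m (dig a e' π) ∧
      Ext (dig a e) τ d (dig a e' π) := by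
  have h1 : (∀ π' < a + 1, π' ≠ π → ∀ x < horN a, dig a e' π' x = dig a e π' x) ↔
      dig a e' = Function.update (dig a e) π (dig a e' π) := by
    constructor
    · intro h
      funext π' x
      rcases eq_or_ne π' π with rfl | hπ
      · rw [Function.update_self]
      · rw [Function.update_of_ne hπ]
        by_cases hx : π' < a + 1 ∧ x < horN a
        · exact h π' hx.1 hπ x hx.2
        · have h0 {e : ℕ} (he : e < envN a) : dig a e π' x = 0 := by
            by_contra h0
            exact hx ⟨dig_ne_zero' he h0, dig_ne_zero h0⟩
          rw [h0 he, h0 he']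
    · intro h π' _ hπ x _
      rw [h, Function.update_of_ne hπ]
  have h2 : (∀ x < horN a, dig a e' π x ≠ 0 → x % bigL a ^ m = 0) ∧ validB a e' π ↔
      admN (codeOf B) N (unitN a) (bigL a) m (dig a e' π) := by
    rw [validB_iff ha, admN, ← horN_eq ha]
    refine and_congr_left fun _ => ⟨fun h x hx => ?_, fun h x _ hx => ?_⟩
    · exact ⟨dig_ne_zero hx, Nat.dvd_of_mod_eq_zero (h x (dig_ne_zero hx) hx)⟩
    · exact Nat.mod_eq_zero_of_dvd (h x hx).2
  have h3 : ((posE d = 0 ∧ τ = 0) ∨ (posE d ≠ 0 ∧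
      (∃ x < horN a, τ ≤ x ∧ dig a e (posE d - 1) x ≠ 0) ∧
      ∀ x < τ + 1, dig a e' π x = dig a e (posE d - 1) x)) ↔
      Ext (dig a e) τ d (dig a e' π) := by
    cases d with
    | none => simp [posE, Ext]
    | some d =>
      simp only [posE, Ext, Nat.add_sub_cancel, Option.some.injEq, exists_eq_left', Nat.lt_succ_iff]
      simp only [Nat.add_eq_zero_iff, one_ne_zero, and_false, false_and, ne_eq, not_false_eq_true,
        true_and, reduceCtorEq, false_or]
      refine and_congr_left fun _ => exists_congr fun x => ?_
      exact ⟨fun h => h.2, fun h => ⟨dig_ne_zero h.2, h⟩⟩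
  rw [quantB, h1, h3, ← h2, and_assoc]

end

section
variable {a : ℕ}

theorem ptN_lt {d τ e : ℕ} (hd : d < a + 2) (hτ : τ < horN a) (he : e < envN a) :
    ptN d τ e < ptBd a := by
  unfold ptBd ptN
  exact (Nat.pair_lt_pair_left _ hd).trans (Nat.pair_lt_pair_right _
    ((Nat.pair_lt_pair_left _ hτ).trans (Nat.pair_lt_pair_right _ he)))

theorem satN_pair {k r d τ e : ℕ} (hd : d < a + 2) (hτ : τ < horN a) (he : e < envN a) :
    satN a (Nat.pair k r) (ptN d τ e) ↔
      satK a k r d τ e (tabs ptBd satG a (Nat.pair k r)) := by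
  rw [satN, look_iff _ (ptN_lt hd hτ he), satG, ptN]
  simp only [Nat.unpair_pair]

variable {B : PTA ℕ} {v N : ℕ} (ha : a = Nat.pair (encPTA B) (Nat.pair v N))
include ha

theorem exists_env {e π m : ℕ} (he : e < envN a) (hπ : π < a + 1) {f : ℕ → ℕ}
    (hf : admN (codeOf B) N (unitN a) (bigL a) m f) :
    ∃ e' < envN a, dig a e' = Function.update (dig a e) π f := by
  have hf' : ∀ x, f x ≠ 0 → x < horN a := fun x hx => horN_eq ha ▸ (hf.1 x hx).1
  refine exists_dig (fun π' x => ?_) fun π' x hx => ?_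
  · rcases eq_or_ne π' π with rfl | hπ'
    · rw [Function.update_self]
      by_cases hx : f x = 0
      · omega
      · obtain ⟨k, hk, hk'⟩ := hf.2.mem x hx
        have h1 := lt_encPTA hk
        have h2 := Nat.left_le_pair (encPTA B) (Nat.pair v N)
        omega
    · rw [Function.update_of_ne hπ']
      exact dig_lt _ _ _ _
  · rcases eq_or_ne π' π with rfl | hπ'
    · rw [Function.update_self] at hx
      exact ⟨hπ, hf' x hx⟩
    · rw [Function.update_of_ne hπ'] at hx
      exact ⟨dig_ne_zero' he hx, dig_ne_zero hx⟩

/-- The evaluator is correct for discrete times. -/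
theorem satN_iff (φ : HF ℕ) (hφ : encHF φ ≤ a) {d : Option ℕ} {τ e : ℕ} (hd : posE d < a + 2)
    (hτ : τ < horN a) (he : e < envN a) :
    satN a (encHF φ) (ptN (posE d) τ e) ↔
      GSat (memN (unitN a)) (admN (codeOf B) N (unitN a) (bigL a)) φ (dig a e) τ d := by
  induction φ generalizing d τ e with
  | pos p π =>
    rw [encHF, satN_pair hd hτ he, GSat]
    simp [satK]
  | neg p π =>
    rw [encHF, satN_pair hd hτ he, GSat]
    simp [satK]
  | disj φ ψ ih ih' =>
    rw [encHF] at hφ ⊢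
    have h := encHF_pos_sub (k := 2) (x := encHF ψ) (y := encHF φ) two_pos
    rw [satN_pair hd hτ he, GSat, ← ih (h.2.le.trans hφ) hd hτ he,
      ← ih' (h.1.le.trans hφ) hd hτ he, satN, satN, ← lk_tabs h.1, ← lk_tabs h.2]
    simp [satK]
  | conj φ ψ ih ih' =>
    rw [encHF] at hφ ⊢
    have h := encHF_pos_sub (k := 3) (x := encHF ψ) (y := encHF φ) three_pos
    rw [satN_pair hd hτ he, GSat, ← ih (h.2.le.trans hφ) hd hτ he,
      ← ih' (h.1.le.trans hφ) hd hτ he, satN, satN, ← lk_tabs h.1, ← lk_tabs h.2]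
    simp [satK]
  | fut I φ ih =>
    rw [encHF] at hφ ⊢
    have h := (encHF_pos_sub (k := 4) (x := encHF φ) (y := encFIvl I) four_pos).1
    have ih := fun {x} (hx : x < horN a) => (lk_tabs h _).trans (ih (h.le.trans hφ) hd hx he)
    rw [satN_pair hd hτ he, GSat]
    simp only [satK, Nat.unpair_pair, memB_iff, evB_iff he]
    simp only [OfNat.ofNat_ne_zero, Nat.reduceEqDiff, false_and, true_and, false_or, or_false]
    refine exists_congr fun x => ?_
    constructor
    · rintro ⟨hx, h1, h2, h3, h4⟩
      exact ⟨h1, h2, h3, (ih hx).1 h4⟩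
    · rintro ⟨h1, h2, ⟨π, h3⟩, h4⟩
      exact ⟨dig_ne_zero h3, h1, h2, ⟨π, h3⟩, (ih (dig_ne_zero h3)).2 h4⟩
  | glob I φ ih =>
    rw [encHF] at hφ ⊢
    have h := (encHF_pos_sub (k := 5) (x := encHF φ) (y := encFIvl I) (by omega)).1
    have ih := fun {x} (hx : x < horN a) => (lk_tabs h _).trans (ih (h.le.trans hφ) hd hx he)
    rw [satN_pair hd hτ he, GSat]
    simp only [satK, Nat.unpair_pair, memB_iff, evB_iff he]
    simp only [OfNat.ofNat_ne_zero, Nat.reduceEqDiff, false_and, true_and, false_or, or_false]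
    refine forall_congr' fun x => ⟨fun H h1 h2 h3 => ?_, fun H hx h1 h2 h3 => (ih hx).2 (H h1 h2 h3)⟩
    obtain ⟨π, h4⟩ := h3
    exact (ih (dig_ne_zero h4)).1 (H (dig_ne_zero h4) h1 h2 ⟨π, h4⟩)
  | untl I φ ψ ih ih' =>
    rw [encHF] at hφ ⊢
    have h0 := (encHF_pos_sub (k := 6) (x := Nat.pair (encHF φ) (encHF ψ)) (y := encFIvl I)
      (by omega)).1
    have h := (Nat.left_le_pair (encHF φ) (encHF ψ)).trans_lt h0
    have h' := (Nat.right_le_pair (encHF φ) (encHF ψ)).trans_lt h0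
    have ih := fun {x} (hx : x < horN a) => (lk_tabs h _).trans (ih (h.le.trans hφ) hd hx he)
    have ih' := fun {x} (hx : x < horN a) => (lk_tabs h' _).trans (ih' (h'.le.trans hφ) hd hx he)
    rw [satN_pair hd hτ he, GSat]
    simp only [satK, Nat.unpair_pair, memB_iff, evB_iff he]
    simp only [OfNat.ofNat_ne_zero, Nat.reduceEqDiff, false_and, true_and, false_or, or_false]
    refine exists_congr fun x => ?_
    constructor
    · rintro ⟨hx, h1, h2, h3, h4, h5⟩
      exact ⟨h1, h2, h3, (ih' hx).1 h4, fun y hy hyx hye =>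
        (ih (hyx.trans hx)).1 (h5 y hyx hy hye)⟩
    · rintro ⟨h1, h2, ⟨π, h3⟩, h4, h5⟩
      have hx := dig_ne_zero h3
      exact ⟨hx, h1, h2, ⟨π, h3⟩, (ih' hx).2 h4, fun y hyx hy hye =>
        (ih (hyx.trans hx)).2 (h5 y hy hyx hye)⟩
  | ex π φ ih =>
    rw [encHF] at hφ ⊢
    have h := encHF_pos_sub (k := 7) (x := encHF φ) (y := π) (by omega)
    have hπ : posE (some π) < a + 2 := by have := h.2; simp only [posE]; omega
    have ih := fun {e'} (he' : e' < envN a) =>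
      (lk_tabs h.1 _).trans (ih (h.1.le.trans hφ) hπ hτ he')
    rw [satN_pair hd hτ he, GSat]
    simp only [satK, Nat.unpair_pair]
    simp only [OfNat.ofNat_ne_zero, OfNat.ofNat_ne_one, Nat.reduceEqDiff, false_and, true_and,
      false_or, or_false]
    constructor
    · rintro ⟨e', he', hq, hs⟩
      obtain ⟨h1, h2, h3⟩ := (quantB_iff ha he he').1 hq
      exact ⟨_, h2, h3, h1 ▸ (ih he').1 hs⟩
    · rintro ⟨f, h2, h3, hs⟩
      obtain ⟨e', he', h1⟩ := exists_env ha he (by omega : π < a + 1) h2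
      have hf : dig a e' π = f := by rw [h1, Function.update_self]
      exact ⟨e', he', (quantB_iff ha he he').2 (by rw [hf]; exact ⟨h1, h2, h3⟩),
        (ih he').2 (by rw [h1]; exact hs)⟩
  | all π φ ih =>
    rw [encHF] at hφ ⊢
    have h := encHF_pos_sub (k := 8) (x := encHF φ) (y := π) (by omega)
    have hπ : posE (some π) < a + 2 := by have := h.2; simp only [posE]; omega
    have ih := fun {e'} (he' : e' < envN a) =>
      (lk_tabs h.1 _).trans (ih (h.1.le.trans hφ) hπ hτ he')
    rw [satN_pair hd hτ he, GSat]
    simp only [satK, Nat.unpair_pair]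
    simp only [OfNat.ofNat_ne_zero, OfNat.ofNat_ne_one, Nat.reduceEqDiff, false_and, true_and,
      false_or]
    constructor
    · intro H f h2 h3
      obtain ⟨e', he', h1⟩ := exists_env ha he (by omega : π < a + 1) h2
      have hf : dig a e' π = f := by rw [h1, Function.update_self]
      have := (ih he').1 (H e' he' ((quantB_iff ha he he').2 (by rw [hf]; exact ⟨h1, h2, h3⟩)))
      rwa [h1] at this
    · intro H e' he' hq
      obtain ⟨h1, h2, h3⟩ := (quantB_iff ha he he').1 hq
      have := H _ h2 h3
      rw [← h1] at this
      exact (ih he').2 this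

end

/-- The evaluator solves the bounded-time verification problem. -/
theorem satN_psat (B : PTA ℕ) (φ : HF ℕ) {N : ℕ} (hN : 0 < N) {a : ℕ}
    (ha : a = Nat.pair (encPTA B) (Nat.pair (encHF φ) N)) :
    satN a (encHF φ) (ptN 0 0 0) ↔
      PSat natR B (some (N : ℝ)) φ ∅ (fun _ => default) 0 none := by
  have hB : encPTA B ≤ a := ha ▸ Nat.left_le_pair _ _
  have hφN : Nat.pair (encHF φ) N ≤ a := ha ▸ Nat.right_le_pair _ _
  have hφ : encHF φ ≤ a := (Nat.left_le_pair _ _).trans hφN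
  have hNa : N ≤ a := (Nat.right_le_pair _ _).trans hφN
  have hab : a ≤ 2 ^ (a + 4) := Nat.lt_two_pow_self.le.trans (Nat.pow_le_pow_right two_pos (by omega))
  have hh : 0 < horN a := by rw [horN_eq ha]; exact Nat.mul_pos hN (unitN_pos a)
  have hE : 0 < envN a := by unfold envN; positivity
  have hU : unitN a = bigL a ^ a := by unfold unitN; rfl
  have hg : ∀ e ∈ (codeOf B).trans, (grdC (e + 1)).length ≤ 2 ^ (a + 4) := by
    intro e he
    refine le_trans ?_ ((lt_encPTA he).le.trans (hB.trans hab))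
    obtain ⟨e, -, rfl⟩ := List.mem_map.1 he
    rw [grdC_enc, List.length_map]
    unfold encPEdge
    refine le_trans ?_ (Nat.right_le_pair _ _)
    refine le_trans ?_ (Nat.right_le_pair _ _)
    exact (length_le_encList _ _).trans (Nat.left_le_pair _ _)
  have hgr := gsat_gr (N := N) (b := 2 ^ (a + 4)) (C := codeOf B) (L := bigL a) (K := a)
    (Nat.pow_le_pow_right two_pos (by omega : 4 ≤ a + 4))
    (by rw [← pow_succ]; exact Nat.pow_le_pow_right two_pos (by omega))
    (by
      rw [codeOf, List.length_map]
      exact (length_le_encList encPEdge _).trans ((encList_trans_le B).trans (hB.trans hab)))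
    hg φ (by unfold bigL; rfl) hφ le_rfl (c := dig a 0) (τ := 0)
    (fun π τ h => absurd (by rw [dig_zero]; rfl) h) (by rw [← hU, ← horN_eq ha]; exact hh)
    (dvd_zero _) none
  rw [psat_iff B N φ ∅ _ 0 none (by simp) (by simp) (by simp)]
  rw [← hU] at hgr
  have h0 : (fun π : ℕ => gr (unitN a) (dig a 0 π)) = fun _ => fn default := by
    funext π x
    rw [fn_default, dig_zero]
    simp [gr]
  rw [h0, Nat.cast_zero, zero_div] at hgr
  rw [hgr]
  exact satN_iff ha φ hφ (d := none) (by simp [posE]) hh hE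

end Track

/-- The bounded-time verification problem for HCMTL* in the
point-based semantics is decidable: there is a computable function which, on the code of
a triple `(B, φ, N)` of a point-based timed automaton, an HCMTL* sentence and a positive
natural time bound, decides whether `{}, 0, ε ⊨^N_B φ` under the point-based semantics. -/
theorem bounded_point_verification_decidable :
    ∃ dec : ℕ → Bool, Computable dec ∧
      ∀ (B : PTA ℕ) (φ : HF ℕ) (N : ℕ), φ.Sentence → 0 < N →
        (dec (Nat.pair (encPTA B) (Nat.pair (encHF φ) N)) = true ↔
          PSat natR B (some (N : ℝ)) φ ∅ (fun _ => default) 0 none) := by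
  classical
  have h : PrimrecPred fun a : ℕ => Track.satN a a.unpair.2.unpair.1 (Track.ptN 0 0 0) :=
    Track.pred_satN Track.prim_id (Track.prim_const _)
      (Track.prim_fst (Track.prim_unpair (Track.prim_snd (Track.prim_unpair Track.prim_id))))
  refine ⟨_, h.decide.to_comp, fun B φ N _ hN => ?_⟩
  rw [decide_eq_true_iff, ← Track.satN_psat B φ hN rfl]
  simp

end HyTime
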